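/- (Lower bound) There is an absolute constant c > 0 such that every finite set A ⊂ ℤ with |A| ≥ 2^{16} satisfies max{ dim^+(A), dim^×(A) } ≥ c·log|A|·√(log log|A| / log log log|A|). (Upper bound) There is an absolute constant C > 0 such that for every N there exists a finite set A ⊂ ℤ of positive integers with |A| ≥ N and max{ dim^+(A), dim^×(A) } ≤ C·log|A|·log log|A|. -/

import Mathlib

open Finset Pointwise

universe u

/-- A finset `Λ` in an abelian group is `k`-dissociated if every integer relation
`∑ ε_λ • λ = 0` with `|ε_λ| ≤ k` forces all `ε_λ = 0`. -/
def IsKDissociated {G : Type*} [AddCommGroup G] (k : ℕ) (Λ : Finset G) : Prop :=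
  ∀ ε : G → ℤ, (∀ x ∈ Λ, |ε x| ≤ (k : ℤ)) → (∑ x ∈ Λ, ε x • x) = 0 → ∀ x ∈ Λ, ε x = 0

/-- `addDim k A` is the maximal size of a `k`-dissociated subset of `A`. -/
noncomputable def addDim {G : Type*} [AddCommGroup G] (k : ℕ) (A : Finset G) : ℕ :=
  sSup {n : ℕ | ∃ Λ : Finset G, Λ ⊆ A ∧ Λ.card = n ∧ IsKDissociated k Λ}

/-- `nFold A n` is the `n`-fold sumset `A + A + ⋯ + A` (`n` summands). -/
def nFold {G : Type*} [AddCommGroup G] [DecidableEq G] (A : Finset G) : ℕ → Finset G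
  | 0 => {0}
  | n + 1 => nFold A n + A

/-- Multiplicative dissociativity over `ℚ` for a finset of nonzero integers: every relation
`∏ λ^{ε_λ} = 1` with `ε_λ ∈ {-1,0,1}` forces all `ε_λ = 0`. -/
def IsMulDissociated (Λ : Finset ℤ) : Prop :=
  ∀ ε : ℤ → ℤ, (∀ x ∈ Λ, |ε x| ≤ 1) → (∏ x ∈ Λ, (x : ℚ) ^ ε x) = 1 → ∀ x ∈ Λ, ε x = 0

/-- The multiplicative dimension of a finite set of integers: the maximal size of a
multiplicatively dissociated subset of nonzero elements. -/
noncomputable def mulDim (A : Finset ℤ) : ℕ :=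
  sSup {n : ℕ | ∃ Λ : Finset ℤ, Λ ⊆ A ∧ (0 : ℤ) ∉ Λ ∧ Λ.card = n ∧ IsMulDissociated Λ}

/-- The autocorrelation of `u` at shift `t`, for `u` supported in `J`. -/
def autocorr (J : Finset ℤ) (u : ℤ → ℝ) (t : ℤ) : ℝ := ∑ i ∈ J, u i * u (i + t)

/-- The additive energy of a weight `u` supported in `J`. -/
def energyInt (J : Finset ℤ) (u : ℤ → ℝ) : ℝ := ∑ t ∈ J - J, autocorr J u t ^ 2

lemma sum_shift_eq (J D : Finset ℤ) (g : ℤ → ℝ) (hg : ∀ x, x ∉ J → g x = 0) (i : ℤ)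
    (hD : ∀ k ∈ J, k - i ∈ D) : ∑ t ∈ D, g (i + t) = ∑ k ∈ J, g k := by
  symm
  apply Finset.sum_of_injOn (fun k => k - i)
  · intro a _ b _ h
    simpa using h
  · intro k hk
    exact hD k hk
  · intro t _ ht
    apply hg
    intro h
    exact ht ⟨i + t, h, by simp⟩
  · intro k _
    simp

lemma sum_shift_le (J D : Finset ℤ) (g : ℤ → ℝ) (hg : ∀ x, x ∉ J → g x = 0)
    (hg0 : ∀ x, 0 ≤ g x) (i : ℤ) : ∑ t ∈ D, g (i + t) ≤ ∑ k ∈ J, g k := by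
  classical
  rw [← sum_shift_eq J (D ∪ J.image (fun k => k - i)) g hg i]
  · exact Finset.sum_le_sum_of_subset_of_nonneg subset_union_left (fun _ _ _ => hg0 _)
  · intro k hk
    exact mem_union_right _ (mem_image_of_mem _ hk)

lemma sum_shift_reflect_le (J D : Finset ℤ) (g : ℤ → ℝ) (hg : ∀ x, x ∉ J → g x = 0)
    (hg0 : ∀ x, 0 ≤ g x) (i : ℤ) : ∑ t ∈ D, g (i - t) ≤ ∑ k ∈ J, g k := by
  have h := sum_shift_le J (D.image Neg.neg) g hg hg0 i
  rw [Finset.sum_image (fun a _ b _ h => neg_injective h)] at h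
  simpa [sub_eq_add_neg] using h

lemma sum_diff_shift (J : Finset ℤ) (F : ℤ → ℤ → ℝ) (hF : ∀ i k, k ∉ J → F i k = 0) :
    ∑ t ∈ J - J, ∑ i ∈ J, F i (i + t) = ∑ i ∈ J, ∑ k ∈ J, F i k := by
  rw [Finset.sum_comm]
  refine Finset.sum_congr rfl fun i hi => ?_
  exact sum_shift_eq J (J - J) (F i) (hF i) i fun k hk => Finset.sub_mem_sub hk hi

/-- An autocorrelation deficit controls the mass of a half-open interval. -/
lemma interval_mass_sq_le (J : Finset ℤ) (s : ℤ → ℝ) (hs : ∀ x, x ∉ J → s x = 0) (t : ℤ)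
    (P : ℝ) (hP : P = ∑ i ∈ J, s i ^ 2) (m : ℤ) :
    (∑ i ∈ J, (if i ≤ m + t then s i ^ 2 else 0) - ∑ i ∈ J, if i ≤ m then s i ^ 2 else 0) ^ 2
      ≤ (2 * P - 2 * autocorr J s t) * (2 * P + 2 * autocorr J s t) := by
  classical
  set W := J ∪ J.image (fun k => k - t) with hW
  have hshift : ∀ g : ℤ → ℝ, (∀ x, x ∉ J → g x = 0) → ∑ l ∈ W, g (l + t) = ∑ k ∈ J, g k := by
    intro g hg
    have := sum_shift_eq J W g hg t (fun k hk => mem_union_right _ (mem_image_of_mem _ hk))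
    simpa [add_comm] using this
  have hid : ∀ g : ℤ → ℝ, (∀ x, x ∉ J → g x = 0) → ∑ l ∈ W, g l = ∑ k ∈ J, g k := by
    intro g hg
    exact (Finset.sum_subset subset_union_left (fun x _ hx => hg x hx)).symm
  have e1 : ∑ l ∈ W, s l ^ 2 = P := by
    rw [hP]; exact hid (fun l => s l ^ 2) (fun x hx => by simp [hs x hx])
  have e2 : ∑ l ∈ W, s (l + t) ^ 2 = P := by
    rw [hP]; exact hshift (fun l => s l ^ 2) (fun x hx => by simp [hs x hx])
  have e3 : ∑ l ∈ W, s l * s (l + t) = autocorr J s t :=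
    hid (fun l => s l * s (l + t)) (fun x hx => by simp [hs x hx])
  have e4 : ∑ i ∈ J, (if i ≤ m + t then s i ^ 2 else 0) - (∑ i ∈ J, if i ≤ m then s i ^ 2 else 0)
      = ∑ l ∈ W, (if l ≤ m then (s (l + t) - s l) else 0) * (s (l + t) + s l) := by
    rw [← hshift (fun i => if i ≤ m + t then s i ^ 2 else 0) (fun x hx => by simp [hs x hx]),
      ← hid (fun i => if i ≤ m then s i ^ 2 else 0) (fun x hx => by simp [hs x hx]),
      ← Finset.sum_sub_distrib]
    refine Finset.sum_congr rfl fun l _ => ?_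
    by_cases h : l ≤ m <;> simp [h]
    ring
  rw [e4]
  refine (Finset.sum_mul_sq_le_sq_mul_sq _ _ _).trans ?_
  have h1 : ∑ l ∈ W, (if l ≤ m then (s (l + t) - s l) else 0) ^ 2 ≤ 2 * P - 2 * autocorr J s t := by
    calc _ ≤ ∑ l ∈ W, (s (l + t) ^ 2 + s l ^ 2 - 2 * (s l * s (l + t))) := by
          refine Finset.sum_le_sum fun l _ => ?_
          by_cases h : l ≤ m <;> simp [h] <;> nlinarith [sq_nonneg (s (l + t) - s l)]
      _ = _ := by
          rw [Finset.sum_sub_distrib, Finset.sum_add_distrib, ← Finset.mul_sum, e1, e2, e3]; ring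
  have h2 : ∑ l ∈ W, (s (l + t) + s l) ^ 2 = 2 * P + 2 * autocorr J s t := by
    calc _ = ∑ l ∈ W, (s (l + t) ^ 2 + s l ^ 2 + 2 * (s l * s (l + t))) := by
          refine Finset.sum_congr rfl fun l _ => ?_
          ring
      _ = _ := by
          rw [Finset.sum_add_distrib, Finset.sum_add_distrib, ← Finset.mul_sum, e1, e2, e3]; ring
  rw [h2]
  refine mul_le_mul_of_nonneg_right h1 ?_
  rw [← h2]
  exact Finset.sum_nonneg fun _ _ => sq_nonneg _

lemma autocorr_le (J : Finset ℤ) (s : ℤ → ℝ) (hs : ∀ x, x ∉ J → s x = 0) (t : ℤ) :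
    autocorr J s t ≤ ∑ i ∈ J, s i ^ 2 := by
  have h := sum_shift_le J J (fun i => s i ^ 2) (fun x hx => by simp [hs x hx])
    (fun _ => sq_nonneg _) t
  have : autocorr J s t ≤ ∑ i ∈ J, (s i ^ 2 + s (t + i) ^ 2) / 2 := by
    refine Finset.sum_le_sum fun i _ => ?_
    rw [add_comm t i]
    nlinarith [sq_nonneg (s i - s (i + t))]
  rw [← Finset.sum_div, Finset.sum_add_distrib] at this
  linarith

/-- The mass of the closed interval spanned by `i` and `k`. -/
def spanMass (J : Finset ℤ) (w : ℤ → ℝ) (i k : ℤ) : ℝ :=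
  ∑ l ∈ J, if (i ≤ l ∧ l ≤ k) ∨ (k ≤ l ∧ l ≤ i) then w l else 0

lemma autocorr_nonneg (J : Finset ℤ) (s : ℤ → ℝ) (h : ∀ x, 0 ≤ s x) (t : ℤ) :
    0 ≤ autocorr J s t :=
  Finset.sum_nonneg fun _ _ => mul_nonneg (h _) (h _)

lemma spanMass_sq_le_of_lt (J : Finset ℤ) (s : ℤ → ℝ) (hs : ∀ x, x ∉ J → s x = 0)
    (hs0 : ∀ x, 0 ≤ s x) (P : ℝ) (hP : P = ∑ i ∈ J, s i ^ 2) (i k : ℤ) (hik : i < k) :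
    spanMass J (fun l => s l ^ 2) i k ^ 2 ≤ 32 * P * (P - autocorr J s (k - i)) := by
  have h1 := interval_mass_sq_le J s hs (k - i) P hP i
  have h2 := interval_mass_sq_le J s hs (k - i) P hP (i - 1)
  have hB := autocorr_le J s hs (k - i)
  have hB0 := autocorr_nonneg J s hs0 (k - i)
  rw [← hP] at hB
  rw [← Finset.sum_sub_distrib] at h1 h2
  set X := ∑ x ∈ J, ((if x ≤ i + (k - i) then s x ^ 2 else 0) - if x ≤ i then s x ^ 2 else 0)
  set Y := ∑ x ∈ J, ((if x ≤ i - 1 + (k - i) then s x ^ 2 else 0) - if x ≤ i - 1 then s x ^ 2 else 0)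
  have hXY : spanMass J (fun l => s l ^ 2) i k ≤ X + Y := by
    rw [← Finset.sum_add_distrib]
    refine Finset.sum_le_sum fun l _ => ?_
    have := sq_nonneg (s l)
    split_ifs <;> first | omega | linarith
  have h0 : 0 ≤ spanMass J (fun l => s l ^ 2) i k :=
    Finset.sum_nonneg fun l _ => by split_ifs <;> positivity
  have hbd : (2 * P - 2 * autocorr J s (k - i)) * (2 * P + 2 * autocorr J s (k - i))
      ≤ 8 * P * (P - autocorr J s (k - i)) := by
    nlinarith
  nlinarith [sq_nonneg (X - Y)]

lemma autocorr_neg (J : Finset ℤ) (s : ℤ → ℝ) (hs : ∀ x, x ∉ J → s x = 0) (t : ℤ) :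
    autocorr J s (-t) = autocorr J s t := by
  have := sum_shift_eq J (J ∪ J.image (fun k => k - (-t))) (fun x => s x * s (x + t))
    (fun x hx => by simp [hs x hx]) (-t) (fun k hk => mem_union_right _ (mem_image_of_mem _ hk))
  rw [autocorr, autocorr, ← this]
  rw [Finset.sum_subset (subset_union_left (s₂ := J.image (fun k => k - (-t))))]
  · refine Finset.sum_congr rfl fun x _ => ?_
    rw [mul_comm, add_comm (-t) x, neg_add_cancel_right]
  · intro x _ hx
    simp [hs x hx]

lemma spanMass_sq_le (J : Finset ℤ) (s : ℤ → ℝ) (hs : ∀ x, x ∉ J → s x = 0)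
    (hs0 : ∀ x, 0 ≤ s x) (P : ℝ) (hP : P = ∑ i ∈ J, s i ^ 2) (i k : ℤ) (hik : i ≠ k) :
    spanMass J (fun l => s l ^ 2) i k ^ 2 ≤ 32 * P * (P - autocorr J s (k - i)) := by
  rcases lt_or_gt_of_ne hik with h | h
  · exact spanMass_sq_le_of_lt J s hs hs0 P hP i k h
  · have := spanMass_sq_le_of_lt J s hs hs0 P hP k i h
    rw [← neg_sub k i, autocorr_neg J s hs] at this
    convert this using 2
    unfold spanMass
    refine Finset.sum_congr rfl fun l _ => ?_
    simp only [or_comm]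

/-- Some element of a triple lies between the other two. -/
lemma sum_spanMass_ge (J : Finset ℤ) (w : ℤ → ℝ) (hw : ∀ x, 0 ≤ w x) :
    (∑ i ∈ J, w i) ^ 3 - ∑ i ∈ J, w i ^ 3 ≤
      3 * ∑ i ∈ J, ∑ k ∈ J, (if i ≠ k then w i * w k * spanMass J w i k else 0) := by
  set G : ℤ → ℤ → ℤ → ℝ := fun i k l =>
    if i ≠ k ∧ ((i ≤ l ∧ l ≤ k) ∨ (k ≤ l ∧ l ≤ i)) then w i * w k * w l else 0 with hG
  have h0 : ∑ i ∈ J, ∑ k ∈ J, (if i ≠ k then w i * w k * spanMass J w i k else 0)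
      = ∑ i ∈ J, ∑ k ∈ J, ∑ l ∈ J, G i k l := by
    refine Finset.sum_congr rfl fun i _ => Finset.sum_congr rfl fun k _ => ?_
    by_cases h : i = k
    · simp [hG, h]
    · simp only [hG, h, ne_eq, not_false_eq_true, if_true, true_and, spanMass, Finset.mul_sum,
        mul_ite, mul_zero]
  have h1 : ∑ i ∈ J, ∑ k ∈ J, ∑ l ∈ J, G i k l = ∑ i ∈ J, ∑ k ∈ J, ∑ l ∈ J, G i l k := by
    refine Finset.sum_congr rfl fun i _ => ?_
    rw [Finset.sum_comm]
  have h2 : ∑ i ∈ J, ∑ k ∈ J, ∑ l ∈ J, G i k l = ∑ i ∈ J, ∑ k ∈ J, ∑ l ∈ J, G k l i := by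
    rw [Finset.sum_comm]
    rw [Finset.sum_congr rfl fun i _ => Finset.sum_comm]
    rw [Finset.sum_comm]
    rw [Finset.sum_congr rfl fun i _ => Finset.sum_comm]
  have h3 : (∑ i ∈ J, w i) ^ 3 = ∑ i ∈ J, ∑ k ∈ J, ∑ l ∈ J, w i * w k * w l := by
    rw [pow_succ, pow_two, Finset.sum_mul_sum, Finset.sum_mul]
    refine Finset.sum_congr rfl fun i _ => ?_
    rw [Finset.sum_mul_sum]
  have h4 : ∑ i ∈ J, w i ^ 3 = ∑ i ∈ J, ∑ k ∈ J, ∑ l ∈ J,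
      (if i = k then (if i = l then w i * w k * w l else 0) else 0) := by
    refine Finset.sum_congr rfl fun i hi => ?_
    have : ∀ k ∈ J, (∑ l ∈ J, (if i = k then (if i = l then w i * w k * w l else 0) else 0))
        = if i = k then w i * w k * w i else 0 := by
      intro k _
      by_cases h : i = k
      · simp [h]
        intro h'; exact absurd (h ▸ hi) h'
      · simp [h]
    rw [Finset.sum_congr rfl this]
    simp [hi]
    ring
  have : (3 : ℝ) * ∑ i ∈ J, ∑ k ∈ J, ∑ l ∈ J, G i k l = ∑ i ∈ J, ∑ k ∈ J, ∑ l ∈ J,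
      (G i k l + G i l k + G k l i) := by
    simp only [Finset.sum_add_distrib]
    rw [← h1, ← h2]; ring
  rw [h0, this, h3, h4]
  simp only [← Finset.sum_sub_distrib]
  refine Finset.sum_le_sum fun i _ => Finset.sum_le_sum fun k _ => Finset.sum_le_sum fun l _ => ?_
  have hp : 0 ≤ w i * w k * w l := mul_nonneg (mul_nonneg (hw _) (hw _)) (hw _)
  have e1 : w i * w l * w k = w i * w k * w l := by ring
  have e2 : w k * w l * w i = w i * w k * w l := by ring
  simp only [hG, e1, e2]
  split_ifs <;> first | omega | linarith

lemma energyInt_cube_le (J : Finset ℤ) (r : ℤ → ℝ) :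
    energyInt J (fun i => r i ^ 3) ≤
      ∑ t ∈ J - J, autocorr J (fun i => r i ^ 4) t * autocorr J (fun i => r i ^ 2) t := by
  refine Finset.sum_le_sum fun t _ => ?_
  have e1 : autocorr J (fun i => r i ^ 3) t ^ 2 = ∑ i ∈ J, ∑ l ∈ J,
      (r i ^ 3 * r (i + t) ^ 3) * (r l ^ 3 * r (l + t) ^ 3) := by
    rw [pow_two, autocorr, Finset.sum_mul_sum]
  have e2 : autocorr J (fun i => r i ^ 4) t * autocorr J (fun i => r i ^ 2) t = ∑ i ∈ J, ∑ l ∈ J,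
      (r i ^ 4 * r (i + t) ^ 4) * (r l ^ 2 * r (l + t) ^ 2) := by
    rw [autocorr, autocorr, Finset.sum_mul_sum]
  have e3 : autocorr J (fun i => r i ^ 4) t * autocorr J (fun i => r i ^ 2) t = ∑ i ∈ J, ∑ l ∈ J,
      (r l ^ 4 * r (l + t) ^ 4) * (r i ^ 2 * r (i + t) ^ 2) := by
    rw [e2, Finset.sum_comm]
  have : 2 * autocorr J (fun i => r i ^ 3) t ^ 2 ≤
      autocorr J (fun i => r i ^ 4) t * autocorr J (fun i => r i ^ 2) t +
      autocorr J (fun i => r i ^ 4) t * autocorr J (fun i => r i ^ 2) t := by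
    nth_rw 1 [e2]
    rw [e3, e1, Finset.mul_sum, ← Finset.sum_add_distrib]
    refine Finset.sum_le_sum fun i _ => ?_
    rw [Finset.mul_sum, ← Finset.sum_add_distrib]
    refine Finset.sum_le_sum fun l _ => ?_
    nlinarith [sq_nonneg (r i ^ 2 * r (i + t) ^ 2 * (r l * r (l + t)) -
      r l ^ 2 * r (l + t) ^ 2 * (r i * r (i + t)))]
  linarith

lemma sum_autocorr (J : Finset ℤ) (w : ℤ → ℝ) (hw : ∀ x, x ∉ J → w x = 0) :
    ∑ t ∈ J - J, autocorr J w t = (∑ i ∈ J, w i) ^ 2 := by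
  unfold autocorr
  rw [sum_diff_shift J (fun i k => w i * w k) (fun i k hk => by simp [hw k hk]), pow_two,
    Finset.sum_mul_sum]

/-- Young's inequality for the additive energy on `ℤ`. -/
lemma energyInt_cube_le_sum_pow (J : Finset ℤ) (r : ℤ → ℝ) (hr : ∀ x, x ∉ J → r x = 0) :
    energyInt J (fun i => r i ^ 3) ≤ (∑ i ∈ J, r i ^ 4) ^ 3 := by
  refine (energyInt_cube_le J r).trans ?_
  have h4 : ∀ x, x ∉ J → r x ^ 4 = 0 := fun x hx => by simp [hr x hx]
  calc _ ≤ ∑ t ∈ J - J, autocorr J (fun i => r i ^ 4) t * ∑ i ∈ J, r i ^ 4 := by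
        refine Finset.sum_le_sum fun t _ => mul_le_mul_of_nonneg_left ?_
          (autocorr_nonneg _ _ (fun x => by positivity) _)
        refine (autocorr_le J _ (fun x hx => by simp [hr x hx]) t).trans (le_of_eq ?_)
        exact Finset.sum_congr rfl fun i _ => by ring
    _ = _ := by
        rw [← Finset.sum_mul, sum_autocorr J (fun i => r i ^ 4) h4]; ring

/-- Young's inequality with a gain when the mass is not concentrated at a point. -/
lemma energyInt_cube_le_of_spread (J : Finset ℤ) (r : ℤ → ℝ) (hr : ∀ x, x ∉ J → r x = 0)
    (P η : ℝ) (hP : P = ∑ i ∈ J, r i ^ 4) (hP0 : 0 < P) (hη : 0 ≤ η) (hη1 : η ≤ 1)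
    (hmax : ∀ i ∈ J, r i ^ 4 ≤ (1 - η) * P) :
    energyInt J (fun i => r i ^ 3) ≤ P ^ 3 * (1 - η ^ 2 / 288) := by
  set w : ℤ → ℝ := fun i => r i ^ 4 with hw
  have hw0 : ∀ x, 0 ≤ w x := fun x => by simp only [hw]; positivity
  have hwJ : ∀ x, x ∉ J → w x = 0 := fun x hx => by simp [hw, hr x hx]
  have hs : (fun l => (r l ^ 2) ^ 2) = w := by
    funext l; simp only [hw]; ring
  have hP' : P = ∑ i ∈ J, (r i ^ 2) ^ 2 := by
    rw [hP]; exact Finset.sum_congr rfl fun i _ => by ring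
  have hcube : ∑ i ∈ J, w i ^ 3 ≤ (1 - η) * P ^ 3 := by
    calc ∑ i ∈ J, w i ^ 3 ≤ ∑ i ∈ J, (1 - η) * P ^ 2 * w i := by
          refine Finset.sum_le_sum fun i hi => ?_
          have h1 : w i ≤ (1 - η) * P := hmax i hi
          have h2 : w i ≤ P := by nlinarith
          have h3 := mul_le_mul h1 h2 (hw0 i) (by nlinarith)
          nlinarith [hw0 i]
      _ = (1 - η) * P ^ 3 := by rw [← Finset.mul_sum, ← hP]; ring
  have hX := sum_spanMass_ge J w hw0
  rw [← hP] at hX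
  set X := ∑ i ∈ J, ∑ k ∈ J, (if i ≠ k then w i * w k * spanMass J w i k else 0) with hXdef
  have hXge : η * P ^ 3 / 3 ≤ X := by linarith
  have hX0 : 0 ≤ η * P ^ 3 / 3 := by positivity
  set Y := ∑ i ∈ J, ∑ k ∈ J, (if i ≠ k then w i * w k * spanMass J w i k ^ 2 else 0) with hYdef
  have hsum2 : ∑ i ∈ J, ∑ k ∈ J, w i * w k = P ^ 2 := by
    rw [hP, pow_two, Finset.sum_mul_sum]
  have hCS : X ^ 2 ≤ P ^ 2 * Y := by
    have h := Finset.sum_mul_sq_le_sq_mul_sq (J ×ˢ J) (fun p => Real.sqrt (w p.1 * w p.2))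
      (fun p => if p.1 ≠ p.2 then Real.sqrt (w p.1 * w p.2) * spanMass J w p.1 p.2 else 0)
    have g1 : ∀ p : ℤ × ℤ, Real.sqrt (w p.1 * w p.2) ^ 2 = w p.1 * w p.2 :=
      fun p => Real.sq_sqrt (mul_nonneg (hw0 _) (hw0 _))
    have a1 : ∑ p ∈ J ×ˢ J, Real.sqrt (w p.1 * w p.2) *
        (if p.1 ≠ p.2 then Real.sqrt (w p.1 * w p.2) * spanMass J w p.1 p.2 else 0) = X := by
      rw [hXdef, ← Finset.sum_product']
      refine Finset.sum_congr rfl fun p _ => ?_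
      rw [mul_ite, mul_zero, ← mul_assoc, ← pow_two, g1]
    have a2 : ∑ p ∈ J ×ˢ J, Real.sqrt (w p.1 * w p.2) ^ 2 = P ^ 2 := by
      rw [← hsum2, ← Finset.sum_product']
      exact Finset.sum_congr rfl fun p _ => g1 p
    have a3 : ∑ p ∈ J ×ˢ J,
        (if p.1 ≠ p.2 then Real.sqrt (w p.1 * w p.2) * spanMass J w p.1 p.2 else 0) ^ 2 = Y := by
      rw [hYdef, ← Finset.sum_product']
      refine Finset.sum_congr rfl fun p _ => ?_
      rw [ite_pow, mul_pow, g1]; simp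
    rwa [a1, a2, a3] at h
  have hY : η ^ 2 * P ^ 4 / 9 ≤ Y := by
    have h1 : (η * P ^ 3 / 3) ^ 2 ≤ P ^ 2 * Y := (pow_le_pow_left₀ hX0 hXge 2).trans hCS
    have h2 : P ^ 2 * (η ^ 2 * P ^ 4 / 9) ≤ P ^ 2 * Y := by
      refine le_trans (le_of_eq ?_) h1; ring
    exact le_of_mul_le_mul_left h2 (by positivity)
  have hdef : 32 * P * energyInt J (fun i => r i ^ 3) ≤ 32 * P * (P * P ^ 2) - Y := by
    have h1 : ∑ t ∈ J - J, autocorr J w t * autocorr J (fun i => r i ^ 2) t =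
        ∑ i ∈ J, ∑ k ∈ J, w i * w k * autocorr J (fun i => r i ^ 2) (k - i) := by
      rw [← sum_diff_shift J (fun i k => w i * w k * autocorr J (fun i => r i ^ 2) (k - i))
        (fun i k hk => by simp [hwJ k hk])]
      refine Finset.sum_congr rfl fun t _ => ?_
      rw [autocorr, Finset.sum_mul]
      simp
    have h2 : 32 * P * energyInt J (fun i => r i ^ 3) ≤
        32 * P * ∑ i ∈ J, ∑ k ∈ J, w i * w k * autocorr J (fun i => r i ^ 2) (k - i) := by
      rw [← h1]
      exact mul_le_mul_of_nonneg_left (energyInt_cube_le J r) (by positivity)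
    refine h2.trans ?_
    rw [← hsum2, hYdef]
    simp only [Finset.mul_sum]
    rw [← Finset.sum_sub_distrib]
    refine Finset.sum_le_sum fun i _ => ?_
    rw [← Finset.sum_sub_distrib]
    refine Finset.sum_le_sum fun k _ => ?_
    have hwk : 0 ≤ w i * w k := mul_nonneg (hw0 _) (hw0 _)
    by_cases hik : i = k
    · have hB := autocorr_le J (fun i => r i ^ 2) (fun x hx => by simp [hr x hx]) (k - i)
      rw [← hP'] at hB
      simp only [hik, ne_eq, not_true_eq_false, if_false, sub_zero]
      rw [hik] at hB hwk
      have := mul_le_mul_of_nonneg_left hB hwk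
      nlinarith
    · have hB := spanMass_sq_le J (fun i => r i ^ 2) (fun x hx => by simp [hr x hx])
        (fun x => by positivity) P hP' i k hik
      rw [hs] at hB
      simp only [hik, ne_eq, not_false_eq_true, if_true]
      have := mul_le_mul_of_nonneg_left hB hwk
      nlinarith
  have : 32 * P * energyInt J (fun i => r i ^ 3) ≤ 32 * P * (P ^ 3 * (1 - η ^ 2 / 288)) := by
    refine hdef.trans ?_
    nlinarith
  exact le_of_mul_le_mul_left this (by positivity)

/-- Expansion of the energy around one index. -/
lemma energyInt_le_of_point (J : Finset ℤ) (u : ℤ → ℝ) (hu : ∀ x, x ∉ J → u x = 0)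
    (hu0 : ∀ x, 0 ≤ u x) (o : ℤ) (ho : o ∈ J) (v : ℤ → ℝ) (hv : v = Function.update u o 0) :
    energyInt J u ≤ u o ^ 4 + 10 * u o ^ 2 * (∑ i ∈ J, v i ^ 2) + 3 * energyInt J v := by
  set Q := ∑ i ∈ J, v i ^ 2 with hQ
  have hvJ : ∀ x, x ∉ J → v x = 0 := fun x hx => by
    rw [hv]; by_cases h : x = o
    · simp [h]
    · simp [h, hu x hx]
  have hvo : v o = 0 := by simp [hv]
  have huv : ∀ x, u x = (if x = o then u o else 0) + v x := fun x => by
    by_cases h : x = o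
    · simp [h, hvo]
    · simp [hv, h]
  have hv0 : ∀ x, 0 ≤ v x := fun x => by
    by_cases h : x = o
    · simp [h, hvo]
    · simp [hv, h, hu0]
  have hexp : ∀ t, autocorr J u t = (if t = 0 then u o ^ 2 else 0) + u o * v (o + t) +
      u o * v (o - t) + autocorr J v t := by
    intro t
    have h1 : ∀ i ∈ J, u i * u (i + t) = (if i = o then (if t = 0 then u o ^ 2 else 0) else 0) +
        (if i = o then u o * v (o + t) else 0) + v i * (if i = o - t then u o else 0)
         + v i * v (i + t) := by
      intro i _
      rw [huv i, huv (i + t)]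
      by_cases h : i = o
      · subst h
        by_cases ht : t = 0 <;> simp [ht, hvo]
        · ring
      · by_cases h' : i + t = o
        · have : i = o - t := by omega
          simp [h, h']; simp [this]; ring
        · have : i ≠ o - t := by omega
          simp [h, h', this]
    rw [autocorr, Finset.sum_congr rfl h1]
    simp only [Finset.sum_add_distrib, Finset.sum_ite_eq', ho, if_true, mul_ite, mul_zero]
    congr 2
    by_cases h : o - t ∈ J
    · simp [h]; ring
    · simp [h, hvJ _ h]
  have h0mem : (0 : ℤ) ∈ J - J := by simpa using Finset.sub_mem_sub ho ho
  have hR0 : autocorr J u 0 = u o ^ 2 + Q := by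
    rw [hexp 0]; simp [hvo, autocorr, hQ, pow_two]
  have hbound : ∀ t ∈ J - J, autocorr J u t ^ 2 ≤
      (if t = 0 then u o ^ 4 + 2 * u o ^ 2 * Q + autocorr J v 0 ^ 2 else 0) +
      4 * u o ^ 2 * v (o + t) ^ 2 + 4 * u o ^ 2 * v (o - t) ^ 2 + 2 * autocorr J v t ^ 2 := by
    intro t _
    by_cases ht : t = 0
    · have hv' : autocorr J v 0 = Q := by simp [autocorr, hQ, pow_two]
      subst ht
      rw [hR0]
      simp only [if_true, add_zero, sub_zero, hvo, hv']
      nlinarith [sq_nonneg Q]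
    · rw [hexp t]
      simp only [ht, if_false, zero_add]
      nlinarith [sq_nonneg (u o * v (o + t) - u o * v (o - t)),
        sq_nonneg (u o * v (o + t) + u o * v (o - t) - autocorr J v t)]
  calc energyInt J u ≤ _ := Finset.sum_le_sum hbound
    _ = (u o ^ 4 + 2 * u o ^ 2 * Q + autocorr J v 0 ^ 2) +
        4 * u o ^ 2 * ∑ t ∈ J - J, v (o + t) ^ 2 + 4 * u o ^ 2 * ∑ t ∈ J - J, v (o - t) ^ 2 +
        2 * energyInt J v := by
      simp only [Finset.sum_add_distrib, ← Finset.mul_sum, Finset.sum_ite_eq', h0mem, if_true,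
        energyInt]
    _ ≤ _ := by
      have a1 := sum_shift_le J (J - J) (fun x => v x ^ 2) (fun x hx => by simp [hvJ x hx])
        (fun x => sq_nonneg _) o
      have a2 := sum_shift_reflect_le J (J - J) (fun x => v x ^ 2) (fun x hx => by simp [hvJ x hx])
        (fun x => sq_nonneg _) o
      have a3 : autocorr J v 0 ^ 2 ≤ energyInt J v :=
        Finset.single_le_sum (f := fun t => autocorr J v t ^ 2) (fun _ _ => sq_nonneg _) h0mem
      rw [← hQ] at a1 a2
      have b1 := mul_le_mul_of_nonneg_left a1 (show 0 ≤ 4 * u o ^ 2 by positivity)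
      have b2 := mul_le_mul_of_nonneg_left a2 (show 0 ≤ 4 * u o ^ 2 by positivity)
      nlinarith

lemma sum_pow_four_cube_le (s : Finset ℤ) (r B a V : ℤ → ℝ) (b : ℝ) (hb : 0 < b) (hb1 : b ≤ 1 / 2)
    (hB : ∀ i, 0 ≤ B i) (ha : ∀ i, 0 ≤ a i) (hV : ∀ i, 0 ≤ V i)
    (hrB : ∀ i ∈ s, r i ^ 12 ≤ B i * a i ^ (2 - b) * V i ^ b) :
    (∑ i ∈ s, r i ^ 4) ^ 3 ≤ (∑ i ∈ s, B i) * (∑ i ∈ s, a i) ^ (2 - b) * (∑ i ∈ s, V i) ^ b := by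
  set X := ∑ i ∈ s, B i with hX
  set Y := ∑ i ∈ s, a i with hY
  set Z := ∑ i ∈ s, V i with hZ
  have hX0 : 0 ≤ X := Finset.sum_nonneg fun i _ => hB i
  have hY0 : 0 ≤ Y := Finset.sum_nonneg fun i _ => ha i
  have hZ0 : 0 ≤ Z := Finset.sum_nonneg fun i _ => hV i
  have hRHS : 0 ≤ X * Y ^ (2 - b) * Z ^ b := by positivity
  by_cases hzero : X = 0 ∨ Y = 0 ∨ Z = 0
  · have h0 : ∀ i ∈ s, r i ^ 4 = 0 := by
      intro i hi
      have h1 : r i ^ 12 ≤ 0 := by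
        refine (hrB i hi).trans (le_of_eq ?_)
        rcases hzero with h | h | h
        · rw [(Finset.sum_eq_zero_iff_of_nonneg fun i _ => hB i).1 h i hi]; simp
        · rw [(Finset.sum_eq_zero_iff_of_nonneg fun i _ => ha i).1 h i hi,
            Real.zero_rpow (by linarith)]; simp
        · rw [(Finset.sum_eq_zero_iff_of_nonneg fun i _ => hV i).1 h i hi,
            Real.zero_rpow hb.ne']; simp
      have h2 : r i ^ 12 = 0 := le_antisymm h1 (by positivity)
      have h3 : r i = 0 := by simpa using h2
      simp [h3]
    rw [Finset.sum_eq_zero h0]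
    simpa using hRHS
  push Not at hzero
  obtain ⟨hXn, hYn, hZn⟩ := hzero
  have hXp : 0 < X := lt_of_le_of_ne hX0 hXn.symm
  have hYp : 0 < Y := lt_of_le_of_ne hY0 hYn.symm
  have hZp : 0 < Z := lt_of_le_of_ne hZ0 hZn.symm
  set K3 := X * Y ^ (2 - b) * Z ^ b with hK3
  set K := K3 ^ (1 / 3 : ℝ) with hK
  have hK0 : 0 ≤ K := by positivity
  have hKc : K ^ 3 = K3 := by
    rw [hK, ← Real.rpow_natCast, ← Real.rpow_mul hRHS]; norm_num
  have hterm : ∀ i ∈ s, r i ^ 4 ≤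
      K * (1 / 3 * (B i / X) + (2 - b) / 3 * (a i / Y) + b / 3 * (V i / Z)) := by
    intro i hi
    have hBx : 0 ≤ B i / X := div_nonneg (hB i) hX0
    have hay : 0 ≤ a i / Y := div_nonneg (ha i) hY0
    have hvz : 0 ≤ V i / Z := div_nonneg (hV i) hZ0
    have hg := Real.geom_mean_le_arith_mean3_weighted (w₁ := 1 / 3) (w₂ := (2 - b) / 3)
      (w₃ := b / 3) (by norm_num) (by linarith) (by linarith) hBx hay hvz (by ring)
    set G := (B i / X) ^ (1 / 3 : ℝ) * (a i / Y) ^ ((2 - b) / 3) * (V i / Z) ^ (b / 3) with hG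
    have hG0 : 0 ≤ G := by positivity
    have hGc : G ^ 3 = (B i / X) * (a i / Y) ^ (2 - b) * (V i / Z) ^ b := by
      rw [hG, mul_pow, mul_pow]
      congr 1
      · congr 1
        · rw [← Real.rpow_natCast, ← Real.rpow_mul hBx]; norm_num
        · rw [← Real.rpow_natCast, ← Real.rpow_mul hay]; congr 1; push_cast; ring
      · rw [← Real.rpow_natCast, ← Real.rpow_mul hvz]; congr 1; push_cast; ring
    have h3 : (r i ^ 4) ^ 3 ≤ (K * G) ^ 3 := by
      rw [mul_pow, hKc, hGc, hK3]
      have : X * Y ^ (2 - b) * Z ^ b * (B i / X * (a i / Y) ^ (2 - b) * (V i / Z) ^ b)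
          = B i * a i ^ (2 - b) * V i ^ b := by
        rw [Real.div_rpow (ha i) hY0, Real.div_rpow (hV i) hZ0]
        have := (Real.rpow_pos_of_pos hYp (2 - b)).ne'
        have := (Real.rpow_pos_of_pos hZp b).ne'
        field_simp
      rw [this, ← pow_mul]
      exact hrB i hi
    have h4 : r i ^ 4 ≤ K * G := le_of_pow_le_pow_left₀ (by norm_num) (by positivity) h3
    exact h4.trans (mul_le_mul_of_nonneg_left hg hK0)
  have hsum : ∑ i ∈ s, r i ^ 4 ≤ K := by
    refine (Finset.sum_le_sum hterm).trans (le_of_eq ?_)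
    rw [← Finset.mul_sum, Finset.sum_add_distrib, Finset.sum_add_distrib, ← Finset.mul_sum,
      ← Finset.mul_sum, ← Finset.mul_sum, ← Finset.sum_div, ← Finset.sum_div, ← Finset.sum_div,
      ← hX, ← hY, ← hZ, div_self hXn, div_self hYn, div_self hZn]
    ring
  calc _ ≤ K ^ 3 := pow_le_pow_left₀ (Finset.sum_nonneg fun i _ => by positivity) hsum 3
    _ = K3 := hKc

lemma rpow_le_self_of_one_le {y e : ℝ} (hy : 0 ≤ y) (hy1 : y ≤ 1) (he : 1 ≤ e) : y ^ e ≤ y := by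
  rcases hy.eq_or_lt with h | h
  · rw [← h, Real.zero_rpow (by linarith)]
  · simpa using Real.rpow_le_rpow_of_exponent_ge h hy1 he

/-- Energy of a concentrated profile. -/
lemma energyInt_cube_le_one_of_concentrated (J : Finset ℤ) (r B a V : ℤ → ℝ) (b C : ℝ) (hb : 0 < b)
    (hb1 : b ≤ 1 / 2) (hC : C ^ b ≤ 2)
    (hr : ∀ x, x ∉ J → r x = 0) (hr0 : ∀ x, 0 ≤ r x)
    (hB : ∀ i, 0 ≤ B i) (ha : ∀ i, 0 ≤ a i) (hV : ∀ i, 0 ≤ V i) (hV1 : ∀ i ∈ J, V i ≤ 1)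
    (hBs : ∑ i ∈ J, B i = 1) (has : ∑ i ∈ J, a i = 1) (hVs : ∑ i ∈ J, V i ≤ C)
    (hrB : ∀ i ∈ J, r i ^ 12 ≤ B i * a i ^ (2 - b) * V i ^ b)
    (o : ℤ) (ho : o ∈ J) (hBo : 1 - 1 / 10 ^ 4 ≤ B o) (hao : 1 - 1 / 10 ^ 4 ≤ a o) :
    energyInt J (fun i => r i ^ 3) ≤ 1 := by
  classical
  set r' := Function.update r o 0 with hr'
  have hr'J : ∀ x, x ∉ J → r' x = 0 := fun x hx => by
    rw [hr']; by_cases h : x = o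
    · simp [h]
    · simp [h, hr x hx]
  have hmain := energyInt_le_of_point J (fun i => r i ^ 3) (fun x hx => by simp [hr x hx])
    (fun x => pow_nonneg (hr0 x) 3) o ho (fun i => r' i ^ 3) (by
      funext i
      by_cases h : i = o
      · simp [hr', h]
      · simp [hr', h])
  set x := ∑ i ∈ J.erase o, B i with hx
  set y := ∑ i ∈ J.erase o, a i with hy
  have hxB : x = 1 - B o := by rw [← hBs, ← Finset.add_sum_erase J B ho]; ring
  have hya : y = 1 - a o := by rw [← has, ← Finset.add_sum_erase J a ho]; ring
  have hx0 : 0 ≤ x := Finset.sum_nonneg fun i _ => hB i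
  have hy0 : 0 ≤ y := Finset.sum_nonneg fun i _ => ha i
  have hys : y ≤ 1 / 10 ^ 4 := by linarith
  have hxs : x ≤ 1 / 10 ^ 4 := by linarith
  have hVb : ∀ i ∈ J, V i ^ b ≤ 1 := fun i hi => Real.rpow_le_one (hV i) (hV1 i hi) hb.le
  have huo : (r o ^ 3) ^ 4 ≤ (1 - x) * (1 - y) := by
    rw [← pow_mul]
    refine (hrB o ho).trans ?_
    have h1 : a o ^ (2 - b) ≤ a o := rpow_le_self_of_one_le (ha o) (by linarith) (by linarith)
    calc B o * a o ^ (2 - b) * V o ^ b ≤ B o * a o * 1 :=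
          mul_le_mul (mul_le_mul_of_nonneg_left h1 (hB o)) (hVb o ho)
            (Real.rpow_nonneg (hV o) _) (mul_nonneg (hB o) (ha o))
      _ = _ := by rw [hxB, hya]; ring
  have huo1 : (r o ^ 3) ^ 2 ≤ 1 := by
    have : ((r o ^ 3) ^ 2) ^ 2 ≤ 1 ^ 2 := by
      rw [← pow_mul]; refine huo.trans ?_; nlinarith
    exact le_of_pow_le_pow_left₀ (by norm_num) (by norm_num) this
  have hQ2 : ∑ i ∈ J, (r' i ^ 3) ^ 2 ≤ 1 / 20 * (x + y) := by
    rw [← Finset.add_sum_erase J _ ho]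
    have h0 : (r' o ^ 3) ^ 2 = 0 := by simp [hr']
    rw [h0, zero_add, hx, hy, ← Finset.sum_add_distrib, Finset.mul_sum]
    refine Finset.sum_le_sum fun i hi => ?_
    have hne : i ≠ o := Finset.ne_of_mem_erase hi
    have hiJ : i ∈ J := Finset.mem_of_mem_erase hi
    have hri : r' i = r i := by simp [hr', hne]
    rw [hri]
    have hay : a i ≤ 1 / 10 ^ 4 :=
      (Finset.single_le_sum (fun i _ => ha i) hi).trans hys
    have h1 : a i ^ (2 - b) ≤ a i * (1 / 100) := by
      rcases (ha i).eq_or_lt with h | h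
      · rw [← h, Real.zero_rpow (by linarith)]; simp
      · have e : a i ^ (2 - b) = a i * a i ^ (1 - b) := by
          rw [← Real.rpow_one_add' h.le (by linarith)]; congr 1; ring
        rw [e]
        refine mul_le_mul_of_nonneg_left ?_ h.le
        calc a i ^ (1 - b) ≤ a i ^ (1 / 2 : ℝ) :=
              Real.rpow_le_rpow_of_exponent_ge h (by linarith) (by linarith)
          _ ≤ (1 / 10 ^ 4) ^ (1 / 2 : ℝ) := Real.rpow_le_rpow h.le hay (by norm_num)
          _ = 1 / 100 := by
              rw [← Real.sqrt_eq_rpow]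
              rw [show (1 / 10 ^ 4 : ℝ) = (1 / 100) ^ 2 by norm_num]
              exact Real.sqrt_sq (by norm_num)
    have h2 : ((r i ^ 3) ^ 2) ^ 2 ≤ (1 / 20 * (B i + a i)) ^ 2 := by
      rw [← pow_mul, ← pow_mul]
      refine (hrB i hiJ).trans ?_
      calc B i * a i ^ (2 - b) * V i ^ b ≤ B i * (a i * (1 / 100)) * 1 :=
          mul_le_mul (mul_le_mul_of_nonneg_left h1 (hB i)) (hVb i hiJ)
            (Real.rpow_nonneg (hV i) _) (by have := hB i; have := ha i; positivity)
        _ ≤ _ := by nlinarith [sq_nonneg (B i - a i)]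
    exact le_of_pow_le_pow_left₀ (by norm_num) (by have := hB i; have := ha i; positivity) h2
  have hQ4 : energyInt J (fun i => r' i ^ 3) ≤ 2 * x * y := by
    refine (energyInt_cube_le_sum_pow J r' hr'J).trans ?_
    have h0 : ∑ i ∈ J, r' i ^ 4 = ∑ i ∈ J.erase o, r i ^ 4 := by
      rw [← Finset.add_sum_erase J _ ho]
      have h0 : r' o ^ 4 = 0 := by simp [hr']
      rw [h0, zero_add]
      refine Finset.sum_congr rfl fun i hi => ?_
      simp [hr', Finset.ne_of_mem_erase hi]
    rw [h0]
    refine (sum_pow_four_cube_le (J.erase o) r B a V b hb hb1 hB ha hV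
      (fun i hi => hrB i (Finset.mem_of_mem_erase hi))).trans ?_
    rw [← hx, ← hy]
    have hz : (∑ i ∈ J.erase o, V i) ^ b ≤ 2 := by
      refine (Real.rpow_le_rpow (Finset.sum_nonneg fun i _ => hV i) ?_ hb.le).trans hC
      exact (Finset.sum_le_sum_of_subset_of_nonneg (Finset.erase_subset _ _)
        (fun i _ _ => hV i)).trans hVs
    have h1 : y ^ (2 - b) ≤ y := rpow_le_self_of_one_le hy0 (by linarith) (by linarith)
    calc x * y ^ (2 - b) * _ ≤ x * y * 2 :=
          mul_le_mul (mul_le_mul_of_nonneg_left h1 hx0) hz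
            (Real.rpow_nonneg (Finset.sum_nonneg fun i _ => hV i) _) (by positivity)
      _ = _ := by ring
  have h10 : 10 * (r o ^ 3) ^ 2 * ∑ i ∈ J, (r' i ^ 3) ^ 2 ≤ 10 * (1 / 20 * (x + y)) := by
    have h0 : 0 ≤ ∑ i ∈ J, (r' i ^ 3) ^ 2 := Finset.sum_nonneg fun i _ => by positivity
    nlinarith [sq_nonneg (r o ^ 3)]
  have : x * y ≤ x * (1 / 10 ^ 4) := mul_le_mul_of_nonneg_left hys hx0
  nlinarith

/-- The normalized one-dimensional energy inequality. -/
lemma energyInt_cube_le_one (J : Finset ℤ) (r B a V : ℤ → ℝ) (b C : ℝ) (hb : 0 < b)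
    (hb1 : b ≤ 1 / 2) (hC : C ^ b ≤ 1 + 1 / 10 ^ 13)
    (hr : ∀ x, x ∉ J → r x = 0) (hr0 : ∀ x, 0 ≤ r x)
    (hB : ∀ i, 0 ≤ B i) (ha : ∀ i, 0 ≤ a i) (hV : ∀ i, 0 ≤ V i) (hV1 : ∀ i ∈ J, V i ≤ 1)
    (hBs : ∑ i ∈ J, B i = 1) (has : ∑ i ∈ J, a i = 1) (hVs : ∑ i ∈ J, V i ≤ C)
    (hrB : ∀ i ∈ J, r i ^ 12 ≤ B i * a i ^ (2 - b) * V i ^ b) :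
    energyInt J (fun i => r i ^ 3) ≤ 1 := by
  by_cases hcon : ∃ o ∈ J, 1 - 1 / 10 ^ 4 ≤ B o ∧ 1 - 1 / 10 ^ 4 ≤ a o
  · obtain ⟨o, ho, hBo, hao⟩ := hcon
    exact energyInt_cube_le_one_of_concentrated J r B a V b C hb hb1 (by linarith) hr hr0 hB ha hV hV1
      hBs has hVs hrB o ho hBo hao
  push Not at hcon
  set P := ∑ i ∈ J, r i ^ 4 with hP
  have hP0 : 0 ≤ P := Finset.sum_nonneg fun i _ => by positivity
  have hPC : P ^ 3 ≤ 1 + 1 / 10 ^ 13 := by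
    refine (sum_pow_four_cube_le J r B a V b hb hb1 hB ha hV hrB).trans ?_
    rw [hBs, has, Real.one_rpow, one_mul, one_mul]
    exact (Real.rpow_le_rpow (Finset.sum_nonneg fun i _ => hV i) hVs hb.le).trans hC
  have hEP := energyInt_cube_le_sum_pow J r hr
  rw [← hP] at hEP
  rcases hP0.eq_or_lt with hP0' | hPp
  · rw [← hP0'] at hEP
    linarith
  by_cases hmax : ∃ o ∈ J, (1 - 1 / 10 ^ 5) * P ≤ r o ^ 4
  · obtain ⟨o, ho, hro⟩ := hmax
    have hBo1 : B o ≤ 1 := by rw [← hBs]; exact Finset.single_le_sum (fun i _ => hB i) ho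
    have hao1 : a o ≤ 1 := by rw [← has]; exact Finset.single_le_sum (fun i _ => ha i) ho
    have h1 : ((1 - 1 / 10 ^ 5) * P) ^ 3 ≤ (r o ^ 4) ^ 3 :=
      pow_le_pow_left₀ (by positivity) hro 3
    have h2 : (r o ^ 4) ^ 3 ≤ 1 - 1 / 10 ^ 4 := by
      rw [← pow_mul]
      refine (hrB o ho).trans ?_
      have ha2 : a o ^ (2 - b) ≤ a o := rpow_le_self_of_one_le (ha o) hao1 (by linarith)
      have hv : V o ^ b ≤ 1 := Real.rpow_le_one (hV o) (hV1 o ho) hb.le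
      calc B o * a o ^ (2 - b) * V o ^ b ≤ B o * a o * 1 :=
          mul_le_mul (mul_le_mul_of_nonneg_left ha2 (hB o)) hv
            (Real.rpow_nonneg (hV o) _) (mul_nonneg (hB o) (ha o))
        _ ≤ _ := by
          by_cases h : 1 - 1 / 10 ^ 4 ≤ B o
          · have := hcon o ho h
            nlinarith [hB o, ha o]
          · push Not at h
            nlinarith [hB o, ha o]
    rw [mul_pow] at h1
    have h3 : (1 - 1 / 10 ^ 4 : ℝ) ≤ (1 - 1 / 10 ^ 5) ^ 3 := by norm_num
    have h4 : (1 - 1 / 10 ^ 5 : ℝ) ^ 3 * P ^ 3 ≤ (1 - 1 / 10 ^ 5) ^ 3 * 1 := by linarith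
    exact hEP.trans (le_of_mul_le_mul_left h4 (by norm_num))
  · push Not at hmax
    have := energyInt_cube_le_of_spread J r hr P (1 / 10 ^ 5) hP hPp (by norm_num) (by norm_num)
      (fun i hi => (hmax i hi).le)
    refine this.trans ?_
    calc _ ≤ (1 + 1 / 10 ^ 13) * (1 - (1 / 10 ^ 5) ^ 2 / 288 : ℝ) :=
          mul_le_mul_of_nonneg_right hPC (by norm_num)
      _ ≤ 1 := by norm_num

/-- The one-dimensional energy inequality. -/
lemma energyInt_cube_le_of_energy_bounds (J : Finset ℤ) (r B a V : ℤ → ℝ) (b C T : ℝ) (hb : 0 < b)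
    (hb1 : b ≤ 1 / 2) (hC : C ^ b ≤ 1 + 1 / 10 ^ 13) (hT : 0 ≤ T)
    (hr : ∀ x, x ∉ J → r x = 0) (hr0 : ∀ x, 0 ≤ r x)
    (hB : ∀ i, 0 ≤ B i) (ha : ∀ i, 0 ≤ a i) (hV : ∀ i, 0 ≤ V i) (hVT : ∀ i ∈ J, V i ≤ T)
    (hVs : ∑ i ∈ J, V i ≤ C * T)
    (hrB : ∀ i ∈ J, r i ^ 12 ≤ B i * a i ^ (2 - b) * V i ^ b) :
    energyInt J (fun i => r i ^ 3) ≤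
      (∑ i ∈ J, B i) * (∑ i ∈ J, a i) ^ (2 - b) * T ^ b := by
  set X := ∑ i ∈ J, B i with hX
  set Y := ∑ i ∈ J, a i with hY
  have hX0 : 0 ≤ X := Finset.sum_nonneg fun i _ => hB i
  have hY0 : 0 ≤ Y := Finset.sum_nonneg fun i _ => ha i
  have hZ0 : 0 ≤ ∑ i ∈ J, V i := Finset.sum_nonneg fun i _ => hV i
  by_cases hzero : X = 0 ∨ Y = 0 ∨ T = 0
  · refine (energyInt_cube_le_sum_pow J r hr).trans
      ((sum_pow_four_cube_le J r B a V b hb hb1 hB ha hV hrB).trans ?_)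
    rw [← hX, ← hY]
    rcases hzero with h | h | h
    · simp [h]
    · simp [h, Real.zero_rpow (show 2 - b ≠ 0 by linarith)]
    · have : ∑ i ∈ J, V i = 0 := le_antisymm (by simpa [h] using hVs) hZ0
      rw [this, h]
  push Not at hzero
  obtain ⟨hXn, hYn, hTn⟩ := hzero
  have hXp : 0 < X := lt_of_le_of_ne hX0 hXn.symm
  have hYp : 0 < Y := lt_of_le_of_ne hY0 hYn.symm
  have hTp : 0 < T := lt_of_le_of_ne hT hTn.symm
  set K := X * Y ^ (2 - b) * T ^ b with hK
  have hKp : 0 < K := by positivity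
  set k := K ^ (1 / 12 : ℝ) with hk
  have hkp : 0 < k := by positivity
  have hkK : k ^ 12 = K := by
    rw [hk, ← Real.rpow_natCast, ← Real.rpow_mul hKp.le]; norm_num
  have hmain := energyInt_cube_le_one J (fun i => r i / k) (fun i => B i / X) (fun i => a i / Y)
    (fun i => V i / T) b C hb hb1 hC (fun x hx => by simp [hr x hx])
    (fun x => div_nonneg (hr0 x) hkp.le)
    (fun x => div_nonneg (hB x) hX0) (fun x => div_nonneg (ha x) hY0)
    (fun x => div_nonneg (hV x) hT) (fun i hi => (div_le_one hTp).2 (hVT i hi))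
    (by rw [← Finset.sum_div, ← hX, div_self hXn]) (by rw [← Finset.sum_div, ← hY, div_self hYn])
    (by rw [← Finset.sum_div, div_le_iff₀ hTp]; exact hVs)
    (by
      intro i hi
      rw [div_pow, hkK, Real.div_rpow (ha i) hY0, Real.div_rpow (hV i) hT, hK, div_le_iff₀ hKp]
      have := (Real.rpow_pos_of_pos hYp (2 - b)).ne'
      have := (Real.rpow_pos_of_pos hTp b).ne'
      refine (hrB i hi).trans (le_of_eq ?_)
      field_simp
      rw [hK]
      ring)
  have hscale : energyInt J (fun i => (r i / k) ^ 3) = energyInt J (fun i => r i ^ 3) / K := by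
    rw [← hkK]
    unfold energyInt
    rw [Finset.sum_div]
    refine Finset.sum_congr rfl fun t _ => ?_
    have : autocorr J (fun i => (r i / k) ^ 3) t = autocorr J (fun i => r i ^ 3) t / k ^ 6 := by
      unfold autocorr
      rw [Finset.sum_div]
      refine Finset.sum_congr rfl fun i _ => ?_
      field_simp
    rw [this]
    field_simp
  rw [hscale, div_le_one hKp] at hmain
  exact hmain

lemma sum_coincidence_eq {α β γ : Type*} [DecidableEq γ] (Z : Finset γ) (s : Finset α)
    (t : Finset β) (k : α → γ) (l : β → γ) (φ : α → ℝ) (ψ : β → ℝ) (h : ∀ x ∈ s, k x ∈ Z) :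
    ∑ x ∈ s, ∑ y ∈ t, (if k x = l y then φ x * ψ y else 0) =
      ∑ z ∈ Z, (∑ x ∈ s, if k x = z then φ x else 0) * (∑ y ∈ t, if l y = z then ψ y else 0) := by
  simp only [Finset.sum_mul_sum]
  rw [Finset.sum_comm (s := Z)]
  refine Finset.sum_congr rfl fun x hx => ?_
  rw [Finset.sum_comm (s := Z)]
  refine Finset.sum_congr rfl fun y _ => ?_
  rw [Finset.sum_eq_single (k x)]
  · by_cases h' : k x = l y <;> simp [h', eq_comm]
  · intro z _ hz
    simp [hz.symm]
  · intro hkx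
    exact absurd (h x hx) hkx

/-- Cauchy–Schwarz for sums over coincidences of two keys. -/
lemma sq_sum_coincidence_le {α β γ : Type*} [DecidableEq γ] (s : Finset α) (t : Finset β)
    (k : α → γ) (l : β → γ) (φ : α → ℝ) (ψ : β → ℝ) :
    (∑ x ∈ s, ∑ y ∈ t, if k x = l y then φ x * ψ y else 0) ^ 2 ≤
      (∑ x ∈ s, ∑ x' ∈ s, if k x = k x' then φ x * φ x' else 0) *
      (∑ y ∈ t, ∑ y' ∈ t, if l y = l y' then ψ y * ψ y' else 0) := by
  set Z := s.image k ∪ t.image l with hZ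
  have hs : ∀ x ∈ s, k x ∈ Z := fun x hx => mem_union_left _ (mem_image_of_mem _ hx)
  have ht : ∀ x ∈ t, l x ∈ Z := fun x hx => mem_union_right _ (mem_image_of_mem _ hx)
  rw [sum_coincidence_eq Z s t k l φ ψ hs, sum_coincidence_eq Z s s k k φ φ hs,
    sum_coincidence_eq Z t t l l ψ ψ ht]
  refine (Finset.sum_mul_sq_le_sq_mul_sq _ _ _).trans (le_of_eq ?_)
  simp only [pow_two]

/-- Weighted count of the solutions of `a * b = c * d` with variables in four given sets. -/
def mulQuad (S₁ S₂ S₃ S₄ : Finset ℕ) (f : ℕ → ℝ) : ℝ :=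
  ∑ x ∈ S₁ ×ˢ S₂, ∑ y ∈ S₃ ×ˢ S₄,
    if x.1 * x.2 = y.1 * y.2 then (f x.1 * f x.2) * (f y.1 * f y.2) else 0

/-- The multiplicative energy of a weight `f` on `S`. -/
def mulEnergyW (S : Finset ℕ) (f : ℕ → ℝ) : ℝ := mulQuad S S S S f

lemma mulQuad_nonneg (S₁ S₂ S₃ S₄ : Finset ℕ) (f : ℕ → ℝ) (hf : ∀ x, 0 ≤ f x) :
    0 ≤ mulQuad S₁ S₂ S₃ S₄ f := by
  refine Finset.sum_nonneg fun x _ => Finset.sum_nonneg fun y _ => ?_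
  have := hf x.1; have := hf x.2; have := hf y.1; have := hf y.2
  split_ifs <;> positivity

lemma mulQuad_sq_le (S₁ S₂ S₃ S₄ : Finset ℕ) (f : ℕ → ℝ) :
    mulQuad S₁ S₂ S₃ S₄ f ^ 2 ≤ mulQuad S₁ S₂ S₁ S₂ f * mulQuad S₃ S₄ S₃ S₄ f :=
  sq_sum_coincidence_le (S₁ ×ˢ S₂) (S₃ ×ˢ S₄) (fun x => x.1 * x.2) (fun y => y.1 * y.2)
    (fun x => f x.1 * f x.2) (fun y => f y.1 * f y.2)

lemma mulQuad_pair_sq_le (S₁ S₂ : Finset ℕ) (f : ℕ → ℝ) (h₁ : ∀ a ∈ S₁, 0 < a)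
    (h₂ : ∀ a ∈ S₂, 0 < a) :
    mulQuad S₁ S₂ S₁ S₂ f ^ 2 ≤ mulEnergyW S₁ f * mulEnergyW S₂ f := by
  have h := sq_sum_coincidence_le (S₁ ×ˢ S₁) (S₂ ×ˢ S₂) (fun x => (x.1 : ℚ) / x.2)
    (fun y => (y.2 : ℚ) / y.1) (fun x => f x.1 * f x.2) (fun y => f y.1 * f y.2)
  have hq : ∀ {a b c d : ℕ}, 0 < b → 0 < d → ((a : ℚ) / b = c / d ↔ a * d = c * b) := by
    intro a b c d hb hd
    rw [div_eq_div_iff (by positivity) (by positivity)]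
    exact_mod_cast Iff.rfl
  have e0 : mulQuad S₁ S₂ S₁ S₂ f = ∑ x ∈ S₁ ×ˢ S₁, ∑ y ∈ S₂ ×ˢ S₂,
      if (x.1 : ℚ) / x.2 = (y.2 : ℚ) / y.1 then (f x.1 * f x.2) * (f y.1 * f y.2) else 0 := by
    simp only [mulQuad, Finset.sum_product]
    refine Finset.sum_congr rfl fun a ha => ?_
    rw [Finset.sum_comm]
    refine Finset.sum_congr rfl fun c hc => Finset.sum_congr rfl fun b hb =>
      Finset.sum_congr rfl fun d hd => ?_
    simp only [hq (h₁ c hc) (h₂ b hb), mul_comm d c]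
    congr 1; ring
  have e1 : mulEnergyW S₁ f = ∑ x ∈ S₁ ×ˢ S₁, ∑ x' ∈ S₁ ×ˢ S₁,
      if (x.1 : ℚ) / x.2 = (x'.1 : ℚ) / x'.2 then (f x.1 * f x.2) * (f x'.1 * f x'.2) else 0 := by
    simp only [mulEnergyW, mulQuad, Finset.sum_product]
    refine Finset.sum_congr rfl fun a ha => ?_
    rw [Finset.sum_comm, Finset.sum_congr rfl fun c _ => Finset.sum_comm, Finset.sum_comm]
    refine Finset.sum_congr rfl fun b hb => Finset.sum_congr rfl fun c hc =>
      Finset.sum_congr rfl fun d hd => ?_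
    simp only [hq (h₁ b hb) (h₁ d hd)]
    congr 1; ring
  have e2 : mulEnergyW S₂ f = ∑ x ∈ S₂ ×ˢ S₂, ∑ x' ∈ S₂ ×ˢ S₂,
      if (x.2 : ℚ) / x.1 = (x'.2 : ℚ) / x'.1 then (f x.1 * f x.2) * (f x'.1 * f x'.2) else 0 := by
    simp only [mulEnergyW, mulQuad, Finset.sum_product]
    refine Finset.sum_congr rfl fun a ha => ?_
    rw [Finset.sum_comm, Finset.sum_congr rfl fun c _ => Finset.sum_comm, Finset.sum_comm]
    refine Finset.sum_congr rfl fun b hb => Finset.sum_congr rfl fun c hc =>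
      Finset.sum_congr rfl fun d hd => ?_
    simp only [hq (h₂ a ha) (h₂ c hc)]
    have hiff : b * c = d * a ↔ a * d = c * b := by
      rw [mul_comm b c, mul_comm d a]
      exact eq_comm
    simp only [hiff]
    congr 1; ring
  rw [e0, e1, e2]
  exact h

lemma mulQuad_pow_four_le (S₁ S₂ S₃ S₄ : Finset ℕ) (f : ℕ → ℝ) (hf : ∀ x, 0 ≤ f x)
    (h₁ : ∀ a ∈ S₁, 0 < a) (h₂ : ∀ a ∈ S₂, 0 < a) (h₃ : ∀ a ∈ S₃, 0 < a) (h₄ : ∀ a ∈ S₄, 0 < a) :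
    mulQuad S₁ S₂ S₃ S₄ f ^ 4 ≤
      mulEnergyW S₁ f * mulEnergyW S₂ f * (mulEnergyW S₃ f * mulEnergyW S₄ f) := by
  calc mulQuad S₁ S₂ S₃ S₄ f ^ 4 = (mulQuad S₁ S₂ S₃ S₄ f ^ 2) ^ 2 := by ring
    _ ≤ (mulQuad S₁ S₂ S₁ S₂ f * mulQuad S₃ S₄ S₃ S₄ f) ^ 2 :=
        pow_le_pow_left₀ (sq_nonneg _) (mulQuad_sq_le _ _ _ _ _) 2
    _ = mulQuad S₁ S₂ S₁ S₂ f ^ 2 * mulQuad S₃ S₄ S₃ S₄ f ^ 2 := by ring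
    _ ≤ _ := mul_le_mul (mulQuad_pair_sq_le _ _ _ h₁ h₂) (mulQuad_pair_sq_le _ _ _ h₃ h₄)
        (sq_nonneg _) (mul_nonneg (mulQuad_nonneg _ _ _ _ _ hf) (mulQuad_nonneg _ _ _ _ _ hf))

lemma mulEnergyW_le_energyInt (S : Finset ℕ) (f : ℕ → ℝ) (hf : ∀ x, 0 ≤ f x)
    (hS : ∀ a ∈ S, 0 < a) (p : ℕ) (J : Finset ℤ)
    (hJ : ∀ a ∈ S, (a.factorization p : ℤ) ∈ J) (r : ℤ → ℝ) (hr0 : ∀ i, 0 ≤ r i)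
    (hrJ : ∀ i, i ∉ J → r i = 0)
    (hr : ∀ i ∈ J, r i ^ 12 = mulEnergyW (S.filter fun a => (a.factorization p : ℤ) = i) f) :
    mulEnergyW S f ≤ energyInt J (fun i => r i ^ 3) := by
  classical
  set v : ℕ → ℤ := fun a => (a.factorization p : ℤ) with hv
  set Sf : ℤ → Finset ℕ := fun i => S.filter fun a => v a = i with hSf
  have hSp : ∀ i, ∀ a ∈ Sf i, 0 < a := fun i a ha => hS a (Finset.mem_filter.1 ha).1
  have hmaps : ∀ x ∈ S ×ˢ S, (v x.1, v x.2) ∈ J ×ˢ J := fun x hx => by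
    rw [Finset.mem_product] at hx ⊢
    exact ⟨hJ _ hx.1, hJ _ hx.2⟩
  have hfil : ∀ κ : ℤ × ℤ, ((S ×ˢ S).filter fun x => (v x.1, v x.2) = κ) = Sf κ.1 ×ˢ Sf κ.2 := by
    intro κ
    ext x
    simp only [Finset.mem_filter, Finset.mem_product, hSf, Prod.ext_iff]
    tauto
  have hdecomp : mulEnergyW S f = ∑ κ ∈ J ×ˢ J, ∑ l ∈ J ×ˢ J,
      mulQuad (Sf κ.1) (Sf κ.2) (Sf l.1) (Sf l.2) f := by
    rw [mulEnergyW, mulQuad, ← Finset.sum_fiberwise_of_maps_to hmaps]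
    refine Finset.sum_congr rfl fun κ _ => ?_
    rw [Finset.sum_congr rfl fun x _ => (Finset.sum_fiberwise_of_maps_to hmaps _).symm,
      Finset.sum_comm]
    refine Finset.sum_congr rfl fun l _ => ?_
    rw [hfil, hfil]
    rfl
  have hquad : ∀ i ∈ J, ∀ j ∈ J, ∀ k ∈ J, ∀ l ∈ J, mulQuad (Sf i) (Sf j) (Sf k) (Sf l) f ≤
      if j = k + l - i then r i ^ 3 * r j ^ 3 * (r k ^ 3 * r l ^ 3) else 0 := by
    intro i hi j hj k hk l hl
    split_ifs with hsum
    · have h := mulQuad_pow_four_le (Sf i) (Sf j) (Sf k) (Sf l) f hf (hSp i) (hSp j) (hSp k) (hSp l)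
      rw [← hr i hi, ← hr j hj, ← hr k hk, ← hr l hl] at h
      refine le_of_pow_le_pow_left₀ (n := 4) (by norm_num)
        (by have := hr0 i; have := hr0 j; have := hr0 k; have := hr0 l; positivity) ?_
      refine h.trans (le_of_eq ?_)
      ring
    · refine le_of_eq (Finset.sum_eq_zero fun x hx => Finset.sum_eq_zero fun y hy => ?_)
      rw [if_neg]
      intro hxy
      rw [Finset.mem_product] at hx hy
      have h1 := (Finset.mem_filter.1 hx.1).2
      have h2 := (Finset.mem_filter.1 hx.2).2
      have h3 := (Finset.mem_filter.1 hy.1).2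
      have h4 := (Finset.mem_filter.1 hy.2).2
      have h5 := congrArg v hxy
      simp only [hv] at h1 h2 h3 h4 h5
      rw [Nat.factorization_mul (hSp _ _ hx.1).ne' (hSp _ _ hx.2).ne',
        Nat.factorization_mul (hSp _ _ hy.1).ne' (hSp _ _ hy.2).ne'] at h5
      simp only [Finsupp.add_apply, Nat.cast_add] at h5
      omega
  have hfinal : energyInt J (fun i => r i ^ 3) = ∑ i ∈ J, ∑ k ∈ J, ∑ l ∈ J,
      r i ^ 3 * r (k + l - i) ^ 3 * (r k ^ 3 * r l ^ 3) := by
    rw [← sum_diff_shift J (fun i k => ∑ l ∈ J, r i ^ 3 * r (k + l - i) ^ 3 * (r k ^ 3 * r l ^ 3))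
      (fun i k hk => by simp [hrJ k hk])]
    refine Finset.sum_congr rfl fun t _ => ?_
    rw [pow_two, autocorr, Finset.sum_mul_sum]
    refine Finset.sum_congr rfl fun i _ => Finset.sum_congr rfl fun l _ => ?_
    rw [show i + t + l - i = l + t by ring]
    ring
  rw [hdecomp, hfinal]
  simp only [Finset.sum_product]
  refine Finset.sum_le_sum fun i hi => ?_
  rw [Finset.sum_comm]
  refine Finset.sum_le_sum fun k hk => ?_
  rw [Finset.sum_comm]
  refine Finset.sum_le_sum fun l hl => ?_
  refine (Finset.sum_le_sum fun j hj => hquad i hi j hj k hk l hl).trans ?_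
  rw [Finset.sum_ite_eq' J (k + l - i)]
  split_ifs with h
  · exact le_rfl
  · simp [hrJ _ h]

lemma mulEnergyW_singleton (a : ℕ) (f : ℕ → ℝ) : mulEnergyW {a} f = f a ^ 4 := by
  simp [mulEnergyW, mulQuad]; ring

/-- Multiplicative energy is controlled by a class of weights closed under point masses and
under gluing along the valuation at a prime. -/
theorem exists_weight_mulEnergyW_le (Adm : (ℕ → ℝ) → Prop) (b C : ℝ) (hb : 0 < b)
    (hb1 : b ≤ 1 / 2) (hC0 : 0 < C) (hC : C ^ b ≤ 1 + 1 / 10 ^ 13)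
    (hnonneg : ∀ ω, Adm ω → ∀ a, 0 ≤ ω a)
    (hpoint : ∀ a, 0 < a → ∃ ω, Adm ω ∧ 1 ≤ ω a)
    (hglue : ∀ p, p.Prime → ∀ w : ℕ → ℕ → ℝ, (∀ j, Adm (w j)) →
      Adm (fun a => C⁻¹ * w (a.factorization p) a))
    (P : Finset ℕ) :
    ∀ S : Finset ℕ, (∀ a ∈ S, 0 < a) →
      (∀ p, p ∉ P → ∀ a ∈ S, ∀ a' ∈ S, a.factorization p = a'.factorization p) →
      ∀ f : ℕ → ℝ, (∀ x, 0 ≤ f x) → ∃ ω, Adm ω ∧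
        mulEnergyW S f ≤ (∑ a ∈ S, f a ^ 2) * (∑ a ∈ S, f a) ^ (2 - b) * (∑ a ∈ S, ω a * f a) ^ b := by
  classical
  induction P using Finset.induction_on with
  | empty =>
    intro S hS hP f hf
    rcases S.eq_empty_or_nonempty with rfl | ⟨a, ha⟩
    · obtain ⟨ω, hω, _⟩ := hpoint 1 one_pos
      exact ⟨ω, hω, by simp [mulEnergyW, mulQuad]⟩
    · obtain ⟨ω, hω, hω1⟩ := hpoint a (hS a ha)
      have hSa : S = {a} := by
        refine Finset.eq_singleton_iff_unique_mem.2 ⟨ha, fun c hc => ?_⟩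
        exact Nat.eq_of_factorization_eq (hS c hc).ne' (hS a ha).ne'
          (fun p => hP p (by simp) c hc a ha)
      refine ⟨ω, hω, ?_⟩
      rw [hSa, mulEnergyW_singleton]
      simp only [Finset.sum_singleton]
      rcases (hf a).eq_or_lt with h | h
      · simp [← h]
      · calc f a ^ 4 = f a ^ 2 * f a ^ (2 - b) * f a ^ b := by
              rw [mul_assoc, ← Real.rpow_add h, sub_add_cancel, Real.rpow_ofNat]; ring
          _ ≤ _ := by
              refine mul_le_mul_of_nonneg_left ?_ (by positivity)
              exact Real.rpow_le_rpow h.le (by nlinarith) hb.le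
  | insert p P hpP ih =>
    intro S hS hP f hf
    by_cases hp : p.Prime
    swap
    · refine ih S hS (fun q hq a ha a' ha' => ?_) f hf
      by_cases hqp : q = p
      · rw [hqp, Nat.factorization_eq_zero_of_not_prime _ hp, Nat.factorization_eq_zero_of_not_prime _ hp]
      · exact hP q (by simp [hqp, hq]) a ha a' ha'
    rcases S.eq_empty_or_nonempty with rfl | hne
    · obtain ⟨ω, hω, _⟩ := hpoint 1 one_pos
      exact ⟨ω, hω, by simp [mulEnergyW, mulQuad]⟩
    set v : ℕ → ℤ := fun a => (a.factorization p : ℤ) with hv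
    set Sf : ℤ → Finset ℕ := fun i => S.filter fun a => v a = i with hSf
    have hfib : ∀ i, ∃ ω, Adm ω ∧ mulEnergyW (Sf i) f ≤
        (∑ a ∈ Sf i, f a ^ 2) * (∑ a ∈ Sf i, f a) ^ (2 - b) * (∑ a ∈ Sf i, ω a * f a) ^ b := by
      intro i
      refine ih (Sf i) (fun a ha => hS a (Finset.mem_filter.1 ha).1) (fun q hq a ha a' ha' => ?_) f hf
      rw [Finset.mem_filter] at ha ha'
      by_cases hqp : q = p
      · have := ha.2.trans ha'.2.symm
        rw [hqp]
        simp only [hv] at this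
        exact_mod_cast this
      · exact hP q (by simp [hqp, hq]) a ha.1 a' ha'.1
    choose ω hω hE using hfib
    set J := S.image v with hJ
    have hJm : ∀ a ∈ S, v a ∈ J := fun a ha => mem_image_of_mem v ha
    have hJne : J.Nonempty := hne.image v
    set V : ℤ → ℝ := fun i => ∑ a ∈ Sf i, ω i a * f a with hV
    have hV0 : ∀ i, 0 ≤ V i := fun i => Finset.sum_nonneg fun a _ =>
      mul_nonneg (hnonneg _ (hω i) a) (hf a)
    obtain ⟨o, ho, hmax⟩ := J.exists_max_image V hJne
    set Z := ∑ i ∈ J, V i with hZ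
    set T := max (V o) (C⁻¹ * Z) with hT
    set r : ℤ → ℝ := fun i => if i ∈ J then mulEnergyW (Sf i) f ^ (1 / 12 : ℝ) else 0 with hr
    have hE0 : ∀ i, 0 ≤ mulEnergyW (Sf i) f := fun i => mulQuad_nonneg _ _ _ _ _ hf
    have hr0 : ∀ i, 0 ≤ r i := fun i => by
      simp only [hr]; split_ifs
      · exact Real.rpow_nonneg (hE0 i) _
      · exact le_rfl
    have hrJ : ∀ i, i ∉ J → r i = 0 := fun i hi => by simp [hr, hi]
    have hr12 : ∀ i ∈ J, r i ^ 12 = mulEnergyW (Sf i) f := fun i hi => by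
      simp only [hr, hi, if_true]
      rw [← Real.rpow_natCast, ← Real.rpow_mul (hE0 i)]; norm_num
    have h1 := mulEnergyW_le_energyInt S f hf hS p J hJm r hr0 hrJ hr12
    have h2 := energyInt_cube_le_of_energy_bounds J r (fun i => ∑ a ∈ Sf i, f a ^ 2)
      (fun i => ∑ a ∈ Sf i, f a) V b C T hb hb1 hC ((hV0 o).trans (le_max_left _ _)) hrJ hr0
      (fun i => Finset.sum_nonneg fun a _ => sq_nonneg _)
      (fun i => Finset.sum_nonneg fun a _ => hf a) hV0
      (fun i hi => (hmax i hi).trans (le_max_left _ _))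
      (by
        have : C⁻¹ * Z ≤ T := le_max_right _ _
        rwa [inv_mul_le_iff₀ hC0] at this)
      (fun i hi => by rw [hr12 i hi]; exact hE i)
    rw [Finset.sum_fiberwise_of_maps_to hJm, Finset.sum_fiberwise_of_maps_to hJm] at h2
    have h3 := h1.trans h2
    have hKnn : 0 ≤ (∑ a ∈ S, f a ^ 2) * (∑ a ∈ S, f a) ^ (2 - b) :=
      mul_nonneg (Finset.sum_nonneg fun a _ => sq_nonneg _)
        (Real.rpow_nonneg (Finset.sum_nonneg fun a _ => hf a) _)
    rcases max_choice (V o) (C⁻¹ * Z) with hc | hc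
    · refine ⟨ω o, hω o, h3.trans (mul_le_mul_of_nonneg_left ?_ hKnn)⟩
      rw [hT, hc]
      refine Real.rpow_le_rpow (hV0 o) ?_ hb.le
      exact Finset.sum_le_sum_of_subset_of_nonneg (Finset.filter_subset _ _)
        (fun a _ _ => mul_nonneg (hnonneg _ (hω o) a) (hf a))
    · refine ⟨_, hglue p hp (fun n => ω (n : ℤ)) (fun j => hω _), h3.trans (le_of_eq ?_)⟩
      rw [hT, hc, hZ]
      congr 2
      rw [← Finset.sum_fiberwise_of_maps_to hJm, Finset.mul_sum]
      refine Finset.sum_congr rfl fun i _ => ?_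
      rw [hV, Finset.mul_sum]
      refine Finset.sum_congr rfl fun a ha => ?_
      have : ((a.factorization p : ℕ) : ℤ) = i := (Finset.mem_filter.1 ha).2
      rw [this]; ring

/-- Multiplicative self-convolution of a weight on `S`, evaluated at `n`. -/
noncomputable def mulSelfConv (S : Finset ℕ) (f : ℕ → ℝ) (n : ℕ) : ℝ :=
  ∑ x ∈ S ×ˢ S, if x.1 * x.2 = n then f x.1 * f x.2 else 0

lemma mulSelfConv_nonneg (S : Finset ℕ) (f : ℕ → ℝ) (hf : ∀ x, 0 ≤ f x) (n : ℕ) :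
    0 ≤ mulSelfConv S f n :=
  Finset.sum_nonneg fun x _ => by
    have := hf x.1; have := hf x.2
    split_ifs <;> positivity

lemma sum_mulSelfConv (S : Finset ℕ) (f g : ℕ → ℝ) :
    ∑ n ∈ S * S, g n * mulSelfConv S f n = ∑ a ∈ S, f a * ∑ b ∈ S, g (a * b) * f b := by
  unfold mulSelfConv
  simp only [Finset.mul_sum]
  rw [Finset.sum_comm, Finset.sum_product]
  refine Finset.sum_congr rfl fun a ha => Finset.sum_congr rfl fun b hb => ?_
  rw [Finset.sum_eq_single (a * b)]
  · simp; ring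
  · intro n _ hn
    simp [hn.symm]
  · intro h
    exact absurd (Finset.mul_mem_mul ha hb) h

lemma sum_sq_mulSelfConv (S : Finset ℕ) (f : ℕ → ℝ) :
    ∑ n ∈ S * S, mulSelfConv S f n ^ 2 = mulEnergyW S f := by
  rw [mulEnergyW, mulQuad, sum_coincidence_eq (S * S) (S ×ˢ S) (S ×ˢ S) (fun x => x.1 * x.2)
    (fun x => x.1 * x.2) (fun x => f x.1 * f x.2) (fun x => f x.1 * f x.2)
    (fun x hx => Finset.mul_mem_mul (Finset.mem_product.1 hx).1 (Finset.mem_product.1 hx).2)]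
  refine Finset.sum_congr rfl fun n _ => ?_
  rw [pow_two, mulSelfConv]

/-- Iterated doubling of the support. -/
def iterSupp (S : Finset ℕ) : ℕ → Finset ℕ
  | 0 => S
  | j + 1 => iterSupp S j * iterSupp S j

/-- Iterated multiplicative self-convolution. -/
noncomputable def iterConv (S : Finset ℕ) (f : ℕ → ℝ) : ℕ → ℕ → ℝ
  | 0 => f
  | j + 1 => mulSelfConv (iterSupp S j) (iterConv S f j)

lemma iterSupp_pos (S : Finset ℕ) (hS : ∀ a ∈ S, 0 < a) (j : ℕ) : ∀ a ∈ iterSupp S j, 0 < a := by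
  induction j with
  | zero => exact hS
  | succ j ih =>
    intro a ha
    obtain ⟨x, hx, y, hy, rfl⟩ := Finset.mem_mul.1 ha
    exact Nat.mul_pos (ih x hx) (ih y hy)

lemma iterConv_nonneg (S : Finset ℕ) (f : ℕ → ℝ) (hf : ∀ x, 0 ≤ f x) (j : ℕ) :
    ∀ n, 0 ≤ iterConv S f j n := by
  induction j with
  | zero => exact hf
  | succ j ih => exact mulSelfConv_nonneg _ _ ih

lemma sum_iterConv (S : Finset ℕ) (f : ℕ → ℝ) (hf1 : ∑ a ∈ S, f a = 1) (j : ℕ) :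
    ∑ a ∈ iterSupp S j, iterConv S f j a = 1 := by
  induction j with
  | zero => exact hf1
  | succ j ih =>
    have := sum_mulSelfConv (iterSupp S j) (iterConv S f j) (fun _ => 1)
    simp only [one_mul, ih, mul_one] at this
    exact this

/-- If all weights of the class have small mass against `f`, iterated convolutions of `f` have
geometrically decaying `ℓ²` norms. -/
theorem sum_sq_iterConv_le (Adm : (ℕ → ℝ) → Prop) (b C ρ : ℝ) (hb : 0 < b)
    (hb1 : b ≤ 1 / 2) (hC0 : 0 < C) (hC : C ^ b ≤ 1 + 1 / 10 ^ 13)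
    (hnonneg : ∀ ω, Adm ω → ∀ a, 0 ≤ ω a)
    (hpoint : ∀ a, 0 < a → ∃ ω, Adm ω ∧ 1 ≤ ω a)
    (hglue : ∀ p, p.Prime → ∀ w : ℕ → ℕ → ℝ, (∀ j, Adm (w j)) →
      Adm (fun a => C⁻¹ * w (a.factorization p) a))
    (hdil : ∀ ω, Adm ω → ∀ x, 0 < x → Adm (fun a => ω (x * a)))
    (S : Finset ℕ) (hS : ∀ a ∈ S, 0 < a) (f : ℕ → ℝ) (hf : ∀ x, 0 ≤ f x)
    (hf1 : ∑ a ∈ S, f a = 1) (hρ0 : 0 ≤ ρ) (hρ : ∀ ω, Adm ω → ∑ a ∈ S, ω a * f a ≤ ρ) (j : ℕ) :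
    ∑ a ∈ iterSupp S j, iterConv S f j a ^ 2 ≤ (ρ ^ b) ^ j := by
  have hmass : ∀ j, ∀ ω, Adm ω → ∑ a ∈ iterSupp S j, ω a * iterConv S f j a ≤ ρ := by
    intro j
    induction j with
    | zero => exact hρ
    | succ j ih =>
      intro ω hω
      calc ∑ a ∈ iterSupp S (j + 1), ω a * iterConv S f (j + 1) a
          = ∑ a ∈ iterSupp S j, iterConv S f j a *
              ∑ b ∈ iterSupp S j, ω (a * b) * iterConv S f j b :=
            sum_mulSelfConv (iterSupp S j) (iterConv S f j) ω
        _ ≤ ∑ a ∈ iterSupp S j, iterConv S f j a * ρ :=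
            Finset.sum_le_sum fun a ha => mul_le_mul_of_nonneg_left
              (ih _ (hdil ω hω a (iterSupp_pos S hS j a ha))) (iterConv_nonneg S f hf j a)
        _ = ρ := by rw [← Finset.sum_mul, sum_iterConv S f hf1, one_mul]
  induction j with
  | zero =>
    have : ∀ a ∈ S, f a ^ 2 ≤ f a := by
      intro a ha
      have : f a ≤ 1 := by rw [← hf1]; exact Finset.single_le_sum (fun i _ => hf i) ha
      nlinarith [hf a]
    simpa [iterSupp, iterConv, hf1] using Finset.sum_le_sum this
  | succ j ih =>
    have e : ∑ a ∈ iterSupp S (j + 1), iterConv S f (j + 1) a ^ 2 =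
        mulEnergyW (iterSupp S j) (iterConv S f j) := sum_sq_mulSelfConv _ _
    rw [e]
    set S' := iterSupp S j
    obtain ⟨ω, hω, hle⟩ := exists_weight_mulEnergyW_le Adm b C hb hb1 hC0 hC hnonneg hpoint hglue
      (S'.biUnion Nat.primeFactors) S' (iterSupp_pos S hS j) (by
        intro p hp a ha a' ha'
        have : ∀ c ∈ S', c.factorization p = 0 := by
          intro c hc
          rw [← Finsupp.notMem_support_iff, Nat.support_factorization]
          exact fun h => hp (Finset.mem_biUnion.2 ⟨c, hc, h⟩)
        rw [this a ha, this a' ha']) (iterConv S f j) (iterConv_nonneg S f hf j)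
    refine hle.trans ?_
    rw [sum_iterConv S f hf1, Real.one_rpow, mul_one, pow_succ]
    refine mul_le_mul ih (Real.rpow_le_rpow ?_ (hmass j ω hω) hb.le)
      (Real.rpow_nonneg ?_ _) (by positivity)
    all_goals exact Finset.sum_nonneg fun a _ =>
      mul_nonneg (hnonneg ω hω a) (iterConv_nonneg S f hf j a)

open MeasureTheory in
lemma integral_fourier_eq (n : ℤ) :
    ∫ θ : UnitAddCircle, fourier n θ ∂AddCircle.haarAddCircle = if n = 0 then 1 else 0 := by
  split_ifs with h
  · simp [h]
  · exact integral_eq_zero_of_add_right_eq_neg (μ := AddCircle.haarAddCircle)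
      (fourier_add_half_inv_index h one_pos)

/-- The exponential sum with real coefficients `F` and integer frequencies `c`. -/
noncomputable def expSum {α : Type*} [Fintype α] (c : α → ℤ) (F : α → ℝ) (θ : UnitAddCircle) : ℂ :=
  ∑ a, (F a : ℂ) * fourier (c a) θ

lemma continuous_expSum {α : Type*} [Fintype α] (c : α → ℤ) (F : α → ℝ) :
    Continuous (expSum c F) := by
  unfold expSum
  fun_prop

lemma integrable_of_continuous_circle {E : Type*} [NormedAddCommGroup E] (f : UnitAddCircle → E)
    (hf : Continuous f) : MeasureTheory.Integrable f AddCircle.haarAddCircle :=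
  hf.integrable_of_hasCompactSupport (HasCompactSupport.of_compactSpace f)

lemma fourier_sum_apply {κ : Type*} (s : Finset κ) (n : κ → ℤ) (θ : UnitAddCircle) :
    fourier (∑ i ∈ s, n i) θ = ∏ i ∈ s, (fourier (n i) θ : ℂ) := by
  classical
  induction s using Finset.induction_on with
  | empty => simp
  | insert i s hi ih => rw [Finset.sum_insert hi, Finset.prod_insert hi, fourier_add, ih]

/-- Orthogonality of characters. -/
lemma integral_prod_expSum {κ α : Type*} [Fintype κ] [Fintype α] [DecidableEq κ] (c : α → ℤ)
    (σ : κ → ℤ) (F : κ → α → ℝ) (z : ℤ) :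
    ∫ θ : UnitAddCircle, (∏ i, expSum (fun a => σ i * c a) (F i) θ) * fourier (-z) θ
        ∂AddCircle.haarAddCircle =
      ((∑ x : κ → α, if ∑ i, σ i * c (x i) = z then ∏ i, F i (x i) else 0 : ℝ) : ℂ) := by
  have h1 : ∀ θ : UnitAddCircle, (∏ i, expSum (fun a => σ i * c a) (F i) θ) * fourier (-z) θ =
      ∑ x : κ → α, ((∏ i, F i (x i) : ℝ) : ℂ) * fourier (∑ i, σ i * c (x i) - z) θ := by
    intro θ
    unfold expSum
    rw [Fintype.prod_sum, Finset.sum_mul]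
    refine Finset.sum_congr rfl fun x _ => ?_
    rw [Finset.prod_mul_distrib, sub_eq_add_neg, fourier_add, fourier_sum_apply]
    push_cast
    ring
  simp_rw [h1]
  rw [MeasureTheory.integral_finsetSum]
  · push_cast
    refine Finset.sum_congr rfl fun x _ => ?_
    rw [MeasureTheory.integral_const_mul, integral_fourier_eq]
    simp only [sub_eq_zero, mul_ite, mul_one, mul_zero]
    split_ifs <;> push_cast <;> rfl
  · intro x _
    exact integrable_of_continuous_circle _ (by fun_prop)

lemma norm_expSum_sign {α : Type*} [Fintype α] (c : α → ℤ) (F : α → ℝ) (σ : ℤ)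
    (hσ : σ = 1 ∨ σ = -1) (θ : UnitAddCircle) :
    ‖expSum (fun a => σ * c a) F θ‖ = ‖expSum c F θ‖ := by
  rcases hσ with rfl | rfl
  · simp
  · have : expSum (fun a => -1 * c a) F θ = (starRingEnd ℂ) (expSum c F θ) := by
      unfold expSum
      rw [map_sum]
      refine Finset.sum_congr rfl fun a _ => ?_
      rw [map_mul, Complex.conj_ofReal, ← fourier_neg]
      simp
    rw [this, RCLike.norm_conj]

lemma sum_relations_le_integral {κ α : Type*} [Fintype κ] [Fintype α] [DecidableEq κ] (c : α → ℤ)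
    (σ : κ → ℤ) (hσ : ∀ i, σ i = 1 ∨ σ i = -1) (F : κ → α → ℝ) (z : ℤ) :
    (∑ x : κ → α, if ∑ i, σ i * c (x i) = z then ∏ i, F i (x i) else 0) ≤
      ∫ θ : UnitAddCircle, ∏ i, ‖expSum c (F i) θ‖ ∂AddCircle.haarAddCircle := by
  have h := integral_prod_expSum c σ F z
  refine (le_abs_self _).trans ?_
  rw [← Real.norm_eq_abs, ← Complex.norm_real, ← h]
  refine (MeasureTheory.norm_integral_le_integral_norm _).trans (le_of_eq ?_)
  refine MeasureTheory.integral_congr_ae (Filter.Eventually.of_forall fun θ => ?_)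
  simp only [norm_mul, norm_prod, norm_expSum_sign _ _ _ (hσ _)]
  have : ‖(fourier (-z) θ : ℂ)‖ = 1 := by rw [fourier_apply]; exact Circle.norm_coe _
  rw [this, mul_one]

/-- The signs `+` on the first block and `-` on the second. -/
def blockSign (h : ℕ) : Fin h ⊕ Fin h → ℤ := Sum.elim (fun _ => 1) (fun _ => -1)

lemma blockSign_eq (h : ℕ) (i : Fin h ⊕ Fin h) : blockSign h i = 1 ∨ blockSign h i = -1 := by
  rcases i with i | i <;> simp [blockSign]

/-- The `2h`-th moment of an exponential sum. -/
noncomputable def expMoment {α : Type*} [Fintype α] (h : ℕ) (c : α → ℤ) (F : α → ℝ) : ℝ :=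
  ∫ θ : UnitAddCircle, ‖expSum c F θ‖ ^ (2 * h) ∂AddCircle.haarAddCircle

lemma expMoment_nonneg {α : Type*} [Fintype α] (h : ℕ) (c : α → ℤ) (F : α → ℝ) :
    0 ≤ expMoment h c F :=
  MeasureTheory.integral_nonneg fun _ => by positivity

lemma expMoment_eq {α : Type*} [Fintype α] (h : ℕ) (c : α → ℤ) (F : α → ℝ) :
    expMoment h c F = ∑ x : Fin h ⊕ Fin h → α,
      if ∑ i, blockSign h i * c (x i) = 0 then ∏ i, F (x i) else 0 := by
  have h1 := integral_prod_expSum c (blockSign h) (fun _ => F) 0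
  have h2 : ∀ θ : UnitAddCircle, (∏ i, expSum (fun a => blockSign h i * c a) F θ) *
      fourier (-0) θ = ((‖expSum c F θ‖ ^ (2 * h) : ℝ) : ℂ) := by
    intro θ
    have hc : expSum (fun a => -1 * c a) F θ = (starRingEnd ℂ) (expSum c F θ) := by
      unfold expSum
      rw [map_sum]
      refine Finset.sum_congr rfl fun a _ => ?_
      rw [map_mul, Complex.conj_ofReal, ← fourier_neg]
      simp
    simp only [Fintype.prod_sum_type, blockSign, Sum.elim_inl, Sum.elim_inr, hc, one_mul,
      Finset.prod_const, Finset.card_univ, Fintype.card_fin, neg_zero, fourier_zero, mul_one]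
    rw [← mul_pow, Complex.mul_conj, Complex.normSq_eq_norm_sq, pow_mul]
    push_cast
    rfl
  simp_rw [h2] at h1
  rw [integral_complex_ofReal] at h1
  exact_mod_cast h1

/-- In a signed vanishing sum of positive integers two terms have equal valuation. -/
lemma exists_valuation_eq {κ : Type*} [Fintype κ] [Nonempty κ] (p : ℕ) (hp : p.Prime)
    (σ : κ → ℤ) (hσ : ∀ i, σ i = 1 ∨ σ i = -1) (x : κ → ℕ) (hx : ∀ i, 0 < x i)
    (hsum : ∑ i, σ i * (x i : ℤ) = 0) :
    ∃ s t, s ≠ t ∧ (x s).factorization p = (x t).factorization p := by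
  classical
  obtain ⟨s, -, hs⟩ := Finset.exists_min_image Finset.univ (fun i => (x i).factorization p)
    Finset.univ_nonempty
  by_contra! hcon
  set n := (x s).factorization p with hn
  have hdvd : ∀ i, i ≠ s → ((p : ℤ) ^ (n + 1)) ∣ σ i * (x i : ℤ) := by
    intro i hi
    have h1 : n + 1 ≤ (x i).factorization p :=
      lt_of_le_of_ne (hs i (Finset.mem_univ i)) (hcon s i hi.symm)
    have h2 : p ^ (n + 1) ∣ x i := (hp.pow_dvd_iff_le_factorization (hx i).ne').2 h1
    exact Dvd.dvd.mul_left (by exact_mod_cast h2) _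
  rw [← Finset.add_sum_erase _ _ (Finset.mem_univ s)] at hsum
  have h3 : ((p : ℤ) ^ (n + 1)) ∣ σ s * (x s : ℤ) := by
    have : σ s * (x s : ℤ) = -∑ i ∈ Finset.univ.erase s, σ i * (x i : ℤ) := by linarith
    rw [this, dvd_neg]
    exact Finset.dvd_sum fun i hi => hdvd i (Finset.ne_of_mem_erase hi)
  have h4 : ((p : ℤ) ^ (n + 1)) ∣ (x s : ℤ) := by
    rcases hσ s with h | h <;> rw [h] at h3 <;> simpa using h3
  have h5 : p ^ (n + 1) ∣ x s := by exact_mod_cast h4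
  have := (hp.pow_dvd_iff_le_factorization (hx s).ne').1 h5
  omega

lemma prod_two_special {κ : Type*} [Fintype κ] [DecidableEq κ] (s t : κ) (hst : s ≠ t) (u v : ℝ) :
    ∏ i : κ, (if i = s ∨ i = t then u else v) = u ^ 2 * v ^ (Fintype.card κ - 2) := by
  rw [Finset.prod_ite, Finset.prod_const, Finset.prod_const]
  have h1 : (Finset.univ.filter fun i => i = s ∨ i = t) = {s, t} := by ext; simp
  have h2 : (Finset.univ.filter fun i => ¬(i = s ∨ i = t)) = {s, t}ᶜ := by ext; simp
  rw [h1, h2, Finset.card_compl, Finset.card_pair hst]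

/-- Splitting of moments according to the valuation at a prime. -/
lemma expMoment_le_sum_valuation {α : Type*} [Fintype α] (h : ℕ) (hh : 1 ≤ h) (c : α → ℕ)
    (hc : ∀ a, 0 < c a) (F : α → ℝ) (hF : ∀ a, 0 ≤ F a) (p : ℕ) (hp : p.Prime) (J : Finset ℕ)
    (hJ : ∀ a, (c a).factorization p ∈ J) :
    expMoment h (fun a => (c a : ℤ)) F ≤ (4 * h ^ 2) * ∑ j ∈ J,
      ∫ θ : UnitAddCircle,
        ‖expSum (fun a => (c a : ℤ)) (fun a => if (c a).factorization p = j then F a else 0) θ‖ ^ 2 *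
        ‖expSum (fun a => (c a : ℤ)) F θ‖ ^ (2 * h - 2) ∂AddCircle.haarAddCircle := by
  classical
  set κ := Fin h ⊕ Fin h with hκ
  have hcard : Fintype.card κ = 2 * h := by simp [hκ]; ring
  have : Nonempty κ := ⟨Sum.inl ⟨0, hh⟩⟩
  set Fj : ℕ → α → ℝ := fun j a => if (c a).factorization p = j then F a else 0 with hFj
  set I : ℕ → ℝ := fun j => ∫ θ : UnitAddCircle,
        ‖expSum (fun a => (c a : ℤ)) (Fj j) θ‖ ^ 2 *
        ‖expSum (fun a => (c a : ℤ)) F θ‖ ^ (2 * h - 2) ∂AddCircle.haarAddCircle with hI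
  have hI0 : ∀ j, 0 ≤ I j := fun j => MeasureTheory.integral_nonneg fun _ => by positivity
  set G : κ → κ → ℕ → κ → α → ℝ := fun s t j i => if i = s ∨ i = t then Fj j else F with hG
  have hG0 : ∀ s t j i a, 0 ≤ G s t j i a := by
    intro s t j i a
    simp only [hG, hFj]
    split_ifs
    · dsimp only
      split_ifs
      · exact hF a
      · exact le_rfl
    · exact hF a
  have hterm : ∀ s t : κ, s ≠ t → ∀ j, (∑ x : κ → α,
      if ∑ i, blockSign h i * (c (x i) : ℤ) = 0 then ∏ i, G s t j i (x i) else 0) ≤ I j := by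
    intro s t hst j
    refine (sum_relations_le_integral (fun a => (c a : ℤ)) (blockSign h) (blockSign_eq h)
      (G s t j) 0).trans (le_of_eq ?_)
    refine MeasureTheory.integral_congr_ae (Filter.Eventually.of_forall fun θ => ?_)
    have : ∀ i, ‖expSum (fun a => (c a : ℤ)) (G s t j i) θ‖ =
        if i = s ∨ i = t then ‖expSum (fun a => (c a : ℤ)) (Fj j) θ‖
        else ‖expSum (fun a => (c a : ℤ)) F θ‖ := by
      intro i
      simp only [hG]
      split_ifs <;> rfl
    simp only [this]
    rw [prod_two_special s t hst, hcard]
  have hmain : expMoment h (fun a => (c a : ℤ)) F ≤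
      ∑ st ∈ (Finset.univ : Finset κ).offDiag, ∑ j ∈ J, ∑ x : κ → α,
      if ∑ i, blockSign h i * (c (x i) : ℤ) = 0 then ∏ i, G st.1 st.2 j i (x i) else 0 := by
    rw [expMoment_eq]
    rw [Finset.sum_congr rfl fun st _ => Finset.sum_comm, Finset.sum_comm]
    refine Finset.sum_le_sum fun x _ => ?_
    have hnn : ∀ st ∈ (Finset.univ : Finset κ).offDiag, ∀ j ∈ J, 0 ≤
        if ∑ i, blockSign h i * (c (x i) : ℤ) = 0 then ∏ i, G st.1 st.2 j i (x i) else 0 := by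
      intro st _ j _
      split_ifs
      · exact Finset.prod_nonneg fun i _ => hG0 _ _ _ _ _
      · exact le_rfl
    by_cases hrel : ∑ i, blockSign h i * (c (x i) : ℤ) = 0
    · obtain ⟨s, t, hst, hval⟩ := exists_valuation_eq p hp (blockSign h) (blockSign_eq h)
        (fun i => c (x i)) (fun i => hc _) hrel
      have hmem : (s, t) ∈ (Finset.univ : Finset κ).offDiag := by simp [hst]
      refine le_trans ?_ (Finset.single_le_sum (fun st hst => Finset.sum_nonneg (hnn st hst)) hmem)
      refine le_trans ?_ (Finset.single_le_sum (hnn _ hmem) (hJ (x s)))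
      simp only [hrel, if_true]
      refine le_of_eq (Finset.prod_congr rfl fun i _ => ?_)
      simp only [hG, hFj]
      split_ifs with h1 <;> try rfl
      rcases h1 with h1 | h1
      · simp [h1]
      · simp [h1, ← hval]
    · simp only [hrel, if_false, Finset.sum_const_zero, le_refl]
  refine hmain.trans ?_
  calc _ ≤ ∑ st ∈ (Finset.univ : Finset κ).offDiag, ∑ j ∈ J, I j :=
        Finset.sum_le_sum fun st hst => Finset.sum_le_sum fun j _ =>
          hterm st.1 st.2 (by simpa using hst) j
    _ = ((Finset.univ : Finset κ).offDiag.card : ℝ) * ∑ j ∈ J, I j := by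
        rw [Finset.sum_const, nsmul_eq_mul]
    _ ≤ _ := by
        refine mul_le_mul_of_nonneg_right ?_ (Finset.sum_nonneg fun j _ => hI0 j)
        rw [Finset.offDiag_card, Finset.card_univ, hcard]
        have : 2 * h * (2 * h) - 2 * h ≤ 4 * h ^ 2 := (Nat.sub_le _ _).trans (by ring_nf; rfl)
        exact_mod_cast this

lemma norm_expSum_le {α : Type*} [Fintype α] (c : α → ℤ) (F : α → ℝ) (hF : ∀ a, 0 ≤ F a)
    (θ : UnitAddCircle) : ‖expSum c F θ‖ ≤ ∑ a, F a := by
  unfold expSum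
  refine (norm_sum_le _ _).trans (Finset.sum_le_sum fun a _ => ?_)
  have : ‖(fourier (c a) θ : ℂ)‖ = 1 := by rw [fourier_apply]; exact Circle.norm_coe _
  rw [norm_mul, this, mul_one, Complex.norm_real, Real.norm_of_nonneg (hF a)]

lemma expMoment_le_sum_pow {α : Type*} [Fintype α] (h : ℕ) (c : α → ℤ) (F : α → ℝ)
    (hF : ∀ a, 0 ≤ F a) : expMoment h c F ≤ (∑ a, F a) ^ (2 * h) := by
  unfold expMoment
  refine (MeasureTheory.integral_mono (g := fun _ => (∑ a, F a) ^ (2 * h))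
    (integrable_of_continuous_circle _ ?_) (MeasureTheory.integrable_const _)
    fun θ => ?_).trans (le_of_eq ?_)
  · exact ((continuous_expSum c F).norm).pow _
  · exact pow_le_pow_left₀ (norm_nonneg _) (norm_expSum_le c F hF θ) _
  · simp

lemma expMoment_reindex {α β : Type*} [Fintype α] [Fintype β] (e : α ≃ β) (h : ℕ) (c : β → ℤ)
    (F : β → ℝ) : expMoment h (fun a => c (e a)) (fun a => F (e a)) = expMoment h c F := by
  unfold expMoment expSum
  congr 1
  ext θ
  rw [Equiv.sum_comp e fun b => (F b : ℂ) * fourier (c b) θ]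

lemma expMoment_scale {α : Type*} [Fintype α] (h : ℕ) (c : α → ℤ) (F : α → ℝ) (x : ℤ)
    (hx : x ≠ 0) : expMoment h (fun a => x * c a) F = expMoment h c F := by
  rw [expMoment_eq, expMoment_eq]
  refine Finset.sum_congr rfl fun y _ => ?_
  have : ∑ i, blockSign h i * (x * c (y i)) = x * ∑ i, blockSign h i * c (y i) := by
    rw [Finset.mul_sum]
    exact Finset.sum_congr rfl fun i _ => by ring
  simp only [this, mul_eq_zero, hx, false_or]

/-- Weights `ω` for which exponential sums with coefficients `g √ω` satisfy the Khintchine type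
inequality `∫ |S|^{2h} ≤ (∑ g²)^h`. -/
def AdmissibleWeight (h : ℕ) (ω : ℕ → ℝ) : Prop :=
  (∀ a, 0 ≤ ω a) ∧ ∀ B : Finset ℕ, (∀ a ∈ B, 0 < a) → ∀ g : ℕ → ℝ, (∀ a, 0 ≤ g a) →
    expMoment h (fun a : B => ((a : ℕ) : ℤ)) (fun a : B => g a * √(ω a)) ≤ (∑ a ∈ B, g a ^ 2) ^ h

lemma AdmissibleWeight.exists_point (h : ℕ) (a : ℕ) :
    ∃ ω, AdmissibleWeight h ω ∧ 1 ≤ ω a := by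
  refine ⟨fun b => if b = a then 1 else 0, ⟨fun b => by dsimp only; split_ifs <;> norm_num, ?_⟩, by simp⟩
  intro B hB g hg
  refine (expMoment_le_sum_pow h _ _ fun b => by have := hg b; positivity).trans ?_
  rw [pow_mul]
  refine pow_le_pow_left₀ (by positivity) ?_ _
  have h1 : ∑ b : B, g b * √(if (b : ℕ) = a then 1 else 0) = if a ∈ B then g a else 0 := by
    rw [Finset.sum_coe_sort B fun b => g b * √(if b = a then 1 else 0), ← Finset.sum_ite_eq' B a g]
    refine Finset.sum_congr rfl fun b _ => ?_
    split_ifs <;> simp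
  rw [h1]
  split_ifs with ha
  · exact Finset.single_le_sum (f := fun b => g b ^ 2) (fun b _ => sq_nonneg _) ha
  · rw [zero_pow two_ne_zero]
    exact Finset.sum_nonneg fun b _ => sq_nonneg _

lemma AdmissibleWeight.le_one {h : ℕ} (hh : 1 ≤ h) {ω : ℕ → ℝ} (hω : AdmissibleWeight h ω) (a : ℕ)
    (ha : 0 < a) : ω a ≤ 1 := by
  have h1 := hω.2 {a} (by simpa using ha) (fun _ => 1) (fun _ => zero_le_one)
  have h2 : expMoment h (fun b : ({a} : Finset ℕ) => ((b : ℕ) : ℤ))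
      (fun b : ({a} : Finset ℕ) => 1 * √(ω b)) = ω a ^ h := by
    unfold expMoment expSum
    have h3 : ∀ θ : UnitAddCircle, ‖∑ b : ({a} : Finset ℕ), ((1 * √(ω b) : ℝ) : ℂ) *
        fourier ((b : ℕ) : ℤ) θ‖ ^ (2 * h) = ω a ^ h := by
      intro θ
      rw [Finset.sum_coe_sort ({a} : Finset ℕ) fun b => ((1 * √(ω b) : ℝ) : ℂ) *
        fourier (b : ℤ) θ, Finset.sum_singleton]
      have : ‖(fourier (a : ℤ) θ : ℂ)‖ = 1 := by rw [fourier_apply]; exact Circle.norm_coe _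
      rw [norm_mul, this, mul_one, one_mul, Complex.norm_real,
        Real.norm_of_nonneg (Real.sqrt_nonneg _), pow_mul, Real.sq_sqrt (hω.1 a)]
    simp_rw [h3]
    simp
  rw [h2] at h1
  simp only [one_pow, Finset.sum_const, Finset.card_singleton, one_smul] at h1
  by_contra! hcon
  exact absurd h1 (not_le.2 (one_lt_pow₀ hcon (by omega)))

lemma AdmissibleWeight.dilate {h : ℕ} {ω : ℕ → ℝ} (hω : AdmissibleWeight h ω) (x : ℕ)
    (hx : 0 < x) : AdmissibleWeight h (fun a => ω (x * a)) := by
  refine ⟨fun a => hω.1 _, fun B hB g hg => ?_⟩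
  have hinj : Function.Injective fun a : ℕ => x * a := fun a b hab => Nat.eq_of_mul_eq_mul_left hx hab
  set B' := B.map ⟨fun a => x * a, hinj⟩ with hB'
  have h1 := hω.2 B' (by
    intro a ha
    obtain ⟨b, hb, rfl⟩ := Finset.mem_map.1 ha
    exact Nat.mul_pos hx (hB b hb)) (fun n => g (n / x)) (fun n => hg _)
  have h2 : ∑ a ∈ B', g (a / x) ^ 2 = ∑ a ∈ B, g a ^ 2 := by
    rw [hB', Finset.sum_map]
    refine Finset.sum_congr rfl fun a _ => ?_
    simp [Nat.mul_div_cancel_left a hx]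
  rw [h2] at h1
  refine le_trans (le_of_eq ?_) h1
  have e (a : B) : x * (a : ℕ) ∈ B' :=
    Finset.mem_map_of_mem (⟨fun a => x * a, hinj⟩ : ℕ ↪ ℕ) a.2
  have hbij : Function.Bijective fun a : B => (⟨x * (a : ℕ), e a⟩ : B') := by
    refine ⟨fun a b hab => Subtype.ext (hinj (congrArg Subtype.val hab)), fun b => ?_⟩
    obtain ⟨a, ha, hab⟩ := Finset.mem_map.1 b.2
    exact ⟨⟨a, ha⟩, Subtype.ext hab⟩
  rw [← expMoment_reindex (Equiv.ofBijective _ hbij),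
    ← expMoment_scale h (fun a : B => ((a : ℕ) : ℤ)) _ (x : ℤ) (by exact_mod_cast hx.ne')]
  congr 1
  ext a
  simp [Nat.mul_div_cancel_left _ hx]

lemma integral_sq_mul_pow_le (h : ℕ) (hh : 2 ≤ h) (u v : UnitAddCircle → ℝ) (hu : Continuous u)
    (hv : Continuous v) (hv0 : ∀ θ, 0 ≤ v θ) :
    ∫ θ, u θ ^ 2 * v θ ^ (2 * h - 2) ∂AddCircle.haarAddCircle ≤
      (∫ θ, u θ ^ (2 * h) ∂AddCircle.haarAddCircle) ^ (1 / (h : ℝ)) *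
      (∫ θ, v θ ^ (2 * h) ∂AddCircle.haarAddCircle) ^ (((h : ℝ) - 1) / h) := by
  have hh' : (2 : ℝ) ≤ h := by exact_mod_cast hh
  have hq0 : 0 < (h : ℝ) / (h - 1) := by apply div_pos <;> linarith
  have hpq : (h : ℝ).HolderConjugate ((h : ℝ) / (h - 1)) :=
    Real.HolderConjugate.conjExponent (by linarith)
  have key := MeasureTheory.integral_mul_le_Lp_mul_Lq_of_nonneg
    (μ := (AddCircle.haarAddCircle : MeasureTheory.Measure UnitAddCircle)) hpq
    (f := fun θ => u θ ^ 2) (g := fun θ => v θ ^ (2 * h - 2))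
    (Filter.Eventually.of_forall fun θ => by positivity)
    (Filter.Eventually.of_forall fun θ => pow_nonneg (hv0 θ) _)
    ((hu.pow 2).memLp_of_hasCompactSupport (HasCompactSupport.of_compactSpace _))
    ((hv.pow _).memLp_of_hasCompactSupport (HasCompactSupport.of_compactSpace _))
  refine key.trans (le_of_eq ?_)
  have e1 : ∀ θ, (u θ ^ 2) ^ (h : ℝ) = u θ ^ (2 * h) := fun θ => by
    rw [Real.rpow_natCast, pow_mul]
  have e2 : ∀ θ, (v θ ^ (2 * h - 2)) ^ ((h : ℝ) / (h - 1)) = v θ ^ (2 * h) := fun θ => by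
    have : (2 * h - 2) = 2 * (h - 1) := by omega
    rw [this, ← Real.rpow_natCast (v θ) (2 * (h - 1)), ← Real.rpow_mul (hv0 θ),
      ← Real.rpow_natCast (v θ) (2 * h)]
    congr 1
    push_cast [Nat.cast_sub (by omega : 1 ≤ h)]
    have : (h : ℝ) - 1 ≠ 0 := by linarith
    field_simp
  simp only [e1, e2, one_div_div]

lemma AdmissibleWeight.glue {h : ℕ} (hh : 2 ≤ h) (p : ℕ) (hp : p.Prime) (w : ℕ → ℕ → ℝ)
    (hw : ∀ j, AdmissibleWeight h (w j)) :
    AdmissibleWeight h (fun a => (4 * (h : ℝ) ^ 2)⁻¹ * w (a.factorization p) a) := by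
  set C : ℝ := 4 * (h : ℝ) ^ 2 with hC
  have hh0 : (0 : ℝ) < h := by exact_mod_cast (by omega : 0 < h)
  have hC0 : 0 < C := by positivity
  refine ⟨fun a => mul_nonneg (by positivity) ((hw _).1 a), fun B hB g hg => ?_⟩
  set c : B → ℤ := fun a => ((a : ℕ) : ℤ) with hc
  set F : B → ℝ := fun a => g a * √(C⁻¹ * w ((a : ℕ).factorization p) a) with hF
  have hF0 : ∀ a, 0 ≤ F a := fun a => mul_nonneg (hg _) (Real.sqrt_nonneg _)
  set J := B.image fun a => a.factorization p with hJ
  set X := expMoment h c F with hX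
  have hX0 : 0 ≤ X := expMoment_nonneg _ _ _
  set Q : ℕ → ℝ := fun j => ∑ a ∈ B, if a.factorization p = j then g a ^ 2 else 0 with hQ
  have hQ0 : ∀ j, 0 ≤ Q j := fun j => Finset.sum_nonneg fun a _ => by split_ifs <;> positivity
  have hQsum : ∑ j ∈ J, Q j = ∑ a ∈ B, g a ^ 2 := by
    rw [hQ, Finset.sum_comm]
    refine Finset.sum_congr rfl fun a ha => ?_
    rw [Finset.sum_ite_eq, if_pos (Finset.mem_image_of_mem _ ha)]
  have hmom : ∀ j, expMoment h c (fun a : B => if (a : ℕ).factorization p = j then F a else 0) ≤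
      (C⁻¹ * Q j) ^ h := by
    intro j
    have h1 := (hw j).2 B hB (fun a => if a.factorization p = j then √C⁻¹ * g a else 0)
      (fun a => by have := hg a; split_ifs <;> positivity)
    have e1 : (fun a : B => (if (a : ℕ).factorization p = j then √C⁻¹ * g a else 0) *
        √(w j a)) = fun a : B => if (a : ℕ).factorization p = j then F a else 0 := by
      ext a
      split_ifs with hj
      · simp only [hF, hj]
        rw [Real.sqrt_mul (by positivity)]
        ring
      · simp
    have e2 : ∑ a ∈ B, (if a.factorization p = j then √C⁻¹ * g a else 0) ^ 2 = C⁻¹ * Q j := by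
      rw [hQ, Finset.mul_sum]
      refine Finset.sum_congr rfl fun a _ => ?_
      split_ifs
      · rw [mul_pow, Real.sq_sqrt (by positivity)]
      · simp
    rw [e1, e2] at h1
    exact h1
  have hX1 : X ≤ C * ∑ j ∈ J, (C⁻¹ * Q j) * X ^ (((h : ℝ) - 1) / h) := by
    refine (expMoment_le_sum_valuation h (by omega) (fun a : B => (a : ℕ))
      (fun a => hB a a.2) F hF0 p hp J fun a => Finset.mem_image_of_mem _ a.2).trans ?_
    refine mul_le_mul_of_nonneg_left (Finset.sum_le_sum fun j _ => ?_) hC0.le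
    refine (integral_sq_mul_pow_le h hh _ _ (continuous_expSum _ _).norm
      (continuous_expSum _ _).norm (fun _ => norm_nonneg _)).trans ?_
    refine mul_le_mul_of_nonneg_right ?_ (Real.rpow_nonneg hX0 _)
    have h2 : 0 ≤ C⁻¹ * Q j := mul_nonneg (by positivity) (hQ0 j)
    calc _ ≤ ((C⁻¹ * Q j) ^ h) ^ (1 / (h : ℝ)) :=
          Real.rpow_le_rpow (expMoment_nonneg _ _ _) (hmom j) (by positivity)
      _ = C⁻¹ * Q j := by rw [one_div, Real.pow_rpow_inv_natCast h2 (by omega)]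
  rw [← Finset.sum_mul, ← Finset.mul_sum, ← mul_assoc, mul_inv_cancel_left₀ hC0.ne', hQsum] at hX1
  rcases hX0.eq_or_lt with h0 | h0
  · rw [← h0]
    positivity
  · have h3 : X ^ (1 / (h : ℝ)) ≤ ∑ a ∈ B, g a ^ 2 := by
      have h4 : 0 < X ^ (((h : ℝ) - 1) / h) := Real.rpow_pos_of_pos h0 _
      refine le_of_mul_le_mul_right ?_ h4
      rw [← Real.rpow_add h0]
      have : 1 / (h : ℝ) + ((h : ℝ) - 1) / h = 1 := by field_simp; ring
      rwa [this, Real.rpow_one]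
    calc X = (X ^ (1 / (h : ℝ))) ^ h := by
          rw [one_div, Real.rpow_inv_natCast_pow hX0 (by omega)]
      _ ≤ _ := pow_le_pow_left₀ (by positivity) h3 _

/-- Concentration bound for sums of independent elements distributed along an admissible weight. -/
lemma AdmissibleWeight.sum_concentration_le {h : ℕ} {ω : ℕ → ℝ}
    (hω : AdmissibleWeight h ω) (B : Finset ℕ) (hB : ∀ a ∈ B, 0 < a) (hV : 0 < ∑ a ∈ B, ω a)
    {κ : Type*} [Fintype κ] [DecidableEq κ] (hκ : Fintype.card κ = 2 * h) (z : ℤ) :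
    (∑ x : κ → B, if ∑ i, ((x i : ℕ) : ℤ) = z then ∏ i, ω (x i) / ∑ a ∈ B, ω a else 0) ≤
      ((∑ a ∈ B, ω a)⁻¹) ^ h := by
  set V := ∑ a ∈ B, ω a with hVdef
  have h1 := sum_relations_le_integral (fun a : B => ((a : ℕ) : ℤ)) (fun _ : κ => (1 : ℤ))
    (fun _ => Or.inl rfl) (fun _ a => ω a / V) z
  simp only [one_mul] at h1
  refine h1.trans ?_
  simp only [Finset.prod_const, Finset.card_univ, hκ]
  have h2 := hω.2 B hB (fun a => √(ω a) / V) (fun a => by positivity)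
  have e1 : (fun a : B => √(ω a) / V * √(ω a)) = fun a : B => ω a / V := by
    ext a
    rw [div_mul_eq_mul_div, Real.mul_self_sqrt (hω.1 _)]
  have e2 : ∑ a ∈ B, (√(ω a) / V) ^ 2 = V⁻¹ := by
    have : ∀ a ∈ B, (√(ω a) / V) ^ 2 = ω a / V ^ 2 := fun a _ => by
      rw [div_pow, Real.sq_sqrt (hω.1 _)]
    rw [Finset.sum_congr rfl this, ← Finset.sum_div, ← hVdef]
    field_simp
  rw [e1, e2] at h2
  exact h2

lemma sum_prod_eq_one {α κ : Type*} [Fintype α] [Fintype κ] [DecidableEq κ] (ν : α → ℝ)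
    (hν1 : ∑ a, ν a = 1) : ∑ y : κ → α, ∏ i, ν (y i) = 1 := by
  rw [← Fintype.prod_sum fun (_ : κ) a => ν a]
  simp [hν1]

/-- Conditioning on the coordinates outside `P`. -/
lemma sum_rel_le_of_fiber {α ι : Type*} [Fintype α] [Fintype ι] [DecidableEq ι] (ν : α → ℝ)
    (hν0 : ∀ a, 0 ≤ ν a) (hν1 : ∑ a, ν a = 1) (P : ι → Prop) [DecidablePred P]
    (R : (ι → α) → Prop) [DecidablePred R] (K : ℝ)
    (hK : ∀ y : {i // ¬P i} → α, (∑ u : {i // P i} → α,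
      if R ((Equiv.piEquivPiSubtypeProd P fun _ => α).symm (u, y)) then ∏ i, ν (u i) else 0) ≤ K) :
    (∑ x : ι → α, if R x then ∏ i, ν (x i) else 0) ≤ K := by
  rw [← Equiv.sum_comp (Equiv.piEquivPiSubtypeProd P fun _ => α).symm, Fintype.sum_prod_type_right]
  have h1 : ∀ (y : {i // ¬P i} → α) (u : {i // P i} → α),
      (if R ((Equiv.piEquivPiSubtypeProd P fun _ => α).symm (u, y)) then
        ∏ i, ν ((Equiv.piEquivPiSubtypeProd P fun _ => α).symm (u, y) i) else 0) =
      (∏ i, ν (y i)) * if R ((Equiv.piEquivPiSubtypeProd P fun _ => α).symm (u, y)) then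
        ∏ i, ν (u i) else 0 := by
    intro y u
    have : ∏ i, ν ((Equiv.piEquivPiSubtypeProd P fun _ => α).symm (u, y) i) =
        (∏ i, ν (u i)) * ∏ i, ν (y i) := by
      rw [← Fintype.prod_subtype_mul_prod_subtype P]
      congr 1 <;> refine Finset.prod_congr rfl fun i _ => ?_
      · simp [Equiv.piEquivPiSubtypeProd, i.2]
      · simp [Equiv.piEquivPiSubtypeProd, i.2]
    rw [this]
    split_ifs <;> ring
  simp_rw [h1, ← Finset.mul_sum]
  calc _ ≤ ∑ y : {i // ¬P i} → α, (∏ i, ν (y i)) * K :=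
        Finset.sum_le_sum fun y _ =>
          mul_le_mul_of_nonneg_left (hK y) (Finset.prod_nonneg fun _ _ => hν0 _)
    _ = K := by rw [← Finset.sum_mul, sum_prod_eq_one ν hν1, one_mul]

open scoped Classical in
/-- The largest probability that a product of `n` independent `φ`-values equals a given point is
at most `K`. -/
def ProdConcentrationLE {α M : Type*} [Fintype α] [CommGroup M] (ν : α → ℝ) (φ : α → M) (n : ℕ)
    (K : ℝ) : Prop :=
  ∀ z : M, (∑ u : Fin n → α, if ∏ i, φ (u i) = z then ∏ i, ν (u i) else 0) ≤ K

open scoped Classical in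
lemma ProdConcentrationLE.of_card {α M κ : Type*} [Fintype α] [CommGroup M] {ν : α → ℝ} {φ : α → M}
    {n : ℕ} {K : ℝ} (hK : ProdConcentrationLE ν φ n K) [Fintype κ] [DecidableEq κ]
    (hκ : Fintype.card κ = n) (z : M) :
    (∑ u : κ → α, if ∏ i, φ (u i) = z then ∏ i, ν (u i) else 0) ≤ K := by
  have e : κ ≃ Fin n := Fintype.equivFinOfCardEq hκ
  refine le_trans (le_of_eq ?_) (hK z)
  rw [← Equiv.sum_comp (e.arrowCongr (Equiv.refl α))]
  refine Finset.sum_congr rfl fun u _ => ?_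
  have h1 : ∏ i, φ ((e.arrowCongr (Equiv.refl α)) u i) = ∏ i, φ (u i) := by
    rw [← Equiv.prod_comp e]; simp
  have h2 : ∏ i, ν ((e.arrowCongr (Equiv.refl α)) u i) = ∏ i, ν (u i) := by
    rw [← Equiv.prod_comp e]; simp
  rw [h1, h2]

open scoped Classical in
/-- The probability that the random tuple satisfies the relation with exponents `ε`. -/
noncomputable def relWeight {α M : Type*} [Fintype α] [CommGroup M] (ν : α → ℝ) (φ : α → M) {m : ℕ}
    (ε : Fin m → SignType) : ℝ :=
  ∑ x : Fin m → α, if ∏ i, φ (x i) ^ (ε i : ℤ) = 1 then ∏ i, ν (x i) else 0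

open scoped Classical in
lemma relWeight_le_of_pred {α M : Type*} [Fintype α] [CommGroup M] (ν : α → ℝ)
    (hν0 : ∀ a, 0 ≤ ν a) (hν1 : ∑ a, ν a = 1) (φ : α → M) {n m : ℕ} {K : ℝ}
    (hK : ProdConcentrationLE ν φ n K) (ε : Fin m → SignType) (s : SignType) (hs : s ≠ 0)
    (P : Fin m → Prop) (hcard : Fintype.card {i // P i} = n) (hP : ∀ i, P i → ε i = s) :
    relWeight ν φ ε ≤ K := by
  refine sum_rel_le_of_fiber ν hν0 hν1 P
    (fun x => ∏ i, φ (x i) ^ (ε i : ℤ) = 1) K fun y => ?_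
  set Y : M := ∏ i : {i // ¬P i}, φ (y i) ^ (ε i : ℤ) with hY
  refine le_trans (le_of_eq ?_) (hK.of_card hcard (Y⁻¹ ^ (s : ℤ)))
  refine Finset.sum_congr rfl fun u _ => ?_
  have h1 : ∏ i, φ ((Equiv.piEquivPiSubtypeProd P fun _ => α).symm (u, y) i) ^
      (ε i : ℤ) = (∏ i, φ (u i)) ^ (s : ℤ) * Y := by
    rw [← Fintype.prod_subtype_mul_prod_subtype P, hY, ← Finset.prod_zpow]
    congr 1 <;> refine Finset.prod_congr rfl fun i _ => ?_
    · simp [Equiv.piEquivPiSubtypeProd, i.2, hP i i.2]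
    · simp [Equiv.piEquivPiSubtypeProd, i.2]
  rw [h1]
  have h2 : ((∏ i, φ (u i)) ^ (s : ℤ) * Y = 1) ↔ (∏ i, φ (u i)) = Y⁻¹ ^ (s : ℤ) := by
    rw [mul_eq_one_iff_eq_inv]
    rcases s with _ | _ | _
    · exact absurd rfl hs
    · simp [inv_eq_iff_eq_inv]
    · simp
  simp only [h2]

lemma relWeight_le_of_sign {α M : Type*} [Fintype α] [CommGroup M] (ν : α → ℝ)
    (hν0 : ∀ a, 0 ≤ ν a) (hν1 : ∑ a, ν a = 1) (φ : α → M) {n m : ℕ} {K : ℝ}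
    (hK : ProdConcentrationLE ν φ n K) (ε : Fin m → SignType) (s : SignType) (hs : s ≠ 0)
    (hcard : n ≤ (univ.filter fun i => ε i = s).card) : relWeight ν φ ε ≤ K := by
  classical
  obtain ⟨T, hT, hTn⟩ := Finset.exists_subset_card_eq hcard
  refine relWeight_le_of_pred ν hν0 hν1 φ hK ε s hs (fun i => i ∈ T) ?_
    fun i hi => (Finset.mem_filter.1 (hT hi)).2
  rw [← hTn]
  convert Fintype.card_coe T

lemma card_sparse_sign_le (m t : ℕ) (hm : 1 ≤ m) :
    ((univ.filter fun ε : Fin m → SignType => (univ.filter fun i => ε i ≠ 0).card < t).card : ℝ) ≤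
      3 * (2 * (m : ℝ)) ^ t := by
  have hm0 : (0 : ℝ) < m := by exact_mod_cast hm
  have hm1 : (1 : ℝ) ≤ m := by exact_mod_cast hm
  set y : ℝ := (2 * (m : ℝ))⁻¹ with hy
  have hy0 : 0 < y := by positivity
  have hy1 : y ≤ 1 := inv_le_one_of_one_le₀ (by linarith)
  have h1 : ∑ ε : Fin m → SignType, y ^ (univ.filter fun i => ε i ≠ 0).card = (1 + 2 * y) ^ m := by
    have h2 : ∀ ε : Fin m → SignType, y ^ (univ.filter fun i => ε i ≠ 0).card =
        ∏ i, if ε i ≠ 0 then y else 1 := by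
      intro ε
      rw [Finset.prod_ite, Finset.prod_const, Finset.prod_const_one, mul_one]
    simp_rw [h2]
    rw [← Fintype.prod_sum fun (_ : Fin m) (s : SignType) => if s ≠ 0 then y else 1]
    have h3 : ∑ s : SignType, (if s ≠ 0 then y else 1) = 1 + 2 * y := by
      have : (univ : Finset SignType) = {0, -1, 1} := rfl
      rw [this]
      simp
      ring
    rw [h3, Finset.prod_const, Finset.card_univ, Fintype.card_fin]
  have h4 : (1 + 2 * y) ^ m ≤ 3 := by
    have h5 : 1 + 2 * y ≤ Real.exp (2 * y) := by linarith [Real.add_one_le_exp (2 * y)]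
    calc (1 + 2 * y) ^ m ≤ (Real.exp (2 * y)) ^ m := pow_le_pow_left₀ (by positivity) h5 _
      _ = Real.exp 1 := by
        rw [← Real.exp_nat_mul]
        congr 1
        rw [hy]
        field_simp
      _ ≤ 3 := by linarith [Real.exp_one_lt_d9]
  have h6 : ((univ.filter fun ε : Fin m → SignType =>
      (univ.filter fun i => ε i ≠ 0).card < t).card : ℝ) * y ^ t ≤ 3 := by
    refine le_trans ?_ (h1.trans_le h4)
    rw [← nsmul_eq_mul, ← Finset.sum_const]
    refine (Finset.sum_le_sum fun ε hε => ?_).trans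
      (Finset.sum_le_sum_of_subset_of_nonneg (Finset.filter_subset _ _) fun _ _ _ => by positivity)
    exact pow_le_pow_of_le_one hy0.le hy1 (Finset.mem_filter.1 hε).2.le
  have h7 : y ^ t = ((2 * (m : ℝ)) ^ t)⁻¹ := by rw [hy, inv_pow]
  rw [h7, ← div_eq_mul_inv, div_le_iff₀ (by positivity)] at h6
  exact h6

open scoped Classical in
/-- A random tuple avoids all relations when products concentrate little. -/
lemma exists_free_tuple {α M : Type*} [Fintype α] [CommGroup M] (ν : α → ℝ)
    (hν0 : ∀ a, 0 ≤ ν a) (hν1 : ∑ a, ν a = 1) (φ : α → M) {n m : ℕ} (hm : 1 ≤ m) {K₁ K : ℝ}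
    (hK1 : ProdConcentrationLE ν φ 1 K₁) (hK : ProdConcentrationLE ν φ n K) (hK10 : 0 ≤ K₁)
    (hK0 : 0 ≤ K) (hlt : 3 * (2 * (m : ℝ)) ^ (2 * n) * K₁ + 3 ^ m * K < 1) :
    ∃ x : Fin m → α, ∀ ε : Fin m → SignType, ∏ i, φ (x i) ^ (ε i : ℤ) = 1 → ε = 0 := by
  by_contra! hcon
  choose e he1 he0 using hcon
  have hone := sum_prod_eq_one (κ := Fin m) ν hν1
  set D : Finset (Fin m → SignType) := univ.filter fun ε => ε ≠ 0 with hD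
  have h1 : 1 ≤ ∑ ε ∈ D, relWeight ν φ ε := by
    unfold relWeight
    rw [Finset.sum_comm, ← hone]
    refine Finset.sum_le_sum fun x _ => ?_
    have := Finset.single_le_sum (s := D) (f := fun ε : Fin m → SignType =>
      if ∏ i, φ (x i) ^ (ε i : ℤ) = 1 then ∏ i, ν (x i) else 0)
      (fun ε _ => by
        split_ifs
        · exact Finset.prod_nonneg fun i _ => hν0 _
        · exact le_rfl) (a := e x) (by simp [hD, he0 x])
    simpa [he1 x] using this
  have hpos : ∀ ε ∈ D, relWeight ν φ ε ≤ K₁ := by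
    intro ε hε
    have hε0 : ε ≠ 0 := (Finset.mem_filter.1 hε).2
    obtain ⟨i, hi⟩ := Function.ne_iff.1 hε0
    refine relWeight_le_of_sign ν hν0 hν1 φ hK1 ε (ε i) hi ?_
    exact Finset.card_pos.2 ⟨i, by simp⟩
  have hbig : ∀ ε : Fin m → SignType, 2 * n ≤ (univ.filter fun i => ε i ≠ 0).card →
      relWeight ν φ ε ≤ K := by
    intro ε hε
    have hsub : (univ.filter fun i => ε i ≠ 0) ⊆
        (univ.filter fun i => ε i = 1) ∪ (univ.filter fun i => ε i = -1) := by
      intro i hi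
      simp only [Finset.mem_filter, Finset.mem_univ, true_and, Finset.mem_union] at hi ⊢
      rcases h : ε i with _ | _ | _
      · exact absurd h hi
      · exact Or.inr rfl
      · exact Or.inl rfl
    have h2 := (Finset.card_le_card hsub).trans (Finset.card_union_le _ _)
    rcases le_or_gt n (univ.filter fun i => ε i = 1).card with h3 | h3
    · exact relWeight_le_of_sign ν hν0 hν1 φ hK ε 1 (by decide) h3
    · exact relWeight_le_of_sign ν hν0 hν1 φ hK ε (-1) (by decide) (by omega)
  have hsplit : ∀ ε ∈ D, relWeight ν φ ε ≤
      (if (univ.filter fun i => ε i ≠ 0).card < 2 * n then K₁ else 0) + K := by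
    intro ε hε
    split_ifs with h
    · linarith [hpos ε hε]
    · linarith [hbig ε (not_lt.1 h)]
  have h5 : ∑ ε ∈ D, relWeight ν φ ε ≤ 3 * (2 * (m : ℝ)) ^ (2 * n) * K₁ + 3 ^ m * K := by
    calc _ ≤ ∑ ε ∈ D, ((if (univ.filter fun i => ε i ≠ 0).card < 2 * n then K₁ else 0) + K) :=
          Finset.sum_le_sum hsplit
      _ ≤ ∑ ε : Fin m → SignType,
          ((if (univ.filter fun i => ε i ≠ 0).card < 2 * n then K₁ else 0) + K) :=
          Finset.sum_le_sum_of_subset_of_nonneg (Finset.filter_subset _ _) fun _ _ _ => by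
            split_ifs <;> positivity
      _ = ((univ.filter fun ε : Fin m → SignType =>
          (univ.filter fun i => ε i ≠ 0).card < 2 * n).card : ℝ) * K₁ + 3 ^ m * K := by
          rw [Finset.sum_add_distrib, ← Finset.sum_filter, Finset.sum_const, Finset.sum_const,
            nsmul_eq_mul, nsmul_eq_mul]
          have : Fintype.card SignType = 3 := rfl
          simp [this]
      _ ≤ _ := by
          gcongr
          exact card_sparse_sign_le m (2 * n) hm
  linarith

lemma SignType.coe_sign_of_abs_le_one (k : ℤ) (hk : |k| ≤ 1) : ((SignType.sign k : SignType) : ℤ) = k := by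
  rw [abs_le] at hk
  obtain ⟨h1, h2⟩ := hk
  interval_cases k <;> rfl

lemma injective_of_free_tuple {α M : Type*} [CommGroup M] (φ : α → M) {m : ℕ}
    (x : Fin m → α) (hx : ∀ ε : Fin m → SignType, ∏ i, φ (x i) ^ (ε i : ℤ) = 1 → ε = 0) :
    Function.Injective fun i => φ (x i) := by
  intro i j hij
  by_contra hne
  have h1 := hx (fun k => if k = i then 1 else if k = j then -1 else 0) (by
    rw [← Finset.mul_prod_erase _ _ (Finset.mem_univ i),
      ← Finset.mul_prod_erase _ _ (Finset.mem_erase.2 ⟨Ne.symm hne, Finset.mem_univ j⟩),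
      Finset.prod_eq_one]
    · have hji : j ≠ i := Ne.symm hne
      have hij' : φ (x i) = φ (x j) := hij
      simp [hji, hij']
    · intro k hk
      simp only [Finset.mem_erase, Finset.mem_univ, and_true] at hk
      simp [hk.1, hk.2])
  have := congrFun h1 i
  simp at this

lemma prodConcentrationLE_one {α M : Type*} [Fintype α] [CommGroup M] (ν : α → ℝ) (φ : α → M)
    (hφ : Function.Injective φ) {K : ℝ} (hK0 : 0 ≤ K) (hK : ∀ a, ν a ≤ K) :
    ProdConcentrationLE ν φ 1 K := by
  classical
  intro z
  rw [← Equiv.sum_comp (Equiv.funUnique (Fin 1) α).symm]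
  simp only [Equiv.funUnique_symm_apply, uniqueElim_const, Finset.univ_unique, Finset.prod_const,
    Finset.card_singleton, pow_one]
  by_cases h : ∃ a, φ a = z
  · obtain ⟨a, ha⟩ := h
    rw [Finset.sum_eq_single a]
    · rw [if_pos ha]
      exact hK a
    · intro b _ hb
      rw [if_neg]
      intro hbz
      exact hb (hφ (hbz.trans ha.symm))
    · intro h
      exact absurd (Finset.mem_univ a) h
  · rw [Finset.sum_eq_zero]
    · exact hK0
    · intro a _
      rw [if_neg fun ha => h ⟨a, ha⟩]

/-- Natural numbers as units of `ℚ`, with `0` sent to `1`. -/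
noncomputable def natUnit (n : ℕ) : ℚˣ := if h : (n : ℚ) = 0 then 1 else Units.mk0 n h

lemma coe_natUnit {n : ℕ} (hn : 0 < n) : ((natUnit n : ℚˣ) : ℚ) = n := by
  have : (n : ℚ) ≠ 0 := by exact_mod_cast hn.ne'
  simp [natUnit, this]

lemma natUnit_mul {a b : ℕ} (ha : 0 < a) (hb : 0 < b) :
    natUnit (a * b) = natUnit a * natUnit b := by
  ext
  rw [Units.val_mul, coe_natUnit ha, coe_natUnit hb, coe_natUnit (Nat.mul_pos ha hb)]
  push_cast
  rfl

lemma natUnit_inj {a b : ℕ} (ha : 0 < a) (hb : 0 < b) (hab : natUnit a = natUnit b) : a = b := by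
  have := congrArg (fun u : ℚˣ => (u : ℚ)) hab
  simp only [coe_natUnit ha, coe_natUnit hb] at this
  exact_mod_cast this

/-- The distribution of a product of `2 ^ j` independent elements is an iterated convolution. -/
lemma sum_prod_natUnit_eq (B : Finset ℕ) (hB : ∀ a ∈ B, 0 < a) (f : ℕ → ℝ) (j : ℕ) :
    ∀ (κ : Type) [Fintype κ] [DecidableEq κ], Fintype.card κ = 2 ^ j → ∀ F : ℚˣ → ℝ,
      ∑ x : κ → B, (∏ i, f (x i)) * F (∏ i, natUnit (x i)) =
        ∑ n ∈ iterSupp B j, iterConv B f j n * F (natUnit n) := by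
  induction j with
  | zero =>
    intro κ _ _ hκ F
    rw [pow_zero] at hκ
    have e : κ ≃ Fin 1 := Fintype.equivFinOfCardEq hκ
    have : Unique κ := e.unique
    rw [← Equiv.sum_comp (Equiv.funUnique κ B).symm]
    simp only [Equiv.funUnique_symm_apply, uniqueElim_const, Finset.univ_unique, Finset.prod_const,
      Finset.card_singleton, pow_one]
    rw [Finset.sum_coe_sort B fun a => f a * F (natUnit a)]
    rfl
  | succ j ih =>
    intro κ _ _ hκ F
    set κ' := Fin (2 ^ j) with hκ'
    have e : κ' ⊕ κ' ≃ κ := Fintype.equivOfCardEq (by simp [hκ, hκ']; ring)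
    have h1 : ∑ x : κ → B, (∏ i, f (x i)) * F (∏ i, natUnit (x i)) =
        ∑ x : κ' ⊕ κ' → B, (∏ i, f (x i)) * F (∏ i, natUnit (x i)) := by
      rw [← Equiv.sum_comp (e.arrowCongr (Equiv.refl B))]
      refine Finset.sum_congr rfl fun u _ => ?_
      rw [← Equiv.prod_comp e fun i => f ((e.arrowCongr (Equiv.refl B)) u i),
        ← Equiv.prod_comp e fun i => natUnit ((e.arrowCongr (Equiv.refl B)) u i)]
      simp
    rw [h1, ← Equiv.sum_comp (Equiv.sumArrowEquivProdArrow κ' κ' B).symm, Fintype.sum_prod_type]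
    have h2 : ∀ x y : κ' → B,
        (∏ i, f ((Equiv.sumArrowEquivProdArrow κ' κ' B).symm (x, y) i)) *
          F (∏ i, natUnit ((Equiv.sumArrowEquivProdArrow κ' κ' B).symm (x, y) i)) =
        (∏ i, f (x i)) * ((∏ i, f (y i)) *
          F ((∏ i, natUnit (x i)) * ∏ i, natUnit (y i))) := by
      intro x y
      simp [Equiv.sumArrowEquivProdArrow, Fintype.prod_sum_type, mul_assoc]
    simp_rw [h2, ← Finset.mul_sum]
    have h3 : ∀ u : ℚˣ, ∑ y : κ' → B, (∏ i, f (y i)) * F (u * ∏ i, natUnit (y i)) =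
        ∑ n ∈ iterSupp B j, iterConv B f j n * F (u * natUnit n) := fun u =>
      ih κ' (by simp [hκ']) fun v => F (u * v)
    simp_rw [h3]
    rw [ih κ' (by simp [hκ']) fun u => ∑ n ∈ iterSupp B j, iterConv B f j n * F (u * natUnit n)]
    have h4 := sum_mulSelfConv (iterSupp B j) (iterConv B f j) (fun n => F (natUnit n))
    have h5 : ∑ n ∈ iterSupp B (j + 1), iterConv B f (j + 1) n * F (natUnit n) =
        ∑ n ∈ iterSupp B j * iterSupp B j,
          F (natUnit n) * mulSelfConv (iterSupp B j) (iterConv B f j) n :=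
      Finset.sum_congr rfl fun n _ => mul_comm _ _
    rw [h5, h4]
    refine Finset.sum_congr rfl fun a ha => ?_
    congr 1
    refine Finset.sum_congr rfl fun b hb => ?_
    rw [natUnit_mul (iterSupp_pos B hB j a ha) (iterSupp_pos B hB j b hb), mul_comm]

lemma prodConcentrationLE_iterConv (B : Finset ℕ) (hB : ∀ a ∈ B, 0 < a) (f : ℕ → ℝ)
    (hf : ∀ a, 0 ≤ f a) (j : ℕ) :
    ProdConcentrationLE (fun a : B => f a) (fun a : B => natUnit a) (2 ^ (j + 1))
      (∑ a ∈ iterSupp B j, iterConv B f j a ^ 2) := by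
  classical
  intro z
  have h1 := sum_prod_natUnit_eq B hB f (j + 1) (Fin (2 ^ (j + 1))) (by simp)
    (fun u => if u = z then 1 else 0)
  simp only [mul_ite, mul_one, mul_zero] at h1
  refine le_trans (b := ∑ n ∈ iterSupp B (j + 1),
    if natUnit n = z then iterConv B f (j + 1) n else 0) (le_of_eq ?_) ?_
  · convert h1
  set S := iterSupp B j with hS
  set g := iterConv B f j with hg
  have hg0 : ∀ n, 0 ≤ g n := iterConv_nonneg B f hf j
  have h4 := sum_mulSelfConv S g (fun n => if natUnit n = z then 1 else 0)
  have h5 : ∑ n ∈ iterSupp B (j + 1), (if natUnit n = z then iterConv B f (j + 1) n else 0) =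
      ∑ n ∈ S * S, (if natUnit n = z then 1 else 0) * mulSelfConv S g n :=
    Finset.sum_congr rfl fun n _ => by
      rw [ite_mul, one_mul, zero_mul]
      rfl
  rw [h5, h4]
  have hpos := iterSupp_pos B hB j
  have huniq : ∀ a ∈ S, ∑ b ∈ S, (if natUnit (a * b) = z then (1 : ℝ) else 0) ≤ 1 := by
    intro a ha
    rw [Finset.sum_ite, Finset.sum_const_zero, add_zero, Finset.sum_const, nsmul_eq_mul, mul_one]
    have : (S.filter fun b => natUnit (a * b) = z).card ≤ 1 := by
      rw [Finset.card_le_one]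
      intro b hb b' hb'
      rw [Finset.mem_filter] at hb hb'
      have h6 := natUnit_inj (Nat.mul_pos (hpos a ha) (hpos b hb.1))
        (Nat.mul_pos (hpos a ha) (hpos b' hb'.1)) (hb.2.trans hb'.2.symm)
      exact Nat.eq_of_mul_eq_mul_left (hpos a ha) h6
    exact_mod_cast this
  have hterm : ∀ a b, g a * ((if natUnit (a * b) = z then (1 : ℝ) else 0) * g b) ≤
      1 / 2 * (g a ^ 2 * (if natUnit (a * b) = z then (1 : ℝ) else 0)) +
      1 / 2 * (g b ^ 2 * (if natUnit (b * a) = z then (1 : ℝ) else 0)) := by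
    intro a b
    rw [mul_comm b a]
    split_ifs
    · nlinarith [sq_nonneg (g a - g b)]
    · simp
  have hhalf : ∑ a ∈ S, ∑ b ∈ S, g a ^ 2 * (if natUnit (a * b) = z then (1 : ℝ) else 0) ≤
      ∑ a ∈ S, g a ^ 2 := by
    refine Finset.sum_le_sum fun a ha => ?_
    rw [← Finset.mul_sum]
    exact mul_le_of_le_one_right (sq_nonneg _) (huniq a ha)
  calc ∑ a ∈ S, g a * ∑ b ∈ S, (if natUnit (a * b) = z then (1 : ℝ) else 0) * g b
      ≤ ∑ a ∈ S, ∑ b ∈ S, (1 / 2 * (g a ^ 2 * (if natUnit (a * b) = z then (1 : ℝ) else 0)) +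
      1 / 2 * (g b ^ 2 * (if natUnit (b * a) = z then (1 : ℝ) else 0))) := by
        refine Finset.sum_le_sum fun a _ => ?_
        rw [Finset.mul_sum]
        exact Finset.sum_le_sum fun b _ => hterm a b
    _ = 1 / 2 * ∑ a ∈ S, ∑ b ∈ S, g a ^ 2 * (if natUnit (a * b) = z then (1 : ℝ) else 0) +
        1 / 2 * ∑ a ∈ S, ∑ b ∈ S, g a ^ 2 * (if natUnit (a * b) = z then (1 : ℝ) else 0) := by
        simp only [Finset.sum_add_distrib, ← Finset.mul_sum]
        congr 2
        simp only [Finset.mul_sum]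
        rw [Finset.sum_comm]
    _ ≤ _ := by linarith

lemma card_le_addDim {A Λ : Finset ℤ} (hΛ : Λ ⊆ A) (hdis : IsKDissociated 1 Λ) :
    Λ.card ≤ addDim 1 A := by
  refine le_csSup ⟨A.card, ?_⟩ ⟨Λ, hΛ, rfl, hdis⟩
  rintro n ⟨Λ', hΛ', rfl, -⟩
  exact Finset.card_le_card hΛ'

lemma card_le_mulDim {A Λ : Finset ℤ} (hΛ : Λ ⊆ A) (h0 : (0 : ℤ) ∉ Λ) (hdis : IsMulDissociated Λ) :
    Λ.card ≤ mulDim A := by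
  refine le_csSup ⟨A.card, ?_⟩ ⟨Λ, hΛ, h0, rfl, hdis⟩
  rintro n ⟨Λ', hΛ', -, rfl, -⟩
  exact Finset.card_le_card hΛ'

lemma le_addDim_of_free_tuple {A : Finset ℤ} {B : Finset ℕ} (σ : ℤ) (hσ : σ = 1 ∨ σ = -1)
    (hBA : ∀ b ∈ B, σ * (b : ℤ) ∈ A) {m : ℕ} (x : Fin m → B)
    (hx : ∀ ε : Fin m → SignType,
      ∏ i, (Multiplicative.ofAdd ((x i : ℕ) : ℤ)) ^ (ε i : ℤ) = 1 → ε = 0) :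
    m ≤ addDim 1 A := by
  have hσ0 : σ ≠ 0 := by rcases hσ with h | h <;> simp [h]
  have hinj := injective_of_free_tuple (fun a : B => Multiplicative.ofAdd ((a : ℕ) : ℤ)) x hx
  have hinj' : Function.Injective fun i => σ * ((x i : ℕ) : ℤ) := fun i j hij =>
    hinj (congrArg Multiplicative.ofAdd (mul_left_cancel₀ hσ0 hij))
  have hcard : (univ.image fun i => σ * ((x i : ℕ) : ℤ)).card = m := by
    rw [Finset.card_image_of_injective _ hinj', Finset.card_univ, Fintype.card_fin]
  rw [← hcard]
  refine card_le_addDim ?_ ?_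
  · intro a ha
    obtain ⟨i, -, rfl⟩ := Finset.mem_image.1 ha
    exact hBA _ (x i).2
  · intro ε hε hsum
    rw [Finset.sum_image fun i _ j _ hij => hinj' hij] at hsum
    have hε' : ∀ i, |ε (σ * ((x i : ℕ) : ℤ))| ≤ 1 := fun i => by
      exact_mod_cast hε _ (Finset.mem_image_of_mem _ (Finset.mem_univ i))
    have h0 := hx (fun i => SignType.sign (ε (σ * ((x i : ℕ) : ℤ)))) (by
      simp only [SignType.coe_sign_of_abs_le_one _ (hε' _), ← ofAdd_zsmul]
      rw [← ofAdd_sum, ofAdd_eq_one]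
      have h1 : σ * ∑ i, ε (σ * ((x i : ℕ) : ℤ)) • ((x i : ℕ) : ℤ) = 0 := by
        rw [← hsum, Finset.mul_sum]
        exact Finset.sum_congr rfl fun i _ => by simp only [smul_eq_mul]; ring
      exact (mul_eq_zero.1 h1).resolve_left hσ0)
    intro a ha
    obtain ⟨i, -, rfl⟩ := Finset.mem_image.1 ha
    exact sign_eq_zero_iff.1 (congrFun h0 i)

lemma le_mulDim_of_free_tuple {A : Finset ℤ} {B : Finset ℕ} (hB : ∀ b ∈ B, 0 < b) (σ : ℤ)
    (hσ : σ = 1 ∨ σ = -1) (hBA : ∀ b ∈ B, σ * (b : ℤ) ∈ A) {m : ℕ} (x : Fin m → B)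
    (hx : ∀ ε : Fin m → SignType, ∏ i, natUnit (x i) ^ (ε i : ℤ) = 1 → ε = 0) :
    m ≤ mulDim A := by
  have hσ0 : σ ≠ 0 := by rcases hσ with h | h <;> simp [h]
  have hinj := injective_of_free_tuple (fun a : B => natUnit a) x hx
  have hpos : ∀ i, 0 < (x i : ℕ) := fun i => hB _ (x i).2
  have hinj' : Function.Injective fun i => σ * ((x i : ℕ) : ℤ) := fun i j hij => by
    refine hinj (congrArg natUnit ?_)
    exact_mod_cast mul_left_cancel₀ hσ0 hij
  have hcard : (univ.image fun i => σ * ((x i : ℕ) : ℤ)).card = m := by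
    rw [Finset.card_image_of_injective _ hinj', Finset.card_univ, Fintype.card_fin]
  rw [← hcard]
  refine card_le_mulDim ?_ ?_ ?_
  · intro a ha
    obtain ⟨i, -, rfl⟩ := Finset.mem_image.1 ha
    exact hBA _ (x i).2
  · intro h0
    obtain ⟨i, -, hi⟩ := Finset.mem_image.1 h0
    rcases mul_eq_zero.1 hi with h | h
    · exact hσ0 h
    · exact (hpos i).ne' (by exact_mod_cast h)
  · intro ε hε hprod
    rw [Finset.prod_image fun i _ j _ hij => hinj' hij] at hprod
    have hε' : ∀ i, |ε (σ * ((x i : ℕ) : ℤ))| ≤ 1 := fun i =>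
      hε _ (Finset.mem_image_of_mem _ (Finset.mem_univ i))
    have h0 := hx (fun i => SignType.sign (ε (σ * ((x i : ℕ) : ℤ)))) (by
      simp only [SignType.coe_sign_of_abs_le_one _ (hε' _)]
      ext
      rw [Units.coe_prod, Units.val_one]
      have h1 := congrArg (fun q : ℚ => |q|) hprod
      simp only [Finset.abs_prod, abs_one, abs_zpow] at h1
      rw [← h1]
      refine Finset.prod_congr rfl fun i _ => ?_
      rw [Units.val_zpow_eq_zpow_val, coe_natUnit (hpos i)]
      congr 1
      rcases hσ with h | h <;> simp [h])
    intro a ha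
    obtain ⟨i, -, rfl⟩ := Finset.mem_image.1 ha
    exact sign_eq_zero_iff.1 (congrFun h0 i)

lemma le_addDim_of_admissible {A : Finset ℤ} {B : Finset ℕ} (hB : ∀ b ∈ B, 0 < b) (σ : ℤ)
    (hσ : σ = 1 ∨ σ = -1) (hBA : ∀ b ∈ B, σ * (b : ℤ) ∈ A) {h m : ℕ} (hh : 1 ≤ h) (hm : 1 ≤ m)
    {ω : ℕ → ℝ} (hω : AdmissibleWeight h ω) {s : ℝ} (hs : 0 < s) (hV : s ≤ ∑ a ∈ B, ω a)
    (hlt : 3 * (2 * (m : ℝ)) ^ (2 * (2 * h)) * s⁻¹ + 3 ^ m * s⁻¹ ^ h < 1) :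
    m ≤ addDim 1 A := by
  have hV0 : 0 < ∑ a ∈ B, ω a := hs.trans_le hV
  have hVs : (∑ a ∈ B, ω a)⁻¹ ≤ s⁻¹ := inv_anti₀ hs hV
  obtain ⟨x, hx⟩ := exists_free_tuple (fun a : B => ω a / ∑ a ∈ B, ω a)
    (fun a => div_nonneg (hω.1 _) hV0.le)
    (by rw [← Finset.sum_div, Finset.sum_coe_sort B ω, div_self hV0.ne'])
    (fun a : B => Multiplicative.ofAdd ((a : ℕ) : ℤ)) (n := 2 * h) hm (K₁ := s⁻¹) (K := s⁻¹ ^ h)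
    (by
      refine prodConcentrationLE_one _ _ (fun a b hab => ?_) (by positivity) fun a => ?_
      · have : ((a : ℕ) : ℤ) = ((b : ℕ) : ℤ) := Multiplicative.ofAdd.injective hab
        exact Subtype.ext (by exact_mod_cast this)
      · refine le_trans ?_ hVs
        rw [div_eq_mul_inv]
        exact mul_le_of_le_one_left (by positivity) (hω.le_one hh _ (hB _ a.2)))
    (by
      intro z
      refine le_trans (le_of_eq ?_) ((hω.sum_concentration_le B hB hV0 (κ := Fin (2 * h))
        (by simp) (Multiplicative.toAdd z)).trans (pow_le_pow_left₀ (by positivity) hVs h))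
      refine Finset.sum_congr rfl fun u _ => ?_
      have : (∏ i, Multiplicative.ofAdd (((u i : B) : ℕ) : ℤ) = z) ↔
          ∑ i, (((u i : B) : ℕ) : ℤ) = Multiplicative.toAdd z := by
        rw [← ofAdd_sum]
        exact Multiplicative.ofAdd.eq_symm_apply.symm
      simp only [this])
    (by positivity) (by positivity) hlt
  exact le_addDim_of_free_tuple σ hσ hBA x hx

lemma le_mulDim_of_not_admissible {A : Finset ℤ} {B : Finset ℕ} (hB : ∀ b ∈ B, 0 < b)
    (hB0 : B.Nonempty) (σ : ℤ) (hσ : σ = 1 ∨ σ = -1) (hBA : ∀ b ∈ B, σ * (b : ℤ) ∈ A)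
    {h m j : ℕ} (hh : 2 ≤ h) (hm : 1 ≤ m) {b : ℝ} (hb : 0 < b) (hb1 : b ≤ 1 / 2)
    (hC : (4 * (h : ℝ) ^ 2) ^ b ≤ 1 + 1 / 10 ^ 13)
    (hV : ∀ ω, AdmissibleWeight h ω → ∑ a ∈ B, ω a ≤ √B.card)
    (hlt : 3 * (2 * (m : ℝ)) ^ (2 * 2 ^ (j + 1)) * (B.card : ℝ)⁻¹ +
      3 ^ m * (((√B.card)⁻¹) ^ b) ^ j < 1) :
    m ≤ mulDim A := by
  have hN : (0 : ℝ) < B.card := by exact_mod_cast hB0.card_pos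
  have hh0 : (0 : ℝ) < h := by exact_mod_cast (by omega : 0 < h)
  have hsum : ∑ _a ∈ B, (B.card : ℝ)⁻¹ = 1 := by
    rw [Finset.sum_const, nsmul_eq_mul, mul_inv_cancel₀ hN.ne']
  have hconv := sum_sq_iterConv_le (AdmissibleWeight h) b (4 * (h : ℝ) ^ 2) (√B.card)⁻¹ hb hb1
    (by positivity) hC (fun ω hω => hω.1) (fun a _ => AdmissibleWeight.exists_point h a)
    (fun p hp w hw => AdmissibleWeight.glue hh p hp w hw) (fun ω hω x hx => hω.dilate x hx)
    B hB (fun _ => (B.card : ℝ)⁻¹) (fun _ => by positivity) hsum (by positivity)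
    (fun ω hω => by
      rw [← Finset.sum_mul, ← div_eq_mul_inv, div_le_iff₀ hN]
      refine (hV ω hω).trans (le_of_eq ?_)
      rw [eq_inv_mul_iff_mul_eq₀ (Real.sqrt_pos.2 hN).ne', Real.mul_self_sqrt hN.le]) j
  obtain ⟨x, hx⟩ := exists_free_tuple (fun _ : B => (B.card : ℝ)⁻¹) (fun _ => by positivity)
    (by rw [Finset.sum_coe_sort B fun _ => (B.card : ℝ)⁻¹, hsum])
    (fun a : B => natUnit a) (n := 2 ^ (j + 1)) hm
    (prodConcentrationLE_one _ _
      (fun a b hab => Subtype.ext (natUnit_inj (hB _ a.2) (hB _ b.2) hab)) (by positivity)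
      fun _ => le_rfl)
    (fun z => (prodConcentrationLE_iterConv B hB (fun _ => (B.card : ℝ)⁻¹)
      (fun _ => by positivity) j z).trans hconv)
    (by positivity) (by positivity) hlt
  exact le_mulDim_of_free_tuple hB σ hσ hBA x hx

lemma three_pow_le_two_rpow {m : ℕ} {t : ℝ} (hm : 2 * (m : ℝ) ≤ t) : (3 : ℝ) ^ m ≤ 2 ^ t := by
  calc (3 : ℝ) ^ m ≤ 4 ^ m := pow_le_pow_left₀ (by norm_num) (by norm_num) _
    _ = (2 : ℝ) ^ (2 * (m : ℝ)) := by
        rw [Real.rpow_mul (by norm_num), Real.rpow_natCast]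
        norm_num
    _ ≤ _ := Real.rpow_le_rpow_of_exponent_le (by norm_num) hm

lemma two_rpow_le_quarter {t : ℝ} (ht : t ≤ -2) : (2 : ℝ) ^ t ≤ 1 / 4 := by
  calc (2 : ℝ) ^ t ≤ 2 ^ (-2 : ℝ) := Real.rpow_le_rpow_of_exponent_le (by norm_num) ht
    _ = 1 / 4 := by
      rw [Real.rpow_neg (by norm_num)]
      norm_num

lemma sparse_relations_numeric {L : ℝ} (hL : 10 ^ 16 ≤ L) {h m : ℕ} (hh : 2 ≤ h)
    (hhL : 4 * (h : ℝ) ^ 2 ≤ Real.logb 2 L) (hm : 1 ≤ m) (hmL : 2 * (m : ℝ) ≤ h * L) {k : ℕ}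
    (hk : k ≤ 4 * 2 ^ (h ^ 2)) :
    3 * (2 * (m : ℝ)) ^ k * 2 ^ (-(L / 2)) ≤ 1 / 4 := by
  have hL0 : 0 < L := by linarith
  set l := Real.logb 2 L with hl
  set q : ℝ := 2 ^ (l / 4) with hq
  have hq0 : 0 < q := by positivity
  have hq4 : q ^ 4 = L := by
    rw [hq, ← Real.rpow_natCast, ← Real.rpow_mul (by norm_num)]
    have : l / 4 * ((4 : ℕ) : ℝ) = l := by push_cast; ring
    rw [this, hl, Real.rpow_logb (by norm_num) (by norm_num) hL0]
  have hq1 : 10 ^ 4 ≤ q := by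
    refine le_of_pow_le_pow_left₀ (n := 4) (by norm_num) hq0.le ?_
    rw [hq4]
    norm_num at hL ⊢
    exact hL
  have hlog2 : 0.69 < Real.log 2 := by linarith [Real.log_two_gt_d9]
  have hh' : (2 : ℝ) ≤ h := by exact_mod_cast hh
  have hl0 : 0 < l := by nlinarith
  have hlq : l ≤ 6 * q := by
    have h1 : l / 4 * Real.log 2 + 1 ≤ q := by
      rw [hq, Real.rpow_def_of_pos (by norm_num), mul_comm]
      exact Real.add_one_le_exp _
    nlinarith
  have hT : ((2 : ℝ) ^ (h ^ 2)) ≤ q := by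
    rw [hq, ← Real.rpow_natCast]
    refine Real.rpow_le_rpow_of_exponent_le (by norm_num) ?_
    push_cast
    linarith
  have hhL' : (h : ℝ) ≤ L := by
    have : q ≤ q ^ 4 := le_self_pow₀ (by linarith) (by norm_num)
    nlinarith
  have h2m : 2 * (m : ℝ) ≤ 2 ^ (2 * l) := by
    have : (2 : ℝ) ^ (2 * l) = L * L := by
      rw [two_mul, Real.rpow_add (by norm_num), hl, Real.rpow_logb (by norm_num) (by norm_num) hL0]
    rw [this]
    nlinarith
  have hm1 : (1 : ℝ) ≤ 2 * (m : ℝ) := by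
    have : (1 : ℝ) ≤ m := by exact_mod_cast hm
    linarith
  have h3 : (2 * (m : ℝ)) ^ k ≤ 2 ^ (2 * l * (4 * q)) := by
    calc (2 * (m : ℝ)) ^ k ≤ (2 * (m : ℝ)) ^ (4 * 2 ^ (h ^ 2)) := pow_le_pow_right₀ hm1 hk
      _ ≤ ((2 : ℝ) ^ (2 * l)) ^ (4 * 2 ^ (h ^ 2)) := pow_le_pow_left₀ (by positivity) h2m _
      _ = (2 : ℝ) ^ (2 * l * ((4 * 2 ^ (h ^ 2) : ℕ) : ℝ)) := by
          rw [Real.rpow_mul_natCast (by norm_num)]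
      _ ≤ _ := by
          refine Real.rpow_le_rpow_of_exponent_le (by norm_num) ?_
          push_cast
          gcongr
  have h4 : 2 * l * (4 * q) + -(L / 2) ≤ -4 := by
    rw [← hq4]
    have h5 : 2 * l * (4 * q) ≤ 48 * q ^ 2 := by nlinarith
    have h6 : 10 ^ 8 * q ^ 2 ≤ q ^ 4 := by nlinarith [sq_nonneg q]
    nlinarith
  calc 3 * (2 * (m : ℝ)) ^ k * 2 ^ (-(L / 2)) ≤ 3 * 2 ^ (2 * l * (4 * q)) * 2 ^ (-(L / 2)) := by
        gcongr
    _ = 3 * 2 ^ (2 * l * (4 * q) + -(L / 2)) := by rw [mul_assoc, Real.rpow_add (by norm_num)]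
    _ ≤ 3 * 2 ^ (-4 : ℝ) := by
        gcongr
        norm_num
    _ ≤ 1 / 4 := by
        rw [Real.rpow_neg (by norm_num)]
        norm_num

lemma glue_constant_rpow_le {h : ℕ} (hh : 2 ≤ h) :
    (4 * (h : ℝ) ^ 2) ^ ((1 / 10 ^ 14 : ℝ) / h) ≤ 1 + 1 / 10 ^ 13 := by
  have hh0 : (0 : ℝ) < h := by exact_mod_cast (by omega : 0 < h)
  have h1 : (4 * (h : ℝ) ^ 2) = (2 * (h : ℝ)) ^ 2 := by ring
  rw [h1, Real.rpow_def_of_pos (by positivity), Real.log_pow]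
  have h2 : Real.log (2 * (h : ℝ)) ≤ 2 * h := by
    linarith [Real.log_le_sub_one_of_pos (by positivity : (0 : ℝ) < 2 * h)]
  have h3 : ((2 : ℕ) : ℝ) * Real.log (2 * (h : ℝ)) * ((1 / 10 ^ 14 : ℝ) / h) ≤ 4 / 10 ^ 14 := by
    rw [mul_div_assoc', div_le_iff₀ hh0]
    push_cast
    nlinarith
  refine (Real.exp_le_exp.2 h3).trans ?_
  have := Real.abs_exp_sub_one_le (x := (4 / 10 ^ 14 : ℝ)) (by norm_num [abs_of_pos])
  rw [abs_le] at this
  have h4 : |(4 / 10 ^ 14 : ℝ)| = 4 / 10 ^ 14 := abs_of_pos (by norm_num)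
  rw [h4] at this
  norm_num at this ⊢
  linarith [this.2]

/-- The quantitative core of the lower bound. -/
theorem le_max_dim {A : Finset ℤ} {B : Finset ℕ} (hB : ∀ b ∈ B, 0 < b) (σ : ℤ)
    (hσ : σ = 1 ∨ σ = -1) (hBA : ∀ b ∈ B, σ * (b : ℤ) ∈ A) {h m : ℕ} (hh : 2 ≤ h) (hm : 1 ≤ m)
    (hL : 10 ^ 16 ≤ Real.logb 2 B.card)
    (hhL : 4 * (h : ℝ) ^ 2 ≤ Real.logb 2 (Real.logb 2 B.card))
    (hmL : (m : ℝ) ≤ 1 / 10 ^ 14 * h * Real.logb 2 B.card / 8) :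
    m ≤ max (addDim 1 A) (mulDim A) := by
  set L := Real.logb 2 B.card with hLdef
  have hL0 : 0 < L := by linarith
  have hh' : (2 : ℝ) ≤ h := by exact_mod_cast hh
  have hhL2 : 2 * L ≤ h * L := by nlinarith
  have hB0 : B.Nonempty := by
    rw [Finset.nonempty_iff_ne_empty]
    rintro rfl
    simp [hLdef] at hL0
  have hN : (0 : ℝ) < B.card := by exact_mod_cast hB0.card_pos
  have hNL : (B.card : ℝ) = 2 ^ L := by
    rw [hLdef, Real.rpow_logb (by norm_num) (by norm_num) hN]
  have hs : (√B.card : ℝ) = 2 ^ (L / 2) := by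
    rw [hNL, Real.sqrt_eq_rpow, ← Real.rpow_mul (by norm_num)]
    congr 1
    ring
  have hsinv : (√B.card : ℝ)⁻¹ = 2 ^ (-(L / 2)) := by rw [hs, Real.rpow_neg (by norm_num)]
  have hNinv : (B.card : ℝ)⁻¹ ≤ 2 ^ (-(L / 2)) := by
    rw [hNL, ← Real.rpow_neg (by norm_num)]
    exact Real.rpow_le_rpow_of_exponent_le (by norm_num) (by linarith)
  have hm2 : 2 * (m : ℝ) ≤ 1 / 10 ^ 14 * h * L / 4 := by linarith
  have hm3 : 2 * (m : ℝ) ≤ h * L := by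
    refine hm2.trans ?_
    norm_num
    nlinarith
  have h3 := three_pow_le_two_rpow hm2
  by_cases hcase : ∃ ω, AdmissibleWeight h ω ∧ √B.card ≤ ∑ a ∈ B, ω a
  · obtain ⟨ω, hω, hV⟩ := hcase
    refine le_max_of_le_left (le_addDim_of_admissible hB σ hσ hBA (by omega) hm hω
      (Real.sqrt_pos.2 hN) hV ?_)
    rw [hsinv]
    have h4 := sparse_relations_numeric hL hh hhL hm hm3 (k := 2 * (2 * h)) (by
      have : h < 2 ^ h := Nat.lt_two_pow_self
      have : 2 ^ h ≤ 2 ^ (h ^ 2) := Nat.pow_le_pow_right (by norm_num) (Nat.le_self_pow (by norm_num) h)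
      omega)
    have h5 : (3 : ℝ) ^ m * (2 ^ (-(L / 2))) ^ h ≤ 1 / 4 := by
      rw [← Real.rpow_natCast ((2 : ℝ) ^ (-(L / 2))), ← Real.rpow_mul (by norm_num)]
      refine (mul_le_mul_of_nonneg_right h3 (by positivity)).trans ?_
      rw [← Real.rpow_add (by norm_num)]
      refine two_rpow_le_quarter ?_
      norm_num
      nlinarith
    linarith
  · push Not at hcase
    have hb : (0 : ℝ) < (1 / 10 ^ 14 : ℝ) / h := by positivity
    refine le_max_of_le_right (le_mulDim_of_not_admissible hB hB0 σ hσ hBA (j := h ^ 2) hh hm hb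
      ?_ (glue_constant_rpow_le hh) (fun ω hω => (hcase ω hω).le) ?_)
    · rw [div_le_iff₀ (by positivity)]
      norm_num
      linarith
    · have h4 := sparse_relations_numeric hL hh hhL hm hm3 (k := 2 * 2 ^ (h ^ 2 + 1)) (by
        rw [pow_succ]
        omega)
      have h6 : 3 * (2 * (m : ℝ)) ^ (2 * 2 ^ (h ^ 2 + 1)) * (B.card : ℝ)⁻¹ ≤ 1 / 4 :=
        (mul_le_mul_of_nonneg_left hNinv (by positivity)).trans h4
      have h5 : (3 : ℝ) ^ m * (((√B.card)⁻¹) ^ ((1 / 10 ^ 14 : ℝ) / h)) ^ (h ^ 2) ≤ 1 / 4 := by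
        rw [hsinv, ← Real.rpow_mul (by norm_num), ← Real.rpow_mul_natCast (by norm_num)]
        refine (mul_le_mul_of_nonneg_right h3 (by positivity)).trans ?_
        rw [← Real.rpow_add (by norm_num)]
        refine two_rpow_le_quarter ?_
        have h7 : -(L / 2) * ((1 / 10 ^ 14 : ℝ) / h) * ((h ^ 2 : ℕ) : ℝ) =
            -(1 / 10 ^ 14 * h * L / 2) := by
          push_cast
          field_simp
        rw [h7]
        nlinarith
      linarith

lemma exists_signed_part (A : Finset ℤ) (hA : 2 ≤ A.card) :
    ∃ (B : Finset ℕ) (σ : ℤ), (∀ b ∈ B, 0 < b) ∧ (σ = 1 ∨ σ = -1) ∧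
      (∀ b ∈ B, σ * (b : ℤ) ∈ A) ∧ A.card ≤ 4 * B.card := by
  have hsub : A ⊆ (A.filter fun a => 0 < a) ∪ (A.filter fun a => a < 0) ∪ {0} := by
    intro a ha
    simp only [Finset.mem_union, Finset.mem_filter, ha, true_and, Finset.mem_singleton]
    omega
  have h1 := (Finset.card_le_card hsub).trans (Finset.card_union_le _ _)
  have h2 := Finset.card_union_le (A.filter fun a => 0 < a) (A.filter fun a => a < 0)
  rw [Finset.card_singleton] at h1
  have key : ∀ σ : ℤ, (σ = 1 ∨ σ = -1) → A.card ≤ 4 * (A.filter fun a => 0 < σ * a).card →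
      ∃ (B : Finset ℕ) (σ : ℤ), (∀ b ∈ B, 0 < b) ∧ (σ = 1 ∨ σ = -1) ∧
      (∀ b ∈ B, σ * (b : ℤ) ∈ A) ∧ A.card ≤ 4 * B.card := by
    intro σ hσ hcard
    have hσσ : σ * σ = 1 := by rcases hσ with h | h <;> simp [h]
    refine ⟨(A.filter fun a => 0 < σ * a).image fun a => (σ * a).toNat, σ, ?_, hσ, ?_, ?_⟩
    · intro b hb
      obtain ⟨a, ha, rfl⟩ := Finset.mem_image.1 hb
      have := (Finset.mem_filter.1 ha).2
      omega
    · intro b hb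
      obtain ⟨a, ha, rfl⟩ := Finset.mem_image.1 hb
      rw [Finset.mem_filter] at ha
      rw [Int.toNat_of_nonneg ha.2.le, ← mul_assoc, hσσ, one_mul]
      exact ha.1
    · rw [Finset.card_image_of_injOn]
      · exact hcard
      · intro a ha b hb hab
        have ha' := (Finset.mem_filter.1 ha).2
        have hb' := (Finset.mem_filter.1 hb).2
        have h3 : σ * a = σ * b := by
          rw [← Int.toNat_of_nonneg ha'.le, ← Int.toNat_of_nonneg hb'.le]
          exact congrArg _ hab
        calc a = σ * (σ * a) := by rw [← mul_assoc, hσσ, one_mul]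
          _ = b := by rw [h3, ← mul_assoc, hσσ, one_mul]
  have e1 : (A.filter fun a => 0 < (1 : ℤ) * a) = A.filter fun a => 0 < a := by simp
  have e2 : (A.filter fun a => 0 < (-1 : ℤ) * a) = A.filter fun a => a < 0 := by
    refine Finset.filter_congr fun a _ => ?_
    omega
  by_cases h : A.card ≤ 4 * (A.filter fun a => 0 < a).card
  · exact key 1 (Or.inl rfl) (by rwa [e1])
  · refine key (-1) (Or.inr rfl) ?_
    rw [e2]
    omega

lemma one_le_addDim (A : Finset ℤ) (hA : 2 ≤ A.card) : 1 ≤ addDim 1 A := by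
  obtain ⟨a, ha, ha0⟩ := Finset.exists_mem_ne (by omega : 1 < A.card) (0 : ℤ)
  have := card_le_addDim (A := A) (Λ := {a}) (by simpa using ha) (by
    intro ε _ hsum
    simpa [ha0] using hsum)
  simpa using this

theorem max_dim_lower_bound :
    ∃ c : ℝ, 0 < c ∧ ∀ A : Finset ℤ, 2 ^ 16 ≤ A.card →
      c * Real.logb 2 A.card * √(Real.logb 2 (Real.logb 2 A.card)) ≤
        (max (addDim 1 A) (mulDim A) : ℕ) := by
  refine ⟨1 / 10 ^ 40, by norm_num, fun A hA => ?_⟩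
  have hA0 : (2 : ℝ) ^ 16 ≤ A.card := by exact_mod_cast hA
  have hApos : (0 : ℝ) < A.card := by linarith [show (0 : ℝ) < 2 ^ 16 by norm_num]
  set LA := Real.logb 2 A.card with hLA
  have hLA16 : 16 ≤ LA := by
    rw [hLA, Real.le_logb_iff_rpow_le (by norm_num) hApos]
    exact_mod_cast hA0
  set l := Real.logb 2 LA with hl
  have hl4 : 4 ≤ l := by
    rw [hl, Real.le_logb_iff_rpow_le (by norm_num) (by linarith)]
    norm_num
    exact hLA16
  have hlLA : l ≤ LA := by
    have h1 : Real.log LA ≤ LA / 2 := by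
      have := Real.log_le_sub_one_of_pos (by linarith : 0 < LA / 4)
      rw [Real.log_div (by linarith) (by norm_num), show (4 : ℝ) = 2 ^ 2 by norm_num,
        Real.log_pow] at this
      push_cast at this
      linarith [Real.log_two_lt_d9]
    rw [hl, Real.logb, div_le_iff₀ (Real.log_pos (by norm_num))]
    nlinarith [Real.log_two_gt_d9]
  have hsl : √l ≤ l := by
    rw [Real.sqrt_le_left (by linarith)]
    nlinarith
  rcases le_or_gt (4 * 10 ^ 16) LA with hbig | hsmall
  · obtain ⟨B, σ, hB, hσ, hBA, hcard⟩ := exists_signed_part A (by omega)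
    have hcard' : (A.card : ℝ) / 4 ≤ B.card := by
      rw [div_le_iff₀ (by norm_num), mul_comm]
      exact_mod_cast hcard
    set L := Real.logb 2 B.card with hL
    have hLLA : LA - 2 ≤ L := by
      have h1 : Real.logb 2 ((A.card : ℝ) / 4) = LA - 2 := by
        rw [Real.logb_div hApos.ne' (by norm_num), show (4 : ℝ) = 2 ^ (2 : ℝ) by norm_num,
          Real.logb_rpow (by norm_num) (by norm_num)]
      rw [← h1, hL]
      exact Real.logb_le_logb_of_le (by norm_num) (by positivity) hcard'
    have hL2 : LA / 2 ≤ L := by linarith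
    have hL16 : 10 ^ 16 ≤ L := by linarith
    have hL0 : 0 < L := by linarith
    set k := Real.logb 2 L with hk
    have hkl : l - 1 ≤ k := by
      have h1 : Real.logb 2 (LA / 2) = l - 1 := by
        rw [Real.logb_div (by linarith) (by norm_num), Real.logb_self_eq_one (by norm_num)]
      rw [← h1, hk]
      exact Real.logb_le_logb_of_le (by norm_num) (by linarith) hL2
    have hk16 : 16 ≤ k := by
      rw [hk, Real.le_logb_iff_rpow_le (by norm_num) hL0]
      refine le_trans ?_ hL16
      norm_num
    have hsk : 4 ≤ √k := Real.le_sqrt_of_sq_le (by linarith)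
    have hskl : √l / 2 ≤ √k := by
      refine Real.le_sqrt_of_sq_le ?_
      rw [div_pow, Real.sq_sqrt (by linarith)]
      linarith
    set h := ⌊√k / 2⌋₊ with hh
    have hh1 : (h : ℝ) ≤ √k / 2 := Nat.floor_le (by positivity)
    have hh2 : √k / 2 < h + 1 := Nat.lt_floor_add_one _
    have hh3 : 2 ≤ h := Nat.le_floor (by push_cast; linarith)
    have hh4 : √k / 4 ≤ h := by
      have : (2 : ℝ) ≤ h := by exact_mod_cast hh3
      linarith
    have hhk : 4 * (h : ℝ) ^ 2 ≤ k := by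
      have h1 : (h : ℝ) ^ 2 ≤ (√k / 2) ^ 2 := pow_le_pow_left₀ (by positivity) hh1 2
      rw [div_pow, Real.sq_sqrt (by linarith)] at h1
      linarith
    set X : ℝ := 1 / 10 ^ 14 * h * L / 8 with hX
    have hh5 : (2 : ℝ) ≤ h := by exact_mod_cast hh3
    have hX2 : 2 ≤ X := by
      have : 2 * 10 ^ 16 ≤ h * L := mul_le_mul hh5 hL16 (by norm_num) (by positivity)
      rw [hX]
      norm_num at this ⊢
      linarith
    have hm1 : (⌊X⌋₊ : ℝ) ≤ X := Nat.floor_le (by linarith)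
    have hm2 : X < ⌊X⌋₊ + 1 := Nat.lt_floor_add_one _
    have hm3 : 1 ≤ ⌊X⌋₊ := Nat.le_floor (by push_cast; linarith)
    have hfin := le_max_dim hB σ hσ hBA hh3 hm3 hL16 hhk hm1
    have hfin' : (⌊X⌋₊ : ℝ) ≤ (max (addDim 1 A) (mulDim A) : ℕ) := by exact_mod_cast hfin
    refine le_trans ?_ hfin'
    have h7 : LA / 2 * (√l / 8) ≤ h * L := by
      rw [mul_comm (h : ℝ)]
      exact mul_le_mul hL2 (by linarith) (by positivity) hL0.le
    have h8 : 0 ≤ LA * √l := mul_nonneg (by linarith) (Real.sqrt_nonneg _)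
    have h9 : 1 / 10 ^ 40 * LA * √l ≤ X / 2 := by
      rw [hX]
      norm_num at h7 h8 ⊢
      linarith
    linarith
  · have h1 : (1 : ℝ) ≤ (max (addDim 1 A) (mulDim A) : ℕ) := by
      exact_mod_cast (one_le_addDim A (by omega)).trans (le_max_left _ _)
    refine le_trans ?_ h1
    have h2 : LA * √l ≤ (4 * 10 ^ 16) * (4 * 10 ^ 16) :=
      mul_le_mul hsmall.le (by linarith) (Real.sqrt_nonneg _) (by norm_num)
    norm_num at h2 ⊢
    linarith

lemma exists_dissociated_card_eq_addDim (A : Finset ℤ) :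
    ∃ Λ ⊆ A, Λ.card = addDim 1 A ∧ IsKDissociated 1 Λ := by
  refine Nat.sSup_mem (s := {n : ℕ | ∃ Λ : Finset ℤ, Λ ⊆ A ∧ Λ.card = n ∧ IsKDissociated 1 Λ})
    ⟨0, ∅, by simp, by simp, fun _ _ _ => by simp⟩ ⟨A.card, ?_⟩
  rintro n ⟨Λ, hΛ, rfl, -⟩
  exact Finset.card_le_card hΛ

lemma exists_mulDissociated_card_eq_mulDim (A : Finset ℤ) :
    ∃ Λ ⊆ A, (0 : ℤ) ∉ Λ ∧ Λ.card = mulDim A ∧ IsMulDissociated Λ := by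
  refine Nat.sSup_mem
    (s := {n : ℕ | ∃ Λ : Finset ℤ, Λ ⊆ A ∧ (0 : ℤ) ∉ Λ ∧ Λ.card = n ∧ IsMulDissociated Λ})
    ⟨0, ∅, by simp, by simp, by simp, fun _ _ _ => by simp⟩ ⟨A.card, ?_⟩
  rintro n ⟨Λ, hΛ, -, rfl, -⟩
  exact Finset.card_le_card hΛ

lemma abs_indicator_sub_indicator_le (S T : Finset ℤ) (x : ℤ) :
    |(if x ∈ S then (1 : ℤ) else 0) - if x ∈ T then 1 else 0| ≤ 1 := by
  split_ifs <;> simp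

lemma eq_of_indicator_sub_eq_zero {Λ S T : Finset ℤ} (hS : S ⊆ Λ) (hT : T ⊆ Λ)
    (h : ∀ x ∈ Λ, ((if x ∈ S then (1 : ℤ) else 0) - if x ∈ T then 1 else 0) = 0) : S = T := by
  ext x
  constructor
  · intro hx
    by_contra hx'
    simpa [hx, hx'] using h x (hS hx)
  · intro hx
    by_contra hx'
    simpa [hx, hx'] using h x (hT hx)

lemma IsKDissociated.injOn_sum {Λ : Finset ℤ} (h : IsKDissociated 1 Λ) :
    Set.InjOn (fun S : Finset ℤ => ∑ x ∈ S, x) Λ.powerset := by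
  intro S hS T hT hST
  rw [Finset.mem_coe, Finset.mem_powerset] at hS hT
  refine eq_of_indicator_sub_eq_zero hS hT (h _ (fun x _ => ?_) ?_)
  · exact_mod_cast abs_indicator_sub_indicator_le S T x
  · simp only [smul_eq_mul, sub_mul, ite_mul, one_mul, zero_mul, Finset.sum_sub_distrib,
      Finset.sum_ite_mem, Finset.inter_eq_right.2 hS, Finset.inter_eq_right.2 hT]
    exact sub_eq_zero.2 hST

lemma IsMulDissociated.injOn_prod {Λ : Finset ℤ} (h0 : (0 : ℤ) ∉ Λ) (h : IsMulDissociated Λ) :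
    Set.InjOn (fun S : Finset ℤ => ∏ x ∈ S, x) Λ.powerset := by
  intro S hS T hT hST
  rw [Finset.mem_coe, Finset.mem_powerset] at hS hT
  refine eq_of_indicator_sub_eq_zero hS hT
    (h _ (fun x _ => abs_indicator_sub_indicator_le S T x) ?_)
  have hne : ∀ x ∈ Λ, (x : ℚ) ≠ 0 := fun x hx hx0 => h0 (by
    rwa [show x = 0 by exact_mod_cast hx0] at hx)
  have hpow : ∀ U ⊆ Λ, ∏ x ∈ Λ, (x : ℚ) ^ (if x ∈ U then (1 : ℤ) else 0) = ∏ x ∈ U, (x : ℚ) := by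
    intro U hU
    calc _ = ∏ x ∈ Λ, if x ∈ U then (x : ℚ) else 1 :=
          Finset.prod_congr rfl fun x _ => by split_ifs <;> simp
      _ = _ := by rw [Finset.prod_ite_mem, Finset.inter_eq_right.2 hU]
  have hST' : ∏ x ∈ S, (x : ℚ) = ∏ x ∈ T, (x : ℚ) := by
    simpa only [Int.cast_prod] using congrArg (Int.cast : ℤ → ℚ) hST
  rw [Finset.prod_congr rfl fun x hx => zpow_sub₀ (hne x hx) _ _, Finset.prod_div_distrib,
    hpow S hS, hpow T hT, hST']
  exact div_self (Finset.prod_ne_zero_iff.2 fun x hx => hne x (hT hx))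

lemma succ_sq_le_two_pow (m : ℕ) : (m + 1) ^ 2 ≤ 2 ^ (m + 2) := by
  induction m with
  | zero => norm_num
  | succ m ih =>
    rcases lt_or_ge m 2 with h | h
    · interval_cases m <;> norm_num
    · rw [show m + 1 + 2 = (m + 2) + 1 from rfl, pow_succ 2 (m + 2)]
      nlinarith

/-- A dissociated subset of `[0, 4 ^ n]` has at most `4 n + 2` elements. -/
lemma IsKDissociated.card_le_of_le_four_pow {Λ : Finset ℤ} (h : IsKDissociated 1 Λ) {n : ℕ}
    (hpos : ∀ x ∈ Λ, 0 ≤ x) (hle : ∀ x ∈ Λ, x ≤ 4 ^ n) : Λ.card ≤ 4 * n + 2 := by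
  set m := Λ.card with hm
  have hmaps : Set.MapsTo (fun S : Finset ℤ => ∑ x ∈ S, x) Λ.powerset
      (Finset.Icc (0 : ℤ) (m * 4 ^ n) : Finset ℤ) := by
    intro S hS
    rw [Finset.mem_coe, Finset.mem_powerset] at hS
    rw [Finset.mem_coe, Finset.mem_Icc]
    refine ⟨Finset.sum_nonneg fun x hx => hpos x (hS hx), ?_⟩
    refine (Finset.sum_le_card_nsmul S _ (4 ^ n) fun x hx => hle x (hS hx)).trans ?_
    rw [nsmul_eq_mul]
    exact mul_le_mul_of_nonneg_right (by exact_mod_cast Finset.card_le_card hS) (by positivity)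
  have hcard := Finset.card_le_card_of_injOn _ hmaps h.injOn_sum
  rw [Finset.card_powerset, Int.card_Icc, ← hm] at hcard
  have hcard' : 2 ^ m ≤ m * 4 ^ n + 1 := by
    refine hcard.trans (le_of_eq ?_)
    rw [sub_zero]
    exact_mod_cast Int.toNat_natCast (m * 4 ^ n + 1)
  have h1 : 2 ^ m ≤ (m + 1) * 4 ^ n := by
    have : 1 ≤ 4 ^ n := Nat.one_le_pow _ _ (by norm_num)
    linarith [add_mul m 1 (4 ^ n)]
  have h2 : 2 ^ (m + m) ≤ 2 ^ (m + (4 * n + 2)) := by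
    calc 2 ^ (m + m) = (2 ^ m) ^ 2 := by ring
      _ ≤ ((m + 1) * 4 ^ n) ^ 2 := Nat.pow_le_pow_left h1 2
      _ = (m + 1) ^ 2 * 2 ^ (4 * n) := by
        rw [mul_pow, ← pow_mul, show (4 : ℕ) = 2 ^ 2 by norm_num, ← pow_mul]
        congr 2
        ring
      _ ≤ 2 ^ (m + 2) * 2 ^ (4 * n) := Nat.mul_le_mul_right _ (succ_sq_le_two_pow m)
      _ = _ := by rw [← pow_add]; congr 1; ring
  have := (Nat.pow_le_pow_iff_right (by norm_num)).1 h2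
  omega

lemma card_divisors_pow_of_squarefree {P : ℕ} (hP : Squarefree P) {m : ℕ} (hm : m ≠ 0) :
    (P ^ m).divisors.card = (m + 1) ^ P.primeFactors.card := by
  rw [Nat.card_divisors (pow_ne_zero _ hP.ne_zero), Nat.primeFactors_pow _ hm]
  refine Finset.prod_eq_pow_card fun p hp => ?_
  rw [Nat.factorization_pow, Finsupp.smul_apply, smul_eq_mul,
    Nat.factorization_eq_one_of_squarefree hP (Nat.prime_of_mem_primeFactors hp)
      (Nat.dvd_of_mem_primeFactors hp), mul_one]

/-- A multiplicatively dissociated set of divisors of a squarefree number with `k` prime factors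
has size `m` with `2 ^ m ≤ (m + 1) ^ k`. -/
lemma IsMulDissociated.two_pow_card_le {Λ : Finset ℤ} (h0 : (0 : ℤ) ∉ Λ) (h : IsMulDissociated Λ)
    {P : ℕ} (hP : Squarefree P) (hpos : ∀ x ∈ Λ, 0 < x) (hdvd : ∀ x ∈ Λ, x ∣ (P : ℤ)) :
    2 ^ Λ.card ≤ (Λ.card + 1) ^ P.primeFactors.card := by
  rcases Nat.eq_zero_or_pos Λ.card with hΛ | hΛ
  · simp [hΛ]
  rw [← card_divisors_pow_of_squarefree hP hΛ.ne', ← Finset.card_powerset,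
    ← Finset.card_map (s := (P ^ Λ.card).divisors) Nat.castEmbedding (β := ℤ)]
  refine Finset.card_le_card_of_injOn (fun S : Finset ℤ => ∏ x ∈ S, x) (fun S hS => ?_)
    (h.injOn_prod h0)
  rw [Finset.mem_coe, Finset.mem_powerset] at hS
  have hSpos : 0 < ∏ x ∈ S, x := Finset.prod_pos fun x hx => hpos x (hS hx)
  rw [Finset.mem_coe, Finset.mem_map]
  refine ⟨(∏ x ∈ S, x).toNat, ?_, Int.toNat_of_nonneg hSpos.le⟩
  rw [Nat.mem_divisors]
  refine ⟨?_, pow_ne_zero _ hP.ne_zero⟩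
  rw [← Int.natCast_dvd_natCast, Int.toNat_of_nonneg hSpos.le]
  calc ∏ x ∈ S, x ∣ ∏ _x ∈ S, (P : ℤ) := Finset.prod_dvd_prod_of_dvd _ _ fun x hx => hdvd x (hS hx)
    _ = (P : ℤ) ^ S.card := by rw [Finset.prod_const]
    _ ∣ (P : ℤ) ^ Λ.card := pow_dvd_pow _ (Finset.card_le_card hS)
    _ = ((P ^ Λ.card : ℕ) : ℤ) := by push_cast; rfl

lemma le_of_two_pow_le_succ_pow {m k : ℕ} (hk : 2 ≤ k) (h : 2 ^ m ≤ (m + 1) ^ k) :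
    (m : ℝ) ≤ 8 * k * Real.logb 2 k := by
  have hk' : (2 : ℝ) ≤ k := by exact_mod_cast hk
  have hL : 1 ≤ Real.logb 2 k := by
    rw [Real.le_logb_iff_rpow_le (by norm_num) (by positivity)]
    simpa using hk'
  have h1 : (m : ℝ) ≤ k * Real.logb 2 (m + 1) := by
    have h2 : ((2 : ℝ) ^ m) ≤ ((m : ℝ) + 1) ^ k := by exact_mod_cast h
    have h3 := Real.logb_le_logb_of_le (b := 2) (by norm_num) (by positivity) h2
    rwa [Real.logb_pow, Real.logb_pow, Real.logb_self_eq_one (by norm_num), mul_one] at h3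
  have hz : 0 < ((m : ℝ) + 1) / k := by positivity
  have h4 : Real.logb 2 (((m : ℝ) + 1) / k) ≤ ((m : ℝ) + 1) / k / 2 + 2 := by
    have h5 := Real.log_le_sub_one_of_pos (show 0 < ((m : ℝ) + 1) / k / 4 by positivity)
    rw [Real.log_div hz.ne' (by norm_num), show (4 : ℝ) = 2 ^ 2 by norm_num, Real.log_pow] at h5
    have h6 := Real.log_two_gt_d9
    rw [Real.logb, div_le_iff₀ (by linarith)]
    push_cast at h5
    nlinarith
  rw [Real.logb_div (by positivity) (by positivity)] at h4
  have h7 : (k : ℝ) * (((m : ℝ) + 1) / k / 2 + 2) = ((m : ℝ) + 1) / 2 + 2 * k := by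
    field_simp
  have h8 := mul_le_mul_of_nonneg_left h4 (by positivity : (0 : ℝ) ≤ k)
  rw [h7] at h8
  nlinarith

lemma exists_le_primeCounting (N : ℕ) :
    ∃ n : ℕ, N + 64 ≤ Nat.primeCounting n ∧
      (n : ℝ) ≤ 4 * Nat.primeCounting n * Real.logb 2 (Nat.primeCounting n) := by
  set M : ℕ := N + 64 with hM
  have hM64 : (64 : ℝ) ≤ M := by exact_mod_cast (by omega : 64 ≤ M)
  refine ⟨M ^ 2, ?_⟩
  set k := Nat.primeCounting (M ^ 2) with hk
  have hlogM : 0 < Real.log M := Real.log_pos (by linarith)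
  have hlogn : Real.log ((M : ℝ) ^ 2) = 2 * Real.log M := by rw [Real.log_pow]; norm_num
  have hlog4 : Real.log M ≤ M / 4 := by
    have h1 := Real.log_le_sub_one_of_pos (show 0 < (M : ℝ) / 16 by positivity)
    rw [Real.log_div (by positivity) (by norm_num), show (16 : ℝ) = 2 ^ 4 by norm_num,
      Real.log_pow] at h1
    have h2 := Real.log_two_lt_d9
    push_cast at h1
    linarith
  have hpi := Chebyshev.pi_ge (M ^ 2)
  push_cast at hpi
  rw [hlogn, div_le_iff₀ (by linarith)] at hpi
  have hlogn1 : Real.log ((M : ℝ) ^ 2 + 1) ≤ 2 * Real.log M + 1 := by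
    have h1 : (M : ℝ) ^ 2 + 1 ≤ M ^ 2 * Real.exp 1 := by
      have := Real.exp_one_gt_d9
      nlinarith
    have h2 := Real.log_le_log (by positivity) h1
    rwa [Real.log_mul (by positivity) (by positivity), Real.log_exp, hlogn] at h2
  have hl2 := Real.log_two_gt_d9
  have hhalf : (M : ℝ) ^ 2 / 2 ≤ k * (2 * Real.log M) := by nlinarith
  have hkM : (M : ℝ) ≤ k := by
    by_contra! hlt
    have : (k : ℝ) * (2 * Real.log M) < M * (2 * Real.log M) :=
      mul_lt_mul_of_pos_right hlt (by linarith)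
    nlinarith
  refine ⟨by exact_mod_cast hkM, ?_⟩
  have hmono : Real.log M ≤ Real.log k := Real.log_le_log (by linarith) hkM
  have hb : Real.log k ≤ Real.logb 2 k := by
    have := Real.log_two_lt_d9
    rw [Real.logb, le_div_iff₀ (by linarith)]
    nlinarith
  have hkpos : (0 : ℝ) ≤ k := by positivity
  have := mul_le_mul_of_nonneg_left (hmono.trans hb) hkpos
  push_cast
  linarith

/-- The divisors of a primorial have small additive and multiplicative dimension. -/
lemma max_dim_upper_bound (N : ℕ) : ∃ A : Finset ℤ, (∀ a ∈ A, 0 < a) ∧ N ≤ A.card ∧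
    ((max (addDim 1 A) (mulDim A) : ℕ) : ℝ) ≤
      20 * Real.logb 2 A.card * Real.logb 2 (Real.logb 2 A.card) := by
  obtain ⟨n, hkN, hn⟩ := exists_le_primeCounting N
  set k := Nat.primeCounting n with hk
  have hsq := squarefree_primorial n
  have hpf : (primorial n).primeFactors.card = k := by
    rw [primeFactors_primorial, hk, Nat.primesLE_card_eq_primeCounting]
  have hcard : ((primorial n).divisors.map (Nat.castEmbedding (R := ℤ))).card = 2 ^ k := by
    rw [Finset.card_map, ← hpf, ← card_divisors_pow_of_squarefree hsq one_ne_zero, pow_one]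
  have hmem : ∀ a ∈ (primorial n).divisors.map (Nat.castEmbedding (R := ℤ)),
      0 < a ∧ a ∣ (primorial n : ℤ) ∧ a ≤ 4 ^ n := by
    intro a ha
    obtain ⟨d, hd, rfl⟩ := Finset.mem_map.1 ha
    rw [Nat.castEmbedding_apply]
    have hdvd := Nat.dvd_of_mem_divisors hd
    have hle := (Nat.le_of_dvd (primorial_pos n) hdvd).trans (primorial_le_four_pow n)
    exact ⟨by exact_mod_cast Nat.pos_of_mem_divisors hd, by exact_mod_cast hdvd,
      by exact_mod_cast hle⟩
  refine ⟨_, fun a ha => (hmem a ha).1, ?_, ?_⟩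
  · rw [hcard]
    exact (by omega : N ≤ k).trans Nat.lt_two_pow_self.le
  have hk64 : (64 : ℝ) ≤ k := by exact_mod_cast (by omega : 64 ≤ k)
  have hL : 1 ≤ Real.logb 2 k := by
    rw [Real.le_logb_iff_rpow_le (by norm_num) (by positivity)]
    norm_num
    linarith
  rw [hcard, Nat.cast_pow, Nat.cast_ofNat, Real.logb_pow, Real.logb_self_eq_one (by norm_num),
    mul_one, Nat.cast_max]
  refine max_le ?_ ?_
  · obtain ⟨Λ, hΛ, hc, hdis⟩ := exists_dissociated_card_eq_addDim
      ((primorial n).divisors.map (Nat.castEmbedding (R := ℤ)))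
    have h1 := hdis.card_le_of_le_four_pow (fun x hx => (hmem x (hΛ hx)).1.le)
      fun x hx => (hmem x (hΛ hx)).2.2
    rw [hc] at h1
    have h2 : (addDim 1 ((primorial n).divisors.map (Nat.castEmbedding (R := ℤ))) : ℝ) ≤
        4 * n + 2 := by exact_mod_cast h1
    nlinarith
  · obtain ⟨Λ, hΛ, h0, hc, hdis⟩ := exists_mulDissociated_card_eq_mulDim
      ((primorial n).divisors.map (Nat.castEmbedding (R := ℤ)))
    have h1 := hdis.two_pow_card_le h0 hsq (fun x hx => (hmem x (hΛ hx)).1)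
      fun x hx => (hmem x (hΛ hx)).2.1
    rw [hc, hpf] at h1
    have h2 := le_of_two_pow_le_succ_pow (by omega) h1
    nlinarith

theorem stmt18 :
    -- lower bound
    (∃ c : ℝ, 0 < c ∧
      ∀ A : Finset ℤ, 2 ^ 16 ≤ A.card →
        c * Real.logb 2 A.card *
            Real.sqrt (Real.logb 2 (Real.logb 2 A.card) /
              Real.logb 2 (Real.logb 2 (Real.logb 2 A.card))) ≤
          (max (addDim 1 A) (mulDim A) : ℝ)) ∧
    -- upper bound
    (∃ C : ℝ, 0 < C ∧
      ∀ N : ℕ, ∃ A : Finset ℤ,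
        (∀ a ∈ A, 0 < a) ∧ N ≤ A.card ∧
        (max (addDim 1 A) (mulDim A) : ℝ) ≤
          C * Real.logb 2 A.card * Real.logb 2 (Real.logb 2 A.card)) := by
  obtain ⟨c, hc, hlow⟩ := max_dim_lower_bound
  refine ⟨⟨c, hc, fun A hA => ?_⟩, 20, by norm_num, fun N => ?_⟩
  · have hA' : (2 : ℝ) ^ (16 : ℝ) ≤ A.card := by
      rw [show (16 : ℝ) = ((16 : ℕ) : ℝ) by norm_num, Real.rpow_natCast]
      exact_mod_cast hA
    have h1 : (16 : ℝ) ≤ Real.logb 2 A.card := by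
      rwa [Real.le_logb_iff_rpow_le (by norm_num) (lt_of_lt_of_le (by positivity) hA')]
    have h2 : (4 : ℝ) ≤ Real.logb 2 (Real.logb 2 A.card) := by
      rw [Real.le_logb_iff_rpow_le (by norm_num) (by linarith)]
      norm_num
      exact h1
    have h3 : (1 : ℝ) ≤ Real.logb 2 (Real.logb 2 (Real.logb 2 A.card)) := by
      rw [Real.le_logb_iff_rpow_le (by norm_num) (by linarith)]
      norm_num
      linarith
    have h4 := hlow A hA
    rw [Nat.cast_max] at h4
    refine le_trans ?_ h4
    exact mul_le_mul_of_nonneg_left (Real.sqrt_le_sqrt (div_le_self (by linarith) h3))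
      (mul_nonneg hc.le (by linarith))
  · obtain ⟨A, hpos, hN, hA⟩ := max_dim_upper_bound N
    rw [Nat.cast_max] at hA
    exact ⟨A, hpos, hN, hA⟩
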